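/- arXiv:math/0701251 — 3 statements merged into one kernel-verified Lean document; each statement's English description precedes it below -/
import Mathlib

section
/- Let a_n be the coefficient of q^n in ∏_{m=1}^∞ (1 - q^m)^6. Let f : ℕ → ℤ be the multiplicative arithmetic function determined on prime powers p^r (r ≥ 1) by: f(p^r) = p^r if p ≡ 3 (mod 4) and r is even; if p ≡ 1 (mod 4), then, writing (u, v) for the unique pair of positive integers with p = u^2 + v^2, u odd and v even, f(p^r) is the integer whose image in ℂ equals (−1)^r·[(v^2 − u^2 + 2i·u·v)^{r+1} − (v^2 − u^2 − 2i·u·v)^{r+1}]/(4i·u·v); and f(p^r) = 0 in all remaining cases. Then a_n = f(4n + 1) for all n ≥ 0. -/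
namespace EtaSix

open Polynomial

/-- The Gaussian integers congruent to `1` modulo `2 + 2i`. -/
def IsPrimary (z : GaussianInt) : Prop :=
  (z.re + z.im) % 4 = 1 ∧ (z.re - z.im) % 4 = 1

instance : DecidablePred IsPrimary := fun z => by unfold IsPrimary; infer_instance

theorem IsPrimary.mul {z w : GaussianInt} (hz : IsPrimary z) (hw : IsPrimary w) :
    IsPrimary (z * w) := by
  obtain ⟨h1, h2⟩ := hz
  obtain ⟨h3, h4⟩ := hw
  obtain ⟨s, hs⟩ : ∃ s, w.re + w.im = 1 + 4 * s := ⟨(w.re + w.im) / 4, by omega⟩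
  obtain ⟨t, ht⟩ : ∃ t, w.re - w.im = 1 + 4 * t := ⟨(w.re - w.im) / 4, by omega⟩
  constructor
  · have : (z * w).re + (z * w).im = (z.re + z.im) + 4 * (z.re * s + z.im * t) := by
      simp only [Zsqrtd.re_mul, Zsqrtd.im_mul]
      linear_combination z.re * hs + z.im * ht
    omega
  · have : (z * w).re - (z * w).im = (z.re - z.im) + 4 * (z.re * t - z.im * s) := by
      simp only [Zsqrtd.re_mul, Zsqrtd.im_mul]
      linear_combination z.re * ht - z.im * hs
    omega

theorem IsPrimary.star {z : GaussianInt} (hz : IsPrimary z) : IsPrimary (star z) := by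
  obtain ⟨h1, h2⟩ := hz
  constructor
  · simpa [sub_eq_add_neg] using h2
  · simpa using h1

theorem IsPrimary.norm_mod_four {z : GaussianInt} (hz : IsPrimary z) : z.norm % 4 = 1 := by
  obtain ⟨h1, h2⟩ := hz
  obtain ⟨s, hs⟩ : ∃ s, z.re + z.im = 1 + 4 * s := ⟨(z.re + z.im) / 4, by omega⟩
  obtain ⟨t, ht⟩ : ∃ t, z.re - z.im = 1 + 4 * t := ⟨(z.re - z.im) / 4, by omega⟩
  have hr : z.re = 1 + 2 * (s + t) := by omega
  have hi : z.im = 2 * (s - t) := by omega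
  have : z.norm = 1 + 4 * (s + t + 2 * s ^ 2 + 2 * t ^ 2) := by
    rw [Zsqrtd.norm_def, hr, hi]; ring
  omega

theorem isPrimary_intCast {a : ℤ} : IsPrimary (a : GaussianInt) ↔ a % 4 = 1 := by
  simp [IsPrimary]

theorem star_mul_self_eq_norm (z : GaussianInt) : star z * z = ((z.norm : ℤ) : GaussianInt) := by
  rw [mul_comm, ← Zsqrtd.norm_eq_mul_conj]

theorem IsPrimary.of_mul_left {z w : GaussianInt} (hz : IsPrimary z) (hzw : IsPrimary (z * w)) :
    IsPrimary w := by
  have h := hz.star.mul hzw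
  rw [← mul_assoc, star_mul_self_eq_norm] at h
  obtain ⟨k, hk⟩ : ∃ k, z.norm = 1 + 4 * k :=
    ⟨z.norm / 4, by have := hz.norm_mod_four; omega⟩
  obtain ⟨h1, h2⟩ := h
  simp only [Zsqrtd.re_mul, Zsqrtd.im_mul, Zsqrtd.re_intCast, Zsqrtd.im_intCast, hk] at h1 h2
  ring_nf at h1 h2
  constructor <;> omega

/-- The primary Gaussian integers of norm `N`. -/
noncomputable def primaryOfNorm (N : ℕ) : Finset GaussianInt :=
  ((Finset.Icc (-(N : ℤ)) N ×ˢ Finset.Icc (-(N : ℤ)) N).image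
    fun p => (⟨p.1, p.2⟩ : GaussianInt)).filter fun z => z.norm = N ∧ IsPrimary z

theorem mem_primaryOfNorm {N : ℕ} {z : GaussianInt} :
    z ∈ primaryOfNorm N ↔ z.norm = N ∧ IsPrimary z := by
  simp only [primaryOfNorm, Finset.mem_filter, Finset.mem_image, Finset.mem_product,
    Finset.mem_Icc, and_iff_right_iff_imp]
  rintro ⟨h, -⟩
  rw [Zsqrtd.norm_def] at h
  refine ⟨(z.re, z.im), ⟨⟨?_, ?_⟩, ?_, ?_⟩, rfl⟩ <;> dsimp only <;>
    nlinarith [sq_nonneg z.re, sq_nonneg z.im, sq_nonneg (z.re + 1), sq_nonneg (z.re - 1),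
      sq_nonneg (z.im + 1), sq_nonneg (z.im - 1), Int.le_self_sq z.re, Int.le_self_sq z.im,
      Int.le_self_sq (-z.re), Int.le_self_sq (-z.im)]

/-- The sum of the squares of the primary Gaussian integers of norm `N`. -/
noncomputable def squareSum (N : ℕ) : GaussianInt := ∑ z ∈ primaryOfNorm N, z ^ 2

open scoped Classical in
theorem sum_filter_dvd_sq {d : GaussianInt} {D : ℕ} (hd : IsPrimary d) (hD : d.norm = D)
    (N : ℕ) :
    ∑ z ∈ primaryOfNorm (D * N) with d ∣ z, z ^ 2 = d ^ 2 * squareSum N := by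
  have hn : d.norm ≠ 0 := by have := hd.norm_mod_four; omega
  have hd0 : d ≠ 0 := by rintro rfl; simp at hn
  have : (primaryOfNorm (D * N)).filter (d ∣ ·) = (primaryOfNorm N).image (d * ·) := by
    ext z
    simp only [Finset.mem_filter, Finset.mem_image, mem_primaryOfNorm]
    constructor
    · rintro ⟨⟨h1, h2⟩, w, rfl⟩
      refine ⟨w, ⟨?_, hd.of_mul_left h2⟩, rfl⟩
      rw [Zsqrtd.norm_mul, Nat.cast_mul, ← hD] at h1
      exact mul_left_cancel₀ hn h1
    · rintro ⟨w, ⟨h1, h2⟩, rfl⟩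
      exact ⟨⟨by rw [Zsqrtd.norm_mul, hD, h1, Nat.cast_mul], hd.mul h2⟩, dvd_mul_right _ _⟩
  rw [this, Finset.sum_image fun a _ b _ h => mul_left_cancel₀ hd0 h, squareSum, Finset.mul_sum]
  simp only [mul_pow]

theorem prime_of_norm_eq_prime {z : GaussianInt} {p : ℕ} (hp : p.Prime) (h : z.norm = p) :
    Prime z := by
  apply Irreducible.prime
  have hn : z.norm.natAbs = p := by rw [h]; rfl
  refine ⟨fun hu => hp.one_lt.ne' ?_, fun a b hab => ?_⟩
  · rw [← hn, Zsqrtd.norm_eq_one_iff.2 hu]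
  · rw [hab, Zsqrtd.norm_mul, Int.natAbs_mul] at hn
    rcases Nat.prime_mul_iff.1 (hn ▸ hp) with h | h
    · exact Or.inr (Zsqrtd.norm_eq_one_iff.1 h.2)
    · exact Or.inl (Zsqrtd.norm_eq_one_iff.1 h.2)

theorem natCast_dvd_of_dvd_of_star_dvd {d z : GaussianInt} {p : ℕ} (hp : p.Prime)
    (hd : IsPrimary d) (hdp : d.norm = p) (h1 : d ∣ z) (h2 : star d ∣ z) :
    (p : GaussianInt) ∣ z := by
  obtain ⟨w, rfl⟩ := h1
  have hp' : Prime (star d) := prime_of_norm_eq_prime hp (by rw [Zsqrtd.norm_conj, hdp])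
  have hdd : (p : GaussianInt) = d * star d := by
    rw [← Zsqrtd.norm_eq_mul_conj, hdp]; simp
  rcases hp'.dvd_or_dvd h2 with h | h
  · exfalso
    have h3 : star d ∣ ((2 * d.re : ℤ) : GaussianInt) := by
      have : ((2 * d.re : ℤ) : GaussianInt) = d + star d := by
        ext <;> simp; ring
      rw [this]
      exact dvd_add h dvd_rfl
    obtain ⟨c, hc⟩ := h3
    have h4 := congrArg Zsqrtd.norm hc
    rw [Zsqrtd.norm_mul, Zsqrtd.norm_conj, hdp, Zsqrtd.norm_intCast] at h4
    have h5 : (p : ℤ) ∣ 2 * d.re := by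
      have := (Nat.prime_iff_prime_int.1 hp).dvd_or_dvd (Dvd.intro _ h4.symm)
      tauto
    have hodd : ¬ (p : ℤ) ∣ 2 := by
      intro h
      have h6 := hd.norm_mod_four
      have h7 : p ∣ 2 := by exact_mod_cast h
      have := (Nat.prime_dvd_prime_iff_eq hp Nat.prime_two).1 h7
      subst this
      rw [hdp] at h6
      norm_num at h6
    have h6 : (p : ℤ) ∣ d.re := ((Nat.prime_iff_prime_int.1 hp).dvd_or_dvd h5).resolve_left hodd
    have hre : d.re ≠ 0 := by
      intro h
      have h1 := hd.1
      have h2 := hd.2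
      omega
    have h7 := Int.natAbs_dvd_natAbs.2 h6
    have h8 := Nat.le_of_dvd (Int.natAbs_pos.2 hre) h7
    have h9 : (p : ℤ) ≤ |d.re| := by rw [Int.abs_eq_natAbs]; exact_mod_cast h8
    have h10 := hp.two_le
    rw [Zsqrtd.norm_def] at hdp
    have h11 := sq_abs d.re
    nlinarith [mul_self_nonneg d.im]
  · rw [hdd]
    exact mul_dvd_mul_left d h

open scoped Classical in
theorem squareSum_prime_mul {d : GaussianInt} {p : ℕ} (hp : p.Prime)
    (hd : IsPrimary d) (hdp : d.norm = p) (N : ℕ) :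
    squareSum (p * N) + ∑ z ∈ primaryOfNorm (p * N) with (p : GaussianInt) ∣ z, z ^ 2 =
      (d ^ 2 + star d ^ 2) * squareSum N := by
  have hdd : (p : GaussianInt) = d * star d := by
    rw [← Zsqrtd.norm_eq_mul_conj, hdp]; simp
  rw [add_mul, ← sum_filter_dvd_sq hd hdp,
    ← sum_filter_dvd_sq hd.star (D := p) (by rw [Zsqrtd.norm_conj, hdp]),
    ← Finset.sum_union_inter, squareSum]
  congr 1
  · apply Finset.sum_congr _ fun _ _ => rfl
    ext z
    simp only [Finset.mem_union, Finset.mem_filter, ← and_or_left, iff_self_and]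
    intro hz
    have hz' : d ∣ z * star z := by
      rw [← Zsqrtd.norm_eq_mul_conj, (mem_primaryOfNorm.1 hz).1]
      push_cast
      rw [hdd, mul_assoc]
      exact dvd_mul_right _ _
    refine ((prime_of_norm_eq_prime hp hdp).dvd_or_dvd hz').imp_right ?_
    rintro ⟨w, hw⟩
    exact ⟨star w, by rw [← star_star z, hw, star_mul, mul_comm]⟩
  · apply Finset.sum_congr _ fun _ _ => rfl
    ext z
    simp only [Finset.mem_inter, Finset.mem_filter]
    constructor
    · rintro ⟨h1, h2⟩
      exact ⟨⟨h1, (Dvd.intro _ hdd.symm).trans h2⟩, h1, (Dvd.intro_left _ hdd.symm).trans h2⟩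
    · rintro ⟨⟨h1, h2⟩, -, h3⟩
      exact ⟨h1, natCast_dvd_of_dvd_of_star_dvd hp hd hdp h2 h3⟩

open scoped Classical in
theorem filter_natCast_dvd_eq_empty {p N : ℕ} (hp : p ≠ 0) (h : ¬ p ∣ N) :
    (primaryOfNorm (p * N)).filter ((p : GaussianInt) ∣ ·) = ∅ := by
  rw [Finset.filter_eq_empty_iff]
  rintro z hz ⟨w, rfl⟩
  apply h
  have h1 := (mem_primaryOfNorm.1 hz).1
  rw [Zsqrtd.norm_mul, Zsqrtd.norm_natCast, Nat.cast_mul, mul_assoc] at h1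
  have h2 := mul_left_cancel₀ (by exact_mod_cast hp) h1
  exact Int.natCast_dvd_natCast.1 (Dvd.intro _ h2)

open scoped Classical in
theorem squareSum_prime_mul_of_not_dvd {d : GaussianInt} {p N : ℕ} (hp : p.Prime)
    (hd : IsPrimary d) (hdp : d.norm = p) (h : ¬ p ∣ N) :
    squareSum (p * N) = (d ^ 2 + star d ^ 2) * squareSum N := by
  rw [← squareSum_prime_mul hp hd hdp, filter_natCast_dvd_eq_empty hp.ne_zero h]
  simp

open scoped Classical in
theorem squareSum_prime_mul_prime_mul {d : GaussianInt} {p : ℕ} (hp : p.Prime)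
    (hd : IsPrimary d) (hdp : d.norm = p) (N : ℕ) :
    squareSum (p * (p * N)) =
      (d ^ 2 + star d ^ 2) * squareSum (p * N) - (d * star d) ^ 2 * squareSum N := by
  have hdd : (p : GaussianInt) = d * star d := by
    rw [← Zsqrtd.norm_eq_mul_conj, hdp]; simp
  have hpr : IsPrimary (p : GaussianInt) := by
    rw [hdd]; exact hd.mul hd.star
  rw [← squareSum_prime_mul hp hd hdp, ← hdd,
    ← sum_filter_dvd_sq hpr (D := p * p) (by rw [Zsqrtd.norm_natCast]; norm_cast), mul_assoc,
    add_sub_cancel_right]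

theorem squareSum_pow_mul {d : GaussianInt} {p m : ℕ} (hp : p.Prime)
    (hd : IsPrimary d) (hdp : d.norm = p) (h : ¬ p ∣ m) (r : ℕ) :
    (d ^ 2 - star d ^ 2) * squareSum (p ^ r * m) =
      ((d ^ 2) ^ (r + 1) - (star d ^ 2) ^ (r + 1)) * squareSum m := by
  induction r using Nat.twoStepInduction with
  | zero => simp
  | one => rw [pow_one, squareSum_prime_mul_of_not_dvd hp hd hdp h]; ring
  | more r h1 h2 =>
    rw [pow_succ' p (r + 1), mul_assoc, pow_succ' p r, mul_assoc,
      squareSum_prime_mul_prime_mul hp hd hdp, ← mul_assoc p, ← pow_succ']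
    linear_combination (d ^ 2 + star d ^ 2) * h2 - (d * star d) ^ 2 * h1

theorem natCast_dvd_of_mem_primaryOfNorm {q N : ℕ} (hq : q.Prime) (hq3 : q % 4 = 3)
    {z : GaussianInt} (hz : z ∈ primaryOfNorm (q * N)) : (q : GaussianInt) ∣ z := by
  have : Fact q.Prime := ⟨hq⟩
  have hpr : Prime (q : GaussianInt) := GaussianInt.prime_of_nat_prime_of_mod_four_eq_three q hq3
  have hz' : (q : GaussianInt) ∣ z * star z := by
    rw [← Zsqrtd.norm_eq_mul_conj, (mem_primaryOfNorm.1 hz).1]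
    push_cast
    exact dvd_mul_right _ _
  rcases hpr.dvd_or_dvd hz' with h | ⟨w, hw⟩
  · exact h
  · exact ⟨star w, by rw [← star_star z, hw, star_mul, mul_comm]; simp⟩

open scoped Classical in
theorem squareSum_inert_mul_of_not_dvd {q N : ℕ} (hq : q.Prime) (hq3 : q % 4 = 3)
    (h : ¬ q ∣ N) : squareSum (q * N) = 0 := by
  rw [squareSum, ← Finset.filter_true_of_mem
    fun z hz => natCast_dvd_of_mem_primaryOfNorm hq hq3 hz,
    filter_natCast_dvd_eq_empty hq.ne_zero h, Finset.sum_empty]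

open scoped Classical in
theorem squareSum_inert_sq_mul {q : ℕ} (hq : q.Prime) (hq3 : q % 4 = 3) (N : ℕ) :
    squareSum (q * (q * N)) = (q : GaussianInt) ^ 2 * squareSum N := by
  have hpr : IsPrimary (-(q : GaussianInt)) := by
    have : (-(q : GaussianInt)) = ((-(q : ℤ) : ℤ) : GaussianInt) := by simp
    rw [this, isPrimary_intCast]
    omega
  rw [← neg_sq, ← sum_filter_dvd_sq hpr (D := q * q)
    (by rw [Zsqrtd.norm_neg, Zsqrtd.norm_natCast]; norm_cast), mul_assoc, squareSum]
  rw [Finset.filter_true_of_mem]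
  intro z hz
  rw [neg_dvd]
  exact natCast_dvd_of_mem_primaryOfNorm hq hq3 hz

theorem squareSum_inert_pow_mul {q m : ℕ} (hq : q.Prime) (hq3 : q % 4 = 3) (h : ¬ q ∣ m)
    (r : ℕ) :
    squareSum (q ^ r * m) = if Even r then (q : GaussianInt) ^ r * squareSum m else 0 := by
  induction r using Nat.twoStepInduction with
  | zero => simp
  | one => simpa using squareSum_inert_mul_of_not_dvd hq hq3 h
  | more r h1 h2 =>
    rw [pow_succ' q (r + 1), mul_assoc, pow_succ' q r, mul_assoc,
      squareSum_inert_sq_mul hq hq3, h1]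
    simp only [Nat.even_add_one, not_not]
    split_ifs
    · ring
    · simp

theorem squareSum_one : squareSum 1 = 1 := by
  have : primaryOfNorm 1 = {1} := by decide
  simp [squareSum, this]

theorem exists_sq_add_sq {p : ℕ} (hp : p.Prime) (h1 : p % 4 = 1) :
    ∃ u v : ℕ, 0 < u ∧ 0 < v ∧ Odd u ∧ Even v ∧ p = u ^ 2 + v ^ 2 := by
  have : Fact p.Prime := ⟨hp⟩
  obtain ⟨a, b, hab⟩ := Nat.Prime.sq_add_sq (p := p) (by omega)
  have hns : ∀ c : ℕ, c ^ 2 ≠ p := fun c hc => by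
    rw [← hc] at hp
    exact Nat.Prime.not_prime_pow le_rfl hp
  have ha : 0 < a := Nat.pos_of_ne_zero fun h => hns b (by rw [← hab, h]; ring)
  have hb : 0 < b := Nat.pos_of_ne_zero fun h => hns a (by rw [← hab, h]; ring)
  have hodd : Odd (a ^ 2 + b ^ 2) := by rw [hab, Nat.odd_iff]; omega
  rcases Nat.even_or_odd a with hae | hao
  · refine ⟨b, a, hb, ha, ?_, hae, by rw [← hab, add_comm]⟩
    by_contra hbo
    rw [Nat.not_odd_iff_even] at hbo
    exact Nat.not_even_iff_odd.2 hodd ((hae.pow_of_ne_zero two_ne_zero).add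
      (hbo.pow_of_ne_zero two_ne_zero))
  · refine ⟨a, b, ha, hb, hao, ?_, hab.symm⟩
    by_contra hbo
    rw [Nat.not_even_iff_odd] at hbo
    exact Nat.not_even_iff_odd.2 hodd (hao.pow.add_odd hbo.pow)

theorem sq_add_sq_unique {p u v x y : ℕ} (hp : p.Prime) (hu : Odd u) (hv : Even v)
    (hx : Odd x) (huv : p = u ^ 2 + v ^ 2) (hxy : p = x ^ 2 + y ^ 2) :
    u = x ∧ v = y := by
  suffices h : u = x by
    refine ⟨h, Nat.pow_left_injective two_ne_zero ?_⟩
    dsimp only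
    subst h
    omega
  have h1 : (p : ℤ) = u ^ 2 + v ^ 2 := by exact_mod_cast huv
  have h2 : (p : ℤ) = x ^ 2 + y ^ 2 := by exact_mod_cast hxy
  have hpp : (0 : ℤ) < p := by exact_mod_cast hp.pos
  have hux : (0 : ℤ) < u * x := by exact_mod_cast Nat.mul_pos hu.pos hx.pos
  have hvy : (0 : ℤ) ≤ v * y := by positivity
  have hdvd : (p : ℤ) ∣ (u * y - v * x) * (u * y + v * x) :=
    ⟨u ^ 2 - x ^ 2, by linear_combination (x : ℤ) ^ 2 * h1 - (u : ℤ) ^ 2 * h2⟩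
  rcases (Nat.prime_iff_prime_int.1 hp).dvd_or_dvd hdvd with ⟨k, hk⟩ | ⟨k, hk⟩
  · have hsq : (u * x + v * y : ℤ) ^ 2 + (p * k) ^ 2 = p ^ 2 := by
      rw [← hk, sq (p : ℤ)]
      nth_rewrite 1 [h1]
      rw [h2]
      ring
    have hk0 : k = 0 := by
      by_contra hk0
      have : 1 ≤ k ^ 2 := Int.one_le_abs (pow_ne_zero 2 hk0) |>.trans_eq (abs_sq k)
      nlinarith [pow_pos hpp 2, pow_pos (add_pos_of_pos_of_nonneg hux hvy) 2]
    have h3 : (u : ℤ) * y = v * x := by rw [hk0] at hk; linarith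
    have h4 : (p : ℤ) * u ^ 2 = p * x ^ 2 := by
      linear_combination (x : ℤ) ^ 2 * (- h1) + (u : ℤ) ^ 2 * h2 +
        ((u : ℤ) * y + v * x) * h3
    have h5 := mul_left_cancel₀ hpp.ne' h4
    exact Nat.pow_left_injective two_ne_zero (by exact_mod_cast h5)
  · exfalso
    have hsq : (u * x - v * y : ℤ) ^ 2 + (p * k) ^ 2 = p ^ 2 := by
      rw [← hk, sq (p : ℤ)]
      nth_rewrite 1 [h1]
      rw [h2]
      ring
    have hodd : (u * x - v * y : ℤ) % 2 = 1 := by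
      have : Odd (u * x - v * y : ℤ) :=
        ((Int.odd_coe_nat u).2 hu |>.mul ((Int.odd_coe_nat x).2 hx)).sub_even
          (((Int.even_coe_nat v).2 hv).mul_right _)
      exact Int.odd_iff.1 this
    have hne : (u * x - v * y : ℤ) ≠ 0 := by intro h; rw [h] at hodd; norm_num at hodd
    have hk0 : k = 0 := by
      by_contra hk0
      have : 1 ≤ k ^ 2 := Int.one_le_abs (pow_ne_zero 2 hk0) |>.trans_eq (abs_sq k)
      nlinarith [pow_pos hpp 2, pow_two_pos_of_ne_zero hne]
    rw [hk0, mul_zero] at hk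
    have hsum : u * y + v * x = 0 := by exact_mod_cast hk
    have hv0 : v = 0 := by
      have := hx.pos
      have h3 : v * x = 0 := by omega
      rcases Nat.mul_eq_zero.1 h3 with h | h
      · exact h
      · omega
    rw [hv0] at huv
    exact Nat.Prime.not_prime_pow (x := u) (n := 2) le_rfl (by simpa [huv] using hp)

theorem exists_isPrimary {u v : ℕ} (hu : Odd u) (hv : Even v) :
    ∃ d : GaussianInt, IsPrimary d ∧ d.norm = ((u ^ 2 + v ^ 2 : ℕ) : ℤ) ∧
      d ^ 2 = ⟨u ^ 2 - v ^ 2, 2 * u * v⟩ := by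
  obtain ⟨k, rfl⟩ := hu
  obtain ⟨l, rfl⟩ := hv
  by_cases h : (2 * k + 1 + (l + l)) % 4 = 1
  · refine ⟨⟨(2 * k + 1 : ℕ), (l + l : ℕ)⟩, ⟨?_, ?_⟩, ?_, ?_⟩
    · dsimp only; omega
    · dsimp only; omega
    · rw [Zsqrtd.norm_def]; push_cast; ring
    · rw [sq]; ext <;> simp <;> ring
  · refine ⟨⟨-(2 * k + 1 : ℕ), -(l + l : ℕ)⟩, ⟨?_, ?_⟩, ?_, ?_⟩
    · dsimp only; omega
    · dsimp only; omega
    · rw [Zsqrtd.norm_def]; push_cast; ring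
    · rw [sq]; ext <;> simp <;> ring

/-- The values at prime powers determine a multiplicative function on odd numbers, which is
`squareSum`. -/
theorem intCast_eq_squareSum (f : ℕ → ℤ) (hf1 : f 1 = 1)
    (hfmul : ∀ m n : ℕ, Nat.Coprime m n → f (m * n) = f m * f n)
    (hfa : ∀ p r : ℕ, p.Prime → 1 ≤ r → p % 4 = 3 → Even r → f (p ^ r) = (p : ℤ) ^ r)
    (hfb : ∀ p r u v : ℕ, p.Prime → 1 ≤ r → p % 4 = 1 → 0 < u → 0 < v →
      Odd u → Even v → p = u ^ 2 + v ^ 2 →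
      (f (p ^ r) : ℂ) =
        (-1 : ℂ) ^ r *
          ((((v : ℂ) ^ 2 - (u : ℂ) ^ 2 + 2 * Complex.I * u * v) ^ (r + 1) -
            ((v : ℂ) ^ 2 - (u : ℂ) ^ 2 - 2 * Complex.I * u * v) ^ (r + 1)) /
          (4 * Complex.I * u * v)))
    (hf0 : ∀ p r : ℕ, p.Prime → 1 ≤ r → ¬(p % 4 = 1) → ¬(p % 4 = 3 ∧ Even r) →
      f (p ^ r) = 0) (N : ℕ) (hN : Odd N) : (f N : GaussianInt) = squareSum N := by
  induction N using Nat.strong_induction_on with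
  | _ N ih =>
  by_cases hN1 : N = 1
  · rw [hN1, hf1, squareSum_one, Int.cast_one]
  obtain ⟨p, hp, hpN⟩ := Nat.exists_prime_and_dvd hN1
  obtain ⟨r, m, hpm, rfl⟩ := Nat.exists_eq_pow_mul_and_not_dvd hN.pos.ne' p hp.ne_one
  have hr : 1 ≤ r := by
    by_contra hr
    rw [Nat.lt_one_iff.1 (not_le.1 hr), pow_zero, one_mul] at hpN
    exact hpm hpN
  have hm : Odd m := (Nat.odd_mul.1 hN).2
  have hp2 : p % 2 = 1 := Nat.odd_iff.1 (hN.of_dvd_nat hpN)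
  have hlt : m < p ^ r * m := by
    have := Nat.one_lt_pow (Nat.one_le_iff_ne_zero.1 hr) hp.one_lt
    nlinarith [hm.pos]
  rw [hfmul _ _ (Nat.Coprime.pow_left r ((Nat.Prime.coprime_iff_not_dvd hp).2 hpm)),
    Int.cast_mul, ih m hlt hm]
  have hp4 : p % 4 = 1 ∨ p % 4 = 3 := by omega
  rcases hp4 with h1 | h3
  · obtain ⟨u, v, hu0, hv0, hu, hv, huv⟩ := exists_sq_add_sq hp h1
    obtain ⟨d, hd, hdp, hd2⟩ := exists_isPrimary hu hv
    rw [← huv] at hdp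
    have hsd2 : star d ^ 2 = ⟨u ^ 2 - v ^ 2, -(2 * u * v)⟩ := by
      rw [← star_pow, hd2]; rfl
    have hne : d ^ 2 - star d ^ 2 ≠ 0 := by
      intro h
      have := congrArg Zsqrtd.im h
      rw [hd2, hsd2] at this
      simp at this
      omega
    apply mul_left_cancel₀ hne
    rw [squareSum_pow_mul hp hd hdp hpm, ← mul_assoc]
    congr 1
    apply GaussianInt.toComplex_injective
    have hcu : (u : ℂ) ≠ 0 := by exact_mod_cast hu0.ne'
    have hcv : (v : ℂ) ≠ 0 := by exact_mod_cast hv0.ne'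
    have e1 : GaussianInt.toComplex (d ^ 2) =
        -((v : ℂ) ^ 2 - (u : ℂ) ^ 2 - 2 * Complex.I * u * v) := by
      rw [hd2, GaussianInt.toComplex_def']; push_cast; ring
    have e2 : GaussianInt.toComplex (star d ^ 2) =
        -((v : ℂ) ^ 2 - (u : ℂ) ^ 2 + 2 * Complex.I * u * v) := by
      rw [hsd2, GaussianInt.toComplex_def']; push_cast; ring
    have hW : -((v : ℂ) ^ 2 - (u : ℂ) ^ 2 - 2 * Complex.I * u * v) -
        -((v : ℂ) ^ 2 - (u : ℂ) ^ 2 + 2 * Complex.I * u * v) = 4 * Complex.I * u * v := by ring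
    have hW0 : 4 * Complex.I * (u : ℂ) * v ≠ 0 := by simp [hcu, hcv]
    rw [map_mul, map_sub, map_sub, map_pow _ (d ^ 2), map_pow _ (star d ^ 2), e1, e2,
      map_intCast, hfb p r u v hp hr h1 hu0 hv0 hu hv huv, neg_pow (_ - _ : ℂ) (r + 1),
      neg_pow (_ + _ : ℂ) (r + 1), hW, mul_left_comm, mul_div_cancel₀ _ hW0]
    ring
  · rw [squareSum_inert_pow_mul hp h3 hpm]
    split_ifs with he
    · rw [hfa p r hp hr h3 he]; push_cast; rfl
    · rw [hf0 p r hp hr (by omega) (by tauto)]; simp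

/-- The finite product `(X; X)_n`. -/
noncomputable def eulerProd (n : ℕ) : ℤ[X] := ∏ m ∈ Finset.Icc 1 n, (1 - X ^ m)

theorem eulerProd_zero : eulerProd 0 = 1 := by simp [eulerProd]

theorem eulerProd_succ (n : ℕ) : eulerProd (n + 1) = eulerProd n * (1 - X ^ (n + 1)) :=
  Finset.prod_Icc_succ_top (by omega) _

/-- The Gaussian binomial coefficient. -/
noncomputable def gaussBinom : ℕ → ℕ → ℤ[X]
  | _, 0 => 1
  | 0, _ + 1 => 0
  | n + 1, k + 1 => gaussBinom n k + X ^ (k + 1) * gaussBinom n (k + 1)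

theorem gaussBinom_zero_right (n : ℕ) : gaussBinom n 0 = 1 := by cases n <;> rfl

theorem gaussBinom_succ_succ (n k : ℕ) :
    gaussBinom (n + 1) (k + 1) = gaussBinom n k + X ^ (k + 1) * gaussBinom n (k + 1) := rfl

theorem gaussBinom_eq_zero_of_lt {n k : ℕ} (h : n < k) : gaussBinom n k = 0 := by
  induction n generalizing k with
  | zero => obtain ⟨k, rfl⟩ := Nat.exists_eq_succ_of_ne_zero h.ne'; rfl
  | succ n ih =>
    obtain ⟨k, rfl⟩ := Nat.exists_eq_succ_of_ne_zero (Nat.ne_zero_of_lt h)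
    rw [Nat.succ_eq_add_one, gaussBinom_succ_succ, ih (by omega), ih (by omega)]
    simp

theorem gaussBinom_self (n : ℕ) : gaussBinom n n = 1 := by
  induction n with
  | zero => rfl
  | succ n ih => rw [gaussBinom_succ_succ, ih, gaussBinom_eq_zero_of_lt (by omega)]; simp

theorem gaussBinom_mul_eulerProd (a b : ℕ) :
    gaussBinom (a + b) a * eulerProd a * eulerProd b = eulerProd (a + b) := by
  induction h : a + b generalizing a b with
  | zero =>
    obtain ⟨rfl, rfl⟩ : a = 0 ∧ b = 0 := by omega
    simp [eulerProd_zero, gaussBinom_zero_right]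
  | succ n ih =>
    rcases a with - | a
    · obtain rfl : b = n + 1 := by omega
      simp [eulerProd_zero, gaussBinom_zero_right]
    rcases b with - | b
    · obtain rfl : a = n := by omega
      simp [eulerProd_zero, gaussBinom_self]
    have h1 := ih a (b + 1) (by omega)
    have h2 := ih (a + 1) b (by omega)
    obtain rfl : n = a + 1 + b := by omega
    rw [eulerProd_succ] at h1 h2
    rw [gaussBinom_succ_succ, eulerProd_succ a, eulerProd_succ b, eulerProd_succ (a + 1 + b)]
    linear_combination (1 - X ^ (a + 1)) * h1 + X ^ (a + 1) * (1 - X ^ (b + 1)) * h2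

theorem gaussBinom_symm (a b : ℕ) : gaussBinom (a + b) a = gaussBinom (a + b) b := by
  have hne : ∀ n, eulerProd n ≠ 0 := fun n => by
    rw [eulerProd, Finset.prod_ne_zero_iff]
    intro m hm h
    have := congrArg (Polynomial.eval 0) h
    have hm' : m ≠ 0 := by have := (Finset.mem_Icc.1 hm).1; omega
    simp [hm'] at this
  apply mul_right_cancel₀ (mul_ne_zero (hne a) (hne b))
  rw [← mul_assoc, gaussBinom_mul_eulerProd, mul_comm (eulerProd a), ← mul_assoc, add_comm a b,
    gaussBinom_mul_eulerProd]

/-- The homogeneous form of the `q`-binomial theorem. -/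
theorem prod_add_mul_pow_eq_sum {R : Type*} [CommRing R] (φ : ℤ[X] →+* R) (m : ℕ) (x y : R) :
    ∏ k ∈ Finset.range m, (y + x * φ X ^ k) =
      ∑ k ∈ Finset.range (m + 1),
        φ (X ^ (k.choose 2) * gaussBinom m k) * x ^ k * y ^ (m - k) := by
  induction m generalizing x with
  | zero => simp [gaussBinom_zero_right]
  | succ m ih =>
    rw [Finset.prod_range_succ', pow_zero, mul_one]
    have : ∀ k, y + x * φ X ^ (k + 1) = y + (x * φ X) * φ X ^ k := fun k => by ring
    simp only [this]
    have hy : y * ∑ k ∈ Finset.range (m + 1),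
        φ (X ^ (k.choose 2) * gaussBinom m k) * (x * φ X) ^ k * y ^ (m - k) =
        ∑ k ∈ Finset.range (m + 2),
        φ (X ^ (k.choose 2) * gaussBinom m k) * (x * φ X) ^ k * y ^ (m + 1 - k) := by
      rw [Finset.sum_range_succ _ (m + 1), gaussBinom_eq_zero_of_lt (Nat.lt_succ_self m),
        Finset.mul_sum]
      simp only [mul_zero, map_zero, zero_mul, add_zero]
      refine Finset.sum_congr rfl fun k hk => ?_
      rw [Nat.sub_add_comm (Nat.lt_succ_iff.1 (Finset.mem_range.1 hk)), pow_succ]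
      ring
    rw [ih, mul_comm, add_mul, hy, Finset.sum_range_succ', Finset.sum_range_succ' _ (m + 1),
      Finset.mul_sum, add_right_comm, ← Finset.sum_add_distrib]
    congr 1
    · refine Finset.sum_congr rfl fun k _ => ?_
      have hc : (k + 1).choose 2 = k + k.choose 2 := by
        rw [Nat.choose_succ_succ' k 1, Nat.choose_one_right]
      rw [gaussBinom_succ_succ, Nat.add_sub_add_right, hc]
      simp only [map_mul, map_add, map_pow, mul_pow, pow_add]
      ring
    · simp [gaussBinom_zero_right]

theorem eulerProd_eq_prod_range (n : ℕ) :
    eulerProd n = ∏ k ∈ Finset.range n, (1 - X ^ (k + 1)) := by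
  induction n with
  | zero => exact eulerProd_zero
  | succ n ih => rw [eulerProd_succ, ih, Finset.prod_range_succ]

theorem prod_X_pow_sub_X_pow (n : ℕ) :
    ∏ k ∈ Finset.range n, ((X : ℤ[X]) ^ n - X ^ k) =
      (-1) ^ n * X ^ n.choose 2 * eulerProd n := by
  have h : ∀ k ∈ Finset.range n, (X : ℤ[X]) ^ n - X ^ k = -1 * X ^ k * (1 - X ^ (n - k)) := by
    intro k hk
    have : n = k + (n - k) := by have := Finset.mem_range.1 hk; omega
    nth_rewrite 1 [this]
    rw [pow_add]
    ring
  rw [Finset.prod_congr rfl h, Finset.prod_mul_distrib, Finset.prod_mul_distrib,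
    Finset.prod_const, Finset.card_range, Finset.prod_pow_eq_pow_sum, Finset.sum_range_id,
    ← Nat.choose_two_right, eulerProd_eq_prod_range, ← Finset.prod_range_reflect]
  congr 1
  refine Finset.prod_congr rfl fun k hk => ?_
  rw [show n - (n - 1 - k) = k + 1 by have := Finset.mem_range.1 hk; omega]

theorem choose_two_add (n j : ℕ) (h : j ≤ n) :
    (n + 1 + j).choose 2 + n * (n - j) =
      (n + n.choose 2 + n * n) + (j + 1).choose 2 := by
  obtain ⟨i, rfl⟩ := Nat.exists_eq_add_of_le h
  have : ((((j + i + 1 + j).choose 2 + (j + i) * i : ℕ)) : ℚ) =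
      (((j + i) + (j + i).choose 2 + (j + i) * (j + i) + (j + 1).choose 2 : ℕ) : ℚ) := by
    push_cast [Nat.cast_choose_two]
    ring
  rw [Nat.add_sub_cancel_left]
  exact_mod_cast this

theorem choose_two_sub (n j : ℕ) (h : j ≤ n) :
    (n - j).choose 2 + n * (n + 1 + j) =
      (n + n.choose 2 + n * n) + (j + 1).choose 2 := by
  obtain ⟨i, rfl⟩ := Nat.exists_eq_add_of_le h
  have : (((i.choose 2 + (j + i) * (j + i + 1 + j) : ℕ)) : ℚ) =
      (((j + i) + (j + i).choose 2 + (j + i) * (j + i) + (j + 1).choose 2 : ℕ) : ℚ) := by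
    push_cast [Nat.cast_choose_two]
    ring
  rw [Nat.add_sub_cancel_left]
  exact_mod_cast this

/-- The derivative of the `q`-binomial theorem at a zero of the product. -/
theorem sum_gaussBinom_deriv (n : ℕ) :
    ∑ k ∈ Finset.range (2 * n + 2),
        (-1) ^ k * (k : ℤ[X]) * X ^ (k.choose 2 + n * (2 * n + 1 - k)) *
          gaussBinom (2 * n + 1) k =
      -((-1) ^ n * X ^ (n + n.choose 2 + n * n) * eulerProd n ^ 2) := by
  have h := congrArg (fun P => (derivative P).eval 1)
    (prod_add_mul_pow_eq_sum (C : ℤ[X] →+* ℤ[X][X]) (2 * n + 1) (-X) (C (X ^ n)))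
  have hL : ∏ k ∈ Finset.range (2 * n + 1), (C (X ^ n) + -X * C (X : ℤ[X]) ^ k) =
      (1 - X) * (C (X ^ n) * ((∏ k ∈ Finset.range n, (C (X ^ n) + -X * C (X : ℤ[X]) ^ k)) *
        ∏ k ∈ Finset.range n, (C (X ^ n) + -X * C (X : ℤ[X]) ^ (n + 1 + k)))) := by
    rw [show 2 * n + 1 = n + 1 + n by ring, Finset.prod_range_add, Finset.prod_range_succ,
      ← C_pow]
    ring
  have hQ : ∏ k ∈ Finset.range n, ((X : ℤ[X]) ^ n - X ^ (n + 1 + k)) =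
      X ^ (n * n) * eulerProd n := by
    have hc : (X : ℤ[X]) ^ (n * n) = ∏ _k ∈ Finset.range n, X ^ n := by simp [pow_mul]
    rw [eulerProd_eq_prod_range, hc, ← Finset.prod_mul_distrib]
    exact Finset.prod_congr rfl fun k _ => by ring
  simp only [hL, derivative_mul, derivative_sub, derivative_one, derivative_X, eval_add, eval_mul,
    eval_sub, eval_one, eval_X, sub_self, zero_mul, add_zero, zero_sub, eval_prod, eval_neg,
    eval_C, eval_pow, neg_mul, one_mul, ← sub_eq_add_neg (X ^ n) (X ^ _), prod_X_pow_sub_X_pow,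
    hQ] at h
  have hR : ∀ k, C ((X : ℤ[X]) ^ k.choose 2 * gaussBinom (2 * n + 1) k) * (-X) ^ k *
      C (X ^ n) ^ (2 * n + 1 - k) =
      C ((-1) ^ k * X ^ (k.choose 2 + n * (2 * n + 1 - k)) * gaussBinom (2 * n + 1) k) *
        X ^ k := fun k => by
    rw [neg_pow (X : ℤ[X][X]) k, pow_add, pow_mul]
    simp only [map_mul, map_pow, map_neg, map_one]
    ring
  simp only [hR, derivative_sum, derivative_C_mul_X_pow, eval_finsetSum, eval_mul, eval_C,
    eval_pow, eval_X, one_pow, mul_one] at h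
  calc _ = _ := Finset.sum_congr rfl fun k _ => by ring
    _ = _ := h.symm
    _ = _ := by ring

theorem eulerProd_sq (n : ℕ) :
    eulerProd n ^ 2 = ∑ j ∈ Finset.range (n + 1),
      (-1) ^ j * (2 * j + 1 : ℤ[X]) * X ^ (j + 1).choose 2 * gaussBinom (2 * n + 1) (n - j) := by
  have h := sum_gaussBinom_deriv n
  rw [show 2 * n + 2 = n + 1 + (n + 1) by ring, Finset.sum_range_add,
    ← Finset.sum_range_reflect, ← Finset.sum_add_distrib] at h
  have hne : (-1) ^ n * (X : ℤ[X]) ^ (n + n.choose 2 + n * n) ≠ 0 :=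
    mul_ne_zero (pow_ne_zero _ (by simp)) (pow_ne_zero _ X_ne_zero)
  apply mul_left_cancel₀ hne
  rw [← neg_inj, ← h, Finset.mul_sum, ← Finset.sum_neg_distrib]
  refine Finset.sum_congr rfl fun j hj => ?_
  have hjn : j ≤ n := Nat.lt_succ_iff.1 (Finset.mem_range.1 hj)
  rw [show n + 1 - 1 - j = n - j by omega, show 2 * n + 1 - (n - j) = n + 1 + j by omega,
    show 2 * n + 1 - (n + 1 + j) = n - j by omega, choose_two_add n j hjn,
    choose_two_sub n j hjn, pow_add]
  have hs : gaussBinom (2 * n + 1) (n + 1 + j) = gaussBinom (2 * n + 1) (n - j) := by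
    rw [show 2 * n + 1 = (n + 1 + j) + (n - j) by omega, gaussBinom_symm]
  have hsign : ((-1) ^ (n - j) : ℤ[X]) = (-1) ^ n * (-1) ^ j := by
    nth_rewrite 2 [← Nat.sub_add_cancel hjn]
    rw [pow_add, mul_assoc, ← mul_pow]
    simp
  rw [hs, hsign, Nat.cast_sub hjn]
  push_cast
  ring

theorem X_pow_dvd_eulerProd_sub {N k : ℕ} (h : N ≤ k) :
    X ^ (N + 1) ∣ eulerProd k - eulerProd N := by
  induction k, h using Nat.le_induction with
  | base => simp
  | succ k hk ih =>
    rw [eulerProd_succ, mul_sub, mul_one, sub_right_comm]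
    exact dvd_sub ih ((pow_dvd_pow X (by omega)).mul_left _)

/-- Jacobi's identity for the cube of the Euler product, to finite order. -/
theorem X_pow_dvd_eulerProd_cube_sub (N : ℕ) :
    X ^ (N + 1) ∣ eulerProd N ^ 3 - ∑ j ∈ Finset.range (N + 1),
      (-1) ^ j * (2 * j + 1 : ℤ[X]) * X ^ (j + 1).choose 2 := by
  have hX : ¬ (X : ℤ[X]) ∣ eulerProd N := by
    rw [eulerProd, prime_X.dvd_finsetProd_iff]
    rintro ⟨m, hm, h⟩
    have hm' : m ≠ 0 := by have := (Finset.mem_Icc.1 hm).1; omega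
    rw [X_dvd_iff] at h
    simp [coeff_X_pow, hm'.symm] at h
  apply prime_X.pow_dvd_of_dvd_mul_right _ hX
  obtain ⟨R, _, φ, hφ⟩ : ∃ (R : Type) (_ : CommRing R) (φ : ℤ[X] →+* R),
      ∀ P : ℤ[X], X ^ (N + 1) ∣ P ↔ φ P = 0 :=
    ⟨_, inferInstance, Ideal.Quotient.mk (Ideal.span {(X : ℤ[X]) ^ (N + 1)}), fun P => by
      rw [Ideal.Quotient.eq_zero_iff_mem, Ideal.mem_span_singleton]⟩
  have hE : ∀ k, N ≤ k → φ (eulerProd k) = φ (eulerProd N) := fun k hk => by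
    rw [← sub_eq_zero, ← map_sub, ← hφ]
    exact X_pow_dvd_eulerProd_sub hk
  have hX0 : ∀ k, N < k → φ X ^ k = 0 := fun k hk => by
    rw [← map_pow, ← hφ]
    exact pow_dvd_pow X hk
  have h := congrArg φ (eulerProd_sq (N + N))
  rw [show N + N + 1 = (N + 1) + N by ring, Finset.sum_range_add, map_add, map_pow,
    hE _ (by omega), map_sum φ _ (Finset.range N), Finset.sum_eq_zero (s := Finset.range N),
    add_zero] at h
  swap
  · intro j _
    have : N < (N + 1 + j + 1).choose 2 := by
      rw [Nat.choose_succ_succ' _ 1, Nat.choose_one_right]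
      omega
    simp only [map_mul, map_pow, hX0 _ this, mul_zero, zero_mul]
  rw [hφ, sub_mul, map_sub, sub_eq_zero, ← pow_succ, map_pow, pow_add _ 2 2]
  nth_rewrite 1 [h]
  rw [map_sum, Finset.sum_mul, Finset.sum_mul, map_sum]
  refine Finset.sum_congr rfl fun j hj => ?_
  have hjn : j ≤ N := Nat.lt_succ_iff.1 (Finset.mem_range.1 hj)
  have hg := congrArg φ (gaussBinom_mul_eulerProd (N + N - j) (N + N + 1 + j))
  rw [map_mul, map_mul, hE (N + N - j) (by omega), hE (N + N + 1 + j) (by omega),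
    hE (N + N - j + (N + N + 1 + j)) (by omega),
    show N + N - j + (N + N + 1 + j) = 2 * (N + N) + 1 by omega] at hg
  rw [map_mul _ _ (gaussBinom _ _), map_mul _ _ (eulerProd N), mul_assoc]
  congr 1
  linear_combination hg

/-- The sequence `1, -3, 5, -7, …` of odd integers congruent to `1` modulo `4`. -/
def signedOdd (j : ℕ) : ℤ := (-1) ^ j * (2 * j + 1)

theorem signedOdd_of_even {j : ℕ} (h : Even j) : signedOdd j = 2 * j + 1 := by
  simp [signedOdd, h.neg_one_pow]

theorem signedOdd_of_odd {j : ℕ} (h : Odd j) : signedOdd j = -(2 * j + 1) := by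
  simp [signedOdd, h.neg_one_pow]

theorem signedOdd_mod_four (j : ℕ) : signedOdd j % 4 = 1 := by
  rcases Nat.even_or_odd j with h | h
  · rw [signedOdd_of_even h]
    obtain ⟨k, rfl⟩ := h
    omega
  · rw [signedOdd_of_odd h]
    obtain ⟨k, rfl⟩ := h
    omega

theorem signedOdd_sq (j : ℕ) : signedOdd j ^ 2 = 8 * ((j + 1).choose 2 : ℤ) + 1 := by
  have h : (((j + 1).choose 2 : ℕ) : ℤ) * 2 = (j + 1) * j := by
    have h2 : ((j + 1).choose 2) * 2 = (j + 1) * j := by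
      rw [Nat.choose_two_right]
      exact Nat.div_mul_cancel (Nat.even_mul_pred_self (j + 1)).two_dvd
    exact_mod_cast h2
  rw [signedOdd, mul_pow, ← pow_mul, mul_comm j 2, pow_mul, neg_one_sq, one_pow]
  linear_combination (-4) * h

theorem signedOdd_injective : Function.Injective signedOdd := by
  intro j k h
  have hj := signedOdd_mod_four j
  rcases Nat.even_or_odd j with h1 | h1 <;> rcases Nat.even_or_odd k with h2 | h2
  · rw [signedOdd_of_even h1, signedOdd_of_even h2] at h; omega
  · rw [signedOdd_of_even h1, signedOdd_of_odd h2] at h; omega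
  · rw [signedOdd_of_odd h1, signedOdd_of_even h2] at h; omega
  · rw [signedOdd_of_odd h1, signedOdd_of_odd h2] at h; omega

theorem exists_signedOdd_eq {x : ℤ} (hx : x % 4 = 1) : ∃ j, signedOdd j = x := by
  rcases le_or_gt 0 x with h | h
  · refine ⟨2 * (x / 4).toNat, ?_⟩
    rw [signedOdd_of_even (even_two_mul _)]
    omega
  · refine ⟨2 * ((-x - 3) / 4).toNat + 1, ?_⟩
    rw [signedOdd_of_odd (odd_two_mul_add_one _)]
    omega

theorem re_squareSum (N : ℕ) :
    (squareSum N).re = ∑ z ∈ primaryOfNorm N, (z.re + z.im) * (z.re - z.im) := by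
  have h : ∀ s : Finset GaussianInt,
      (∑ z ∈ s, z ^ 2).re = ∑ z ∈ s, (z.re + z.im) * (z.re - z.im) := fun s => by
    induction s using Finset.induction_on with
    | empty => simp
    | insert a s ha ih =>
      rw [Finset.sum_insert ha, Finset.sum_insert ha, Zsqrtd.re_add, ih, sq, Zsqrtd.re_mul]
      ring
  exact h _

theorem sum_signedOdd_mul_signedOdd (n : ℕ) :
    ∑ p ∈ Finset.range (n + 1) ×ˢ Finset.range (n + 1) with
      n = (p.1 + 1).choose 2 + (p.2 + 1).choose 2, signedOdd p.1 * signedOdd p.2 =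
      (squareSum (4 * n + 1)).re := by
  rw [re_squareSum]
  refine Finset.sum_bij (fun p _ => (⟨(signedOdd p.1 + signedOdd p.2) / 2,
    (signedOdd p.1 - signedOdd p.2) / 2⟩ : GaussianInt)) ?_ ?_ ?_ ?_
  · intro p hp
    have hn := (Finset.mem_filter.1 hp).2
    have h1 := signedOdd_mod_four p.1
    have h2 := signedOdd_mod_four p.2
    have h3 := signedOdd_sq p.1
    have h4 := signedOdd_sq p.2
    rw [mem_primaryOfNorm, Zsqrtd.norm_def]
    obtain ⟨a, ha⟩ : ∃ a, signedOdd p.1 + signedOdd p.2 = 2 * a :=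
      ⟨(signedOdd p.1 + signedOdd p.2) / 2, by omega⟩
    obtain ⟨b, hb⟩ : ∃ b, signedOdd p.1 - signedOdd p.2 = 2 * b :=
      ⟨(signedOdd p.1 - signedOdd p.2) / 2, by omega⟩
    have h5 : signedOdd p.1 = a + b := by omega
    have h6 : signedOdd p.2 = a - b := by omega
    have hn' : (n : ℤ) = (p.1 + 1).choose 2 + (p.2 + 1).choose 2 := by exact_mod_cast hn
    refine ⟨?_, ?_, ?_⟩
    · simp only [ha, hb]
      rw [Int.mul_ediv_cancel_left _ two_ne_zero, Int.mul_ediv_cancel_left _ two_ne_zero]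
      rw [h5] at h3
      rw [h6] at h4
      push_cast
      linarith
    · dsimp only; omega
    · dsimp only; omega
  · intro p _ q _ h
    have h1 := signedOdd_mod_four p.1
    have h2 := signedOdd_mod_four p.2
    have h3 := signedOdd_mod_four q.1
    have h4 := signedOdd_mod_four q.2
    rw [Zsqrtd.ext_iff] at h
    obtain ⟨h5, h6⟩ := h
    dsimp only at h5 h6
    exact Prod.ext (signedOdd_injective (by omega)) (signedOdd_injective (by omega))
  · intro z hz
    obtain ⟨h1, h2, h3⟩ := mem_primaryOfNorm.1 hz
    obtain ⟨j, hj⟩ := exists_signedOdd_eq h2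
    obtain ⟨k, hk⟩ := exists_signedOdd_eq h3
    have h4 := signedOdd_sq j
    have h5 := signedOdd_sq k
    have hn : n = (j + 1).choose 2 + (k + 1).choose 2 := by
      rw [hj] at h4
      rw [hk] at h5
      rw [Zsqrtd.norm_def] at h1
      push_cast at h1
      zify
      linarith
    have hle : ∀ i : ℕ, i ≤ (i + 1).choose 2 := fun i => by
      rw [Nat.choose_succ_succ' i 1, Nat.choose_one_right]
      omega
    have h6 := hle j
    have h7 := hle k
    refine ⟨(j, k), ?_, ?_⟩
    · simp only [Finset.mem_filter, Finset.mem_product, Finset.mem_range]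
      exact ⟨⟨by omega, by omega⟩, hn⟩
    · ext
      · dsimp only; omega
      · dsimp only; omega
  · intro p _
    have h1 := signedOdd_mod_four p.1
    have h2 := signedOdd_mod_four p.2
    dsimp only
    congr 1 <;> omega

theorem coeff_eulerProd_pow_six (n : ℕ) :
    (eulerProd n ^ 6).coeff n = (squareSum (4 * n + 1)).re := by
  have h : X ^ (n + 1) ∣ eulerProd n ^ 6 - (∑ j ∈ Finset.range (n + 1),
      (-1) ^ j * (2 * j + 1 : ℤ[X]) * X ^ (j + 1).choose 2) ^ 2 := by
    rw [pow_mul _ 3 2]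
    exact (X_pow_dvd_eulerProd_cube_sub n).trans (sub_dvd_pow_sub_pow _ _ 2)
  have h1 := X_pow_dvd_iff.1 h n (Nat.lt_succ_self n)
  rw [coeff_sub, sub_eq_zero] at h1
  have h2 : ∀ j : ℕ, (-1) ^ j * (2 * j + 1 : ℤ[X]) * X ^ (j + 1).choose 2 =
      C (signedOdd j) * X ^ (j + 1).choose 2 := fun j => by simp [signedOdd]
  rw [h1, ← sum_signedOdd_mul_signedOdd, sq, Finset.sum_mul_sum, ← Finset.sum_product',
    finsetSum_coeff, Finset.sum_filter]
  refine Finset.sum_congr rfl fun p _ => ?_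
  rw [h2, h2, mul_mul_mul_comm, ← C_mul, ← pow_add, coeff_C_mul, coeff_X_pow, mul_ite, mul_one,
    mul_zero]

end EtaSix

/-- With `a n` the coefficient of `q^n` in `∏ (1 - q^m)^6`, and `f` the
multiplicative function with the stated values on prime powers (involving
`p = u² + v²`, `u` odd, `v` even, for `p ≡ 1 (mod 4)`), we have
`a n = f (4 n + 1)` for all `n`; moreover the representing pair is unique. -/
theorem stmt_15 (a : ℕ → ℤ)
    (ha : ∀ n N : ℕ, n ≤ N →
      a n = (((∏ m ∈ Finset.Icc 1 N, ((1 : Polynomial ℤ) - Polynomial.X ^ m)) ^ 6).coeff n))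
    (f : ℕ → ℤ)
    (hf1 : f 1 = 1)
    (hfmul : ∀ m n : ℕ, Nat.Coprime m n → f (m * n) = f m * f n)
    (hfa : ∀ p r : ℕ, p.Prime → 1 ≤ r → p % 4 = 3 → Even r →
      f (p ^ r) = (p : ℤ) ^ r)
    (hfb : ∀ p r u v : ℕ, p.Prime → 1 ≤ r → p % 4 = 1 → 0 < u → 0 < v →
      Odd u → Even v → p = u ^ 2 + v ^ 2 →
      (f (p ^ r) : ℂ) =
        (-1 : ℂ) ^ r *
          ((((v : ℂ) ^ 2 - (u : ℂ) ^ 2 + 2 * Complex.I * u * v) ^ (r + 1) -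
            ((v : ℂ) ^ 2 - (u : ℂ) ^ 2 - 2 * Complex.I * u * v) ^ (r + 1)) /
          (4 * Complex.I * u * v)))
    (hf0 : ∀ p r : ℕ, p.Prime → 1 ≤ r → ¬(p % 4 = 1) → ¬(p % 4 = 3 ∧ Even r) →
      f (p ^ r) = 0) :
    (∀ p : ℕ, p.Prime → p % 4 = 1 →
      ∃! uv : ℕ × ℕ, 0 < uv.1 ∧ 0 < uv.2 ∧ Odd uv.1 ∧ Even uv.2 ∧
        p = uv.1 ^ 2 + uv.2 ^ 2) ∧
    ∀ n : ℕ, a n = f (4 * n + 1) := by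
  refine ⟨fun p hp h1 => ?_, fun n => ?_⟩
  · obtain ⟨u, v, hu0, hv0, hu, hv, huv⟩ := EtaSix.exists_sq_add_sq hp h1
    refine ⟨(u, v), ⟨hu0, hv0, hu, hv, huv⟩, ?_⟩
    rintro ⟨x, y⟩ ⟨-, -, hx, hy, hxy⟩
    obtain ⟨rfl, rfl⟩ := EtaSix.sq_add_sq_unique hp hu hv hx huv hxy
    rfl
  · have h := EtaSix.intCast_eq_squareSum f hf1 hfmul hfa hfb hf0 (4 * n + 1) ⟨2 * n, by ring⟩
    rw [ha n n le_rfl, ← EtaSix.eulerProd, EtaSix.coeff_eulerProd_pow_six, ← h,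
      Zsqrtd.re_intCast]
end

section
/- Let a_n be the coefficient of q^n in ∏_{m=1}^∞ (1 - q^m)^8. Let f : ℕ → ℤ be the multiplicative arithmetic function determined on prime powers p^r (r ≥ 1) by: f(p^r) = (-1)^{r/2} p^{3r/2} if p ≡ 2 (mod 3) and r is even; if p ≡ 1 (mod 6), then, writing (x, y) for the unique pair of positive integers with p = x^2 + 3y^2, f(p^r) is the integer whose image in ℂ equals δ·{[x(x^2 − 9y^2) + 3√3·i·y(x^2 − y^2)]^{r+1} − [x(x^2 − 9y^2) − 3√3·i·y(x^2 − y^2)]^{r+1}}/(6√3·i·y(x^2 − y^2)), where δ = −1 if r is odd and x ≢ 1 (mod 3), and δ = 1 otherwise; and f(p^r) = 0 in all remaining cases. Then a_n = f(3n + 1) for all n ≥ 0. -/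
section EulerProduct

open PowerSeries

theorem PowerSeries.coeff_pow_congr {R : Type*} [CommSemiring R] {F G : R⟦X⟧} {n : ℕ}
    (h : ∀ i ≤ n, coeff i F = coeff i G) (k : ℕ) : ∀ i ≤ n, coeff i (F ^ k) = coeff i (G ^ k) := by
  induction k with
  | zero => simp
  | succ k ih =>
    intro i hi
    rw [pow_succ, pow_succ, coeff_mul, coeff_mul]
    refine Finset.sum_congr rfl fun p hp => ?_
    have hp := Finset.HasAntidiagonal.mem_antidiagonal.mp hp
    rw [ih _ (by lia), h _ (by lia)]

theorem coeff_prod_range_one_sub_X_pow {i N : ℕ} (h : i ≤ N) :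
    coeff i (∏ m ∈ Finset.range N, (1 - X ^ (m + 1) : ℤ⟦X⟧)) = coeff i (pentagonalSeries ℤ) := by
  have hstep : ∀ M ≥ N, coeff i (∏ m ∈ Finset.range M, (1 - X ^ (m + 1) : ℤ⟦X⟧)) =
      coeff i (∏ m ∈ Finset.range N, (1 - X ^ (m + 1) : ℤ⟦X⟧)) := by
    intro M hM
    induction M, hM using Nat.le_induction with
    | base => rfl
    | succ M hM ih =>
      rw [Finset.prod_range_succ, mul_sub, mul_one, map_sub, coeff_mul_X_pow', if_neg (by lia),
        sub_zero, ih]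
  obtain ⟨s, hs⟩ := Filter.eventually_atTop.mp (coeff_prod_one_sub_X_pow_eventually_eq ℤ i)
  obtain ⟨M, hM⟩ := s.exists_nat_subset_range
  rw [← hs (Finset.range (max M N)) (hM.trans (Finset.range_mono (le_max_left M N))),
    hstep _ (le_max_right M N)]

theorem coeff_prod_one_sub_X_pow_pow {n N : ℕ} (h : n ≤ N) (k : ℕ) :
    ((∏ m ∈ Finset.Icc 1 N, ((1 : Polynomial ℤ) - Polynomial.X ^ m)) ^ k).coeff n =
      coeff n (pentagonalSeries ℤ ^ k) := by
  rw [← Polynomial.coeff_coe, Polynomial.coe_pow]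
  refine PowerSeries.coeff_pow_congr (n := n) (fun i hi => ?_) k n le_rfl
  rw [← coeff_prod_range_one_sub_X_pow (hi.trans h), ← Polynomial.coeToPowerSeries.ringHom_apply,
    map_prod, Finset.range_eq_Ico, Finset.prod_Ico_add' (fun m => (1 - X ^ m : ℤ⟦X⟧)) 0 N 1]
  simp only [map_sub, map_one, map_pow, Polynomial.coeToPowerSeries.ringHom_apply,
    Polynomial.coe_X]
  rfl

end EulerProduct

section SqAddThreeSq

theorem sq_add_three_mul_sq_unique {p x y u v : ℕ} (hp : p.Prime) (hx : 0 < x) (hy : 0 < y)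
    (hu : 0 < u) (hv : 0 < v) (h : p = x ^ 2 + 3 * y ^ 2) (h' : p = u ^ 2 + 3 * v ^ 2) :
    x = u ∧ y = v := by
  zify at h h'
  have hp0 : (0 : ℤ) < p := by exact_mod_cast hp.pos
  have hdvd : (p : ℤ) ∣ (x * v - u * y) * (x * v + u * y) :=
    ⟨v ^ 2 - y ^ 2, by linear_combination ((y : ℤ) ^ 2) * h' - ((v : ℤ) ^ 2) * h⟩
  rcases (Nat.prime_iff_prime_int.mp hp).dvd_or_dvd hdvd with ⟨k, hk⟩ | ⟨k, hk⟩
  · have hs : (p : ℤ) ^ 2 = (x * u + 3 * y * v) ^ 2 + 3 * (p * k) ^ 2 := by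
      rw [← hk]
      linear_combination (p : ℤ) * h + (x ^ 2 + 3 * y ^ 2 : ℤ) * h'
    have hk0 : k = 0 := by
      by_contra hk0
      have : 1 ≤ k ^ 2 := by have := sq_pos_of_ne_zero hk0; lia
      nlinarith [sq_nonneg (x * u + 3 * y * v : ℤ), pow_pos hp0 2]
    rw [hk0, mul_zero] at hk
    have hxu : (x : ℤ) ^ 2 = u ^ 2 := by
      refine mul_left_cancel₀ hp0.ne' ?_
      linear_combination (x ^ 2 : ℤ) * h' - (u ^ 2 : ℤ) * h + 3 * (x * v + u * y) * hk
    have hxu' : x = u := by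
      exact_mod_cast (pow_left_inj₀ (by positivity) (by positivity) two_ne_zero).mp hxu
    refine ⟨hxu', ?_⟩
    subst hxu'
    have : (x : ℤ) * v = x * y := by linear_combination hk
    exact_mod_cast (mul_left_cancel₀ (by positivity) this).symm
  · exfalso
    have hs : (p : ℤ) ^ 2 = (x * u - 3 * y * v) ^ 2 + 3 * (x * v + u * y) ^ 2 := by
      linear_combination (p : ℤ) * h + (x ^ 2 + 3 * y ^ 2 : ℤ) * h'
    have hpos : (0 : ℤ) < x * v + u * y := by positivity
    have hle : (p : ℤ) ≤ x * v + u * y := Int.le_of_dvd hpos ⟨k, hk⟩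
    nlinarith [sq_nonneg (x * u - 3 * y * v : ℤ)]

theorem ZMod.exists_sq_eq_neg_three {p : ℕ} [Fact p.Prime] (h : p % 3 = 1) :
    ∃ r : ZMod p, r ^ 2 = -3 := by
  have hp : p.Prime := Fact.out
  obtain ⟨z, hz⟩ := exists_prime_orderOf_dvd_card (G := (ZMod p)ˣ) 3
    (by rw [ZMod.card_units]; have := hp.pos; lia)
  have h3 : (z : ZMod p) ^ 3 = 1 := by
    rw [← Units.val_pow_eq_pow_val, ← hz, pow_orderOf_eq_one, Units.val_one]
  have h1 : (z : ZMod p) - 1 ≠ 0 := by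
    intro h0
    rw [sub_eq_zero, Units.val_eq_one] at h0
    rw [h0, orderOf_one] at hz
    norm_num at hz
  have h2 : (z : ZMod p) ^ 2 + z + 1 = 0 := by
    refine (mul_eq_zero.mp ?_).resolve_left h1
    linear_combination h3
  exact ⟨2 * z + 1, by linear_combination 4 * h2⟩

/-- **Thue's lemma** for a prime modulus. -/
theorem ZMod.exists_small_mul {p : ℕ} [Fact p.Prime] (r : ZMod p) :
    ∃ x y : ℤ, (x ≠ 0 ∨ y ≠ 0) ∧ x ^ 2 < p ∧ y ^ 2 < p ∧ (x : ZMod p) = r * y := by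
  have hp : p.Prime := Fact.out
  set s := p.sqrt
  let S := Finset.range (s + 1) ×ˢ Finset.range (s + 1)
  have hcard : (Finset.univ : Finset (ZMod p)).card < S.card := by
    rw [Finset.card_univ, ZMod.card, Finset.card_product, Finset.card_range]
    exact Nat.lt_succ_sqrt p
  obtain ⟨⟨a, b⟩, hab, ⟨c, d⟩, hcd, hne, heq⟩ := Finset.exists_ne_map_eq_of_card_lt_of_maps_to hcard
    (f := fun z : ℕ × ℕ => (z.1 : ZMod p) - r * z.2) (fun _ _ => Finset.mem_coe.2 (Finset.mem_univ _))
  have hs : s ^ 2 < p := by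
    refine lt_of_le_of_ne (Nat.sqrt_le' p) fun h => ?_
    rw [← h] at hp
    exact Nat.Prime.not_prime_pow le_rfl hp
  have hsq : ∀ {m n : ℕ}, m < s + 1 → n < s + 1 → ((m : ℤ) - n) ^ 2 < p := by
    intro m n hm hn
    have : ((m : ℤ) - n) ^ 2 ≤ (s : ℤ) ^ 2 := sq_le_sq' (by lia) (by lia)
    have hs' : (s : ℤ) ^ 2 < p := by exact_mod_cast hs
    lia
  simp only [S, Finset.mem_product, Finset.mem_range] at hab hcd
  refine ⟨a - c, b - d, ?_, hsq hab.1 hcd.1, hsq hab.2 hcd.2, ?_⟩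
  · rw [Ne, Prod.mk.injEq] at hne
    lia
  · push_cast
    linear_combination heq

theorem Nat.Prime.exists_sq_add_three_mul_sq {p : ℕ} (hp : p.Prime) (h : p % 6 = 1) :
    ∃ x y : ℕ, 0 < x ∧ 0 < y ∧ p = x ^ 2 + 3 * y ^ 2 := by
  have := Fact.mk hp
  obtain ⟨r, hr⟩ := ZMod.exists_sq_eq_neg_three (p := p) (by lia)
  obtain ⟨x, y, hxy, hx, hy, he⟩ := ZMod.exists_small_mul r
  obtain ⟨k, hk⟩ : (p : ℤ) ∣ x ^ 2 + 3 * y ^ 2 := by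
    rw [← ZMod.intCast_zmod_eq_zero_iff_dvd]
    push_cast
    rw [he]
    linear_combination (y : ZMod p) ^ 2 * hr
  have hp0 : (0 : ℤ) < p := by exact_mod_cast hp.pos
  have hkpos : 0 < k := by
    refine pos_of_mul_pos_right (a := (p : ℤ)) ?_ hp0.le
    rw [← hk]
    rcases hxy with h0 | h0 <;> positivity
  have hk4 : k < 4 := by nlinarith
  suffices hz : ∃ x y : ℤ, (p : ℤ) = x ^ 2 + 3 * y ^ 2 by
    obtain ⟨u, v, huv⟩ := hz
    have huv' : p = u.natAbs ^ 2 + 3 * v.natAbs ^ 2 := by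
      zify
      simpa using huv
    refine ⟨u.natAbs, v.natAbs, Nat.pos_of_ne_zero fun h0 => ?_, Nat.pos_of_ne_zero fun h0 => ?_,
      huv'⟩
    · rw [h0] at huv'
      lia
    · rw [h0] at huv'
      rw [huv'] at hp
      exact Nat.Prime.not_prime_pow le_rfl (by simpa using hp)
  have hx4 : x ^ 2 % 4 = 0 ∨ x ^ 2 % 4 = 1 := by
    rcases Int.emod_two_eq_zero_or_one x with h0 | h0
    · obtain ⟨t, rfl⟩ : ∃ t, x = 2 * t := ⟨x / 2, by lia⟩
      left; ring_nf; lia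
    · obtain ⟨t, rfl⟩ : ∃ t, x = 2 * t + 1 := ⟨x / 2, by lia⟩
      right; ring_nf; lia
  have hy4 : y ^ 2 % 4 = 0 ∨ y ^ 2 % 4 = 1 := by
    rcases Int.emod_two_eq_zero_or_one y with h0 | h0
    · obtain ⟨t, rfl⟩ : ∃ t, y = 2 * t := ⟨y / 2, by lia⟩
      left; ring_nf; lia
    · obtain ⟨t, rfl⟩ : ∃ t, y = 2 * t + 1 := ⟨y / 2, by lia⟩
      right; ring_nf; lia
  interval_cases k
  · exact ⟨x, y, by linear_combination -hk⟩
  · lia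
  · obtain ⟨t, rfl⟩ : (3 : ℤ) ∣ x := by
      refine Int.prime_three.dvd_of_dvd_pow (n := 2) ⟨p - y ^ 2, ?_⟩
      linear_combination hk
    exact ⟨y, t, by linarith⟩

end SqAddThreeSq

/-- The integer points `(i, j, l)` with `i(i+1)/2 + j(j+1)/2 + l(l+1)/2 = n`. -/
noncomputable def triangularTriples (n : ℕ) : Finset (ℤ × ℤ × ℤ) :=
  ((Finset.Icc (-(2 * n + 1 : ℤ)) (2 * n + 1)) ×ˢ (Finset.Icc (-(2 * n + 1 : ℤ)) (2 * n + 1)) ×ˢ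
    (Finset.Icc (-(2 * n + 1 : ℤ)) (2 * n + 1))).filter
    fun v => v.1 * (v.1 + 1) + v.2.1 * (v.2.1 + 1) + v.2.2 * (v.2.2 + 1) = 2 * n

theorem mul_succ_self_nonneg (a : ℤ) : 0 ≤ a * (a + 1) := by
  rcases le_or_gt 0 a with h | h
  · positivity
  · nlinarith

theorem mem_triangularTriples {n : ℕ} {i j l : ℤ} :
    (i, j, l) ∈ triangularTriples n ↔ i * (i + 1) + j * (j + 1) + l * (l + 1) = 2 * n := by
  simp only [triangularTriples, Finset.mem_filter, Finset.mem_product, Finset.mem_Icc,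
    and_iff_right_iff_imp]
  intro h
  have hi := mul_succ_self_nonneg i
  have hj := mul_succ_self_nonneg j
  have hl := mul_succ_self_nonneg l
  refine ⟨⟨?_, ?_⟩, ⟨?_, ?_⟩, ⟨?_, ?_⟩⟩ <;> nlinarith

/-- Up to sign and scaling, the product of the roots of `A₂` times a quadratic form. -/
def rootQuintic (u v w : ℤ) : ℤ :=
  (2 * u - v - w) * (2 * v - w - u) * (2 * w - u - v) *
    (u ^ 2 + v ^ 2 + w ^ 2 - 3 * (u + v + w) ^ 2)

theorem coe_negOnePow_reflect (a b : ℤ) :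
    ((Int.negOnePow (-1 - a + b) : ℤˣ) : ℤ) = -(Int.negOnePow (a + b) : ℤˣ) := by
  rw [← Units.val_neg, ← Int.negOnePow_succ]
  congr 1
  rw [Int.negOnePow_eq_iff]
  exact ⟨-1 - a, by ring⟩

section Flip

variable (n : ℕ) (g : ℤ → ℤ → ℤ → ℤ)

theorem signed_sum_flip_fst :
    ∑ v ∈ triangularTriples n, ((v.1 + v.2.1 + v.2.2).negOnePow : ℤ) * g v.1 v.2.1 v.2.2 =
    -∑ v ∈ triangularTriples n,
      ((v.1 + v.2.1 + v.2.2).negOnePow : ℤ) * g (-1 - v.1) v.2.1 v.2.2 := by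
  rw [← Finset.sum_neg_distrib]
  refine Finset.sum_nbij' (fun v => (-1 - v.1, v.2.1, v.2.2)) (fun v => (-1 - v.1, v.2.1, v.2.2))
    ?_ ?_ ?_ ?_ ?_
  · rintro ⟨i, j, l⟩ h
    rw [mem_triangularTriples] at h ⊢
    linear_combination h
  · rintro ⟨i, j, l⟩ h
    rw [mem_triangularTriples] at h ⊢
    linear_combination h
  · rintro ⟨i, j, l⟩ _; simp
  · rintro ⟨i, j, l⟩ _; simp
  · rintro ⟨i, j, l⟩ _
    have := coe_negOnePow_reflect i (j + l)
    simp only [← add_assoc] at this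
    simp [this]

theorem sum_triangularTriples_rotate (F : ℤ → ℤ → ℤ → ℤ) :
    ∑ v ∈ triangularTriples n, F v.1 v.2.1 v.2.2 =
    ∑ v ∈ triangularTriples n, F v.2.1 v.2.2 v.1 := by
  refine Finset.sum_nbij' (fun v => (v.2.2, v.1, v.2.1)) (fun v => (v.2.1, v.2.2, v.1))
    ?_ ?_ ?_ ?_ ?_
  · rintro ⟨i, j, l⟩ h
    rw [mem_triangularTriples] at h ⊢
    linear_combination h
  · rintro ⟨i, j, l⟩ h
    rw [mem_triangularTriples] at h ⊢
    linear_combination h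
  all_goals rintro ⟨i, j, l⟩ _; rfl

theorem signed_sum_rotate :
    ∑ v ∈ triangularTriples n, ((v.1 + v.2.1 + v.2.2).negOnePow : ℤ) * g v.1 v.2.1 v.2.2 =
    ∑ v ∈ triangularTriples n, ((v.1 + v.2.1 + v.2.2).negOnePow : ℤ) * g v.2.1 v.2.2 v.1 := by
  rw [sum_triangularTriples_rotate n fun a b c => ((a + b + c).negOnePow : ℤ) * g a b c]
  refine Finset.sum_congr rfl fun v _ => ?_
  rw [add_comm (v.2.1 + v.2.2), ← add_assoc]

theorem signed_sum_flip_snd :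
    ∑ v ∈ triangularTriples n, ((v.1 + v.2.1 + v.2.2).negOnePow : ℤ) * g v.1 v.2.1 v.2.2 =
    -∑ v ∈ triangularTriples n,
      ((v.1 + v.2.1 + v.2.2).negOnePow : ℤ) * g v.1 (-1 - v.2.1) v.2.2 := by
  have h := signed_sum_flip_fst n fun a b c => g c a b
  rw [signed_sum_rotate n fun a b c => g c a b,
    signed_sum_rotate n fun a b c => g c (-1 - a) b] at h
  exact h

theorem signed_sum_flip_trd :
    ∑ v ∈ triangularTriples n, ((v.1 + v.2.1 + v.2.2).negOnePow : ℤ) * g v.1 v.2.1 v.2.2 =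
    -∑ v ∈ triangularTriples n,
      ((v.1 + v.2.1 + v.2.2).negOnePow : ℤ) * g v.1 v.2.1 (-1 - v.2.2) := by
  have h := signed_sum_flip_snd n fun a b c => g c a b
  rw [signed_sum_rotate n fun a b c => g c a b,
    signed_sum_rotate n fun a b c => g c a (-1 - b)] at h
  exact h

end Flip

/-- The signed quintic weight of a point. -/
def quinticWeight (v : ℤ × ℤ × ℤ) : ℤ :=
  ((v.1 + v.2.1 + v.2.2).negOnePow : ℤ) *
    rootQuintic (2 * v.1 + 1) (2 * v.2.1 + 1) (2 * v.2.2 + 1)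

theorem sum_quinticWeight (n : ℕ) : ∑ v ∈ triangularTriples n, quinticWeight v = 0 := by
  have key (g : ℤ → ℤ → ℤ → ℤ) :
      8 * ∑ v ∈ triangularTriples n, ((v.1 + v.2.1 + v.2.2).negOnePow : ℤ) * g v.1 v.2.1 v.2.2 =
      ∑ v ∈ triangularTriples n, ((v.1 + v.2.1 + v.2.2).negOnePow : ℤ) *
        (g v.1 v.2.1 v.2.2 - g (-1 - v.1) v.2.1 v.2.2 - g v.1 (-1 - v.2.1) v.2.2
          - g v.1 v.2.1 (-1 - v.2.2) + g (-1 - v.1) (-1 - v.2.1) v.2.2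
          + g (-1 - v.1) v.2.1 (-1 - v.2.2) + g v.1 (-1 - v.2.1) (-1 - v.2.2)
          - g (-1 - v.1) (-1 - v.2.1) (-1 - v.2.2)) := by
    simp only [mul_sub, mul_add, Finset.sum_sub_distrib, Finset.sum_add_distrib]
    have h1 := signed_sum_flip_fst n g
    have h2 := signed_sum_flip_snd n g
    have h3 := signed_sum_flip_trd n g
    have h4 := signed_sum_flip_snd n fun a b c => g (-1 - a) b c
    have h5 := signed_sum_flip_trd n fun a b c => g (-1 - a) b c
    have h6 := signed_sum_flip_trd n fun a b c => g a (-1 - b) c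
    have h7 := signed_sum_flip_trd n fun a b c => g (-1 - a) (-1 - b) c
    linarith
  have h := key fun a b c => rootQuintic (2 * a + 1) (2 * b + 1) (2 * c + 1)
  rw [Finset.sum_eq_zero (s := triangularTriples n) (f := fun v => _ * (_ - _))] at h
  · simpa [quinticWeight] using h
  · intro v _
    unfold rootQuintic
    ring

theorem sum_quinticWeight_mod_zero (n : ℕ) :
    ∑ v ∈ triangularTriples n with (v.1 + v.2.1 + v.2.2) % 3 = 0, quinticWeight v = 0 := by
  suffices h : ∑ v ∈ triangularTriples n with (v.1 + v.2.1 + v.2.2) % 3 = 0, quinticWeight v =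
      -∑ v ∈ triangularTriples n with (v.1 + v.2.1 + v.2.2) % 3 = 0, quinticWeight v by linarith
  rw [← Finset.sum_neg_distrib]
  let φ : ℤ × ℤ × ℤ → ℤ × ℤ × ℤ := fun v =>
    (2 * ((v.1 + v.2.1 + v.2.2) / 3) - v.1, 2 * ((v.1 + v.2.1 + v.2.2) / 3) - v.2.1,
      2 * ((v.1 + v.2.1 + v.2.2) / 3) - v.2.2)
  have hφ : ∀ v ∈ (triangularTriples n).filter fun v => (v.1 + v.2.1 + v.2.2) % 3 = 0,
      φ v ∈ (triangularTriples n).filter fun v => (v.1 + v.2.1 + v.2.2) % 3 = 0 := by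
    rintro ⟨i, j, l⟩ h
    rw [Finset.mem_filter, mem_triangularTriples] at h
    obtain ⟨m, hm⟩ : (3 : ℤ) ∣ i + j + l := Int.dvd_of_emod_eq_zero h.2
    have hm' : (i + j + l) / 3 = m := by lia
    simp only [φ, hm', Finset.mem_filter, mem_triangularTriples]
    refine ⟨?_, by lia⟩
    obtain rfl : l = 3 * m - i - j := by lia
    linear_combination h.1
  have hinv : ∀ v ∈ (triangularTriples n).filter fun v => (v.1 + v.2.1 + v.2.2) % 3 = 0,
      φ (φ v) = v := by
    rintro ⟨i, j, l⟩ h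
    rw [Finset.mem_filter, mem_triangularTriples] at h
    simp only [φ, Prod.mk.injEq]
    lia
  refine Finset.sum_nbij' φ φ hφ hφ hinv hinv ?_
  rintro ⟨i, j, l⟩ h
  rw [Finset.mem_filter] at h
  obtain ⟨m, hm⟩ : (3 : ℤ) ∣ i + j + l := Int.dvd_of_emod_eq_zero h.2
  have hm' : (i + j + l) / 3 = m := by lia
  simp only [φ, hm', quinticWeight, rootQuintic]
  obtain rfl : l = 3 * m - i - j := by lia
  ring_nf

theorem sum_quinticWeight_mod_two (n : ℕ) :
    ∑ v ∈ triangularTriples n with (v.1 + v.2.1 + v.2.2) % 3 = 2, quinticWeight v =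
    ∑ v ∈ triangularTriples n with (v.1 + v.2.1 + v.2.2) % 3 = 1, quinticWeight v := by
  refine Finset.sum_nbij' (fun v => (-1 - v.1, -1 - v.2.1, -1 - v.2.2))
    (fun v => (-1 - v.1, -1 - v.2.1, -1 - v.2.2)) ?_ ?_ ?_ ?_ ?_
  · rintro ⟨i, j, l⟩ h
    rw [Finset.mem_filter, mem_triangularTriples] at h ⊢
    exact ⟨by linear_combination h.1, by lia⟩
  · rintro ⟨i, j, l⟩ h
    rw [Finset.mem_filter, mem_triangularTriples] at h ⊢
    exact ⟨by linear_combination h.1, by lia⟩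
  · rintro ⟨i, j, l⟩ _; simp
  · rintro ⟨i, j, l⟩ _; simp
  · rintro ⟨i, j, l⟩ _
    have h : (-1 - i + (-1 - j) + (-1 - l)).negOnePow = -(i + j + l).negOnePow := by
      rw [← Int.negOnePow_succ, Int.negOnePow_eq_iff]
      exact ⟨-2 - i - j - l, by ring⟩
    simp only [quinticWeight, rootQuintic, h, Units.val_neg]
    ring

theorem sum_quinticWeight_mod_one (n : ℕ) :
    ∑ v ∈ triangularTriples n with (v.1 + v.2.1 + v.2.2) % 3 = 1, quinticWeight v = 0 := by
  have h := sum_quinticWeight n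
  have hsplit := Finset.sum_fiberwise_of_maps_to (s := triangularTriples n)
    (t := Finset.Ico (0 : ℤ) 3) (g := fun v => (v.1 + v.2.1 + v.2.2) % 3) (f := quinticWeight)
    (fun v _ => by simp only [Finset.mem_Ico]; lia)
  rw [show Finset.Ico (0 : ℤ) 3 = {0, 1, 2} by rfl, Finset.sum_insert (by decide),
    Finset.sum_pair (by decide), sum_quinticWeight_mod_zero, sum_quinticWeight_mod_two, h] at hsplit
  linarith

/-- The pairs `(x, y)` such that the Eisenstein integer `x + yω` has norm `m` and is congruent to
`1` modulo `√-3`. -/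
noncomputable def primaryShell (m : ℕ) : Finset (ℤ × ℤ) :=
  ((Finset.Icc (-(2 * m : ℤ)) (2 * m)) ×ˢ (Finset.Icc (-(2 * m : ℤ)) (2 * m))).filter
    fun z => (z.1 + z.2) % 3 = 1 ∧ z.1 ^ 2 - z.1 * z.2 + z.2 ^ 2 = m

theorem mem_primaryShell {m : ℕ} {x y : ℤ} :
    (x, y) ∈ primaryShell m ↔ (x + y) % 3 = 1 ∧ x ^ 2 - x * y + y ^ 2 = m := by
  simp only [primaryShell, Finset.mem_filter, Finset.mem_product, Finset.mem_Icc,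
    and_iff_right_iff_imp]
  rintro ⟨-, h⟩
  have hx : x ^ 2 ≤ (2 * m : ℤ) ^ 2 := by
    rcases Nat.eq_zero_or_pos m with rfl | hm
    · push_cast at h ⊢; nlinarith [sq_nonneg (x - 2 * y)]
    · have : (1 : ℤ) ≤ m := by exact_mod_cast hm
      nlinarith [sq_nonneg (x - 2 * y)]
  have hy : y ^ 2 ≤ (2 * m : ℤ) ^ 2 := by
    rcases Nat.eq_zero_or_pos m with rfl | hm
    · push_cast at h ⊢; nlinarith [sq_nonneg (2 * x - y)]
    · have : (1 : ℤ) ≤ m := by exact_mod_cast hm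
      nlinarith [sq_nonneg (2 * x - y)]
  have := abs_le_of_sq_le_sq' hx (by positivity)
  have := abs_le_of_sq_le_sq' hy (by positivity)
  tauto

/-- The trace of the cube of the Eisenstein integer `x + yω`. -/
def cubeTrace (x y : ℤ) : ℤ := (2 * x - y) * (x + y) * (x - 2 * y)

/-- The sum of the traces of the cubes of the primary Eisenstein integers of norm `m`. -/
noncomputable def shellSum (m : ℕ) : ℤ := ∑ z ∈ primaryShell m, cubeTrace z.1 z.2

section Fiber

open PowerSeries

theorem pentagonal_le_of_mem {n : ℕ} {i j l k : ℤ} (h : (i, j, l) ∈ triangularTriples n)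
    (hk : i + j + l = 3 * k - 2) : pentagonal k ≤ n := by
  rw [mem_triangularTriples] at h
  have hp := two_mul_natCast_pentagonal k
  zify
  obtain rfl : l = 3 * k - 2 - i - j := by lia
  nlinarith [sq_nonneg (i - j), sq_nonneg (i - (3 * k - 2 - i - j)),
    sq_nonneg (j - (3 * k - 2 - i - j))]

theorem sum_quinticWeight_fiber (a : ℕ) (k : ℤ) :
    ∑ v ∈ triangularTriples (a + pentagonal k) with v.1 + v.2.1 + v.2.2 = 3 * k - 2,
      quinticWeight v =
    64 * ((a - 8 * pentagonal k) * shellSum (3 * a + 1) * (k.negOnePow : ℤ)) := by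
  have hp := two_mul_natCast_pentagonal k
  rw [shellSum, Finset.mul_sum, Finset.sum_mul, Finset.mul_sum]
  refine Finset.sum_nbij' (fun v => (v.1 - v.2.1, v.2.2 - v.2.1))
    (fun z => (k + (2 * z.1 - z.2 - 2) / 3, k + (-z.1 - z.2 - 2) / 3, k + (2 * z.2 - z.1 - 2) / 3))
    ?_ ?_ ?_ ?_ ?_
  · rintro ⟨i, j, l⟩ h
    rw [Finset.mem_filter, mem_triangularTriples] at h
    obtain ⟨h, hk⟩ := h
    rw [mem_primaryShell]
    dsimp only at hk
    obtain rfl : l = 3 * k - 2 - i - j := by lia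
    refine ⟨by lia, ?_⟩
    push_cast at h ⊢
    linarith
  · rintro ⟨x, y⟩ h
    rw [mem_primaryShell] at h
    obtain ⟨h, hN⟩ := h
    obtain ⟨m, hm⟩ : ∃ m, x + y = 3 * m + 1 := ⟨(x + y) / 3, by lia⟩
    obtain rfl : y = 3 * m + 1 - x := by lia
    have e1 : (2 * x - (3 * m + 1 - x) - 2) / 3 = x - m - 1 := by lia
    have e2 : (-x - (3 * m + 1 - x) - 2) / 3 = -m - 1 := by lia
    have e3 : (2 * (3 * m + 1 - x) - x - 2) / 3 = 2 * m - x := by lia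
    rw [Finset.mem_filter, mem_triangularTriples, e1, e2, e3]
    refine ⟨?_, by ring⟩
    push_cast at hN ⊢
    linarith
  · rintro ⟨i, j, l⟩ h
    rw [Finset.mem_filter] at h
    simp only [Prod.mk.injEq]
    lia
  · rintro ⟨x, y⟩ h
    rw [mem_primaryShell] at h
    simp only [Prod.mk.injEq]
    lia
  · rintro ⟨i, j, l⟩ h
    rw [Finset.mem_filter, mem_triangularTriples] at h
    obtain ⟨h, hk⟩ := h
    dsimp only at hk
    have hs : (i + j + l).negOnePow = k.negOnePow := by
      rw [hk, Int.negOnePow_eq_iff]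
      exact ⟨k - 1, by ring⟩
    simp only [quinticWeight, hs, rootQuintic, cubeTrace]
    obtain rfl : l = 3 * k - 2 - i - j := by lia
    push_cast at h
    have hq : (2 * i + 1) ^ 2 + (2 * j + 1) ^ 2 + (2 * (3 * k - 2 - i - j) + 1) ^ 2 -
        3 * (2 * i + 1 + (2 * j + 1) + (2 * (3 * k - 2 - i - j) + 1)) ^ 2 =
        8 * (a - 8 * (pentagonal k : ℤ)) := by linarith
    rw [hq]
    ring

/-- The generating series of `shellSum` along `3n + 1`. -/
noncomputable def shellSeries : ℤ⟦X⟧ := .mk fun n => shellSum (3 * n + 1)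

theorem coeff_X_mul_derivative (F : ℤ⟦X⟧) (n : ℕ) :
    coeff n (X * d⁄dX ℤ F) = n * coeff n F := by
  cases n with
  | zero => simp
  | succ n =>
    rw [coeff_succ_X_mul, coeff_derivative]
    push_cast
    ring

theorem sum_quinticWeight_antidiagonal {n : ℕ} {p : ℕ × ℕ}
    (hp : p ∈ Finset.HasAntidiagonal.antidiagonal n) :
    ∑ v ∈ (triangularTriples n).filter (fun v => (v.1 + v.2.1 + v.2.2) % 3 = 1) with
      (n - pentagonal ((v.1 + v.2.1 + v.2.2 + 2) / 3),
        pentagonal ((v.1 + v.2.1 + v.2.2 + 2) / 3)) = p, quinticWeight v =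
    64 * ((p.1 - 8 * p.2) * coeff p.1 shellSeries * coeff p.2 (pentagonalSeries ℤ)) := by
  obtain ⟨a, b⟩ := p
  rw [Finset.HasAntidiagonal.mem_antidiagonal] at hp
  dsimp only at hp
  by_cases hb : b ∈ Set.range pentagonal
  · obtain ⟨k, rfl⟩ := hb
    subst hp
    rw [coeff_pentagonalSeries_pentagonal, shellSeries, coeff_mk]
    refine Eq.trans (Finset.sum_congr ?_ fun _ _ => rfl) (sum_quinticWeight_fiber a k)
    ext ⟨i, j, l⟩
    simp only [Finset.mem_filter, Prod.mk.injEq, pentagonal_inj, and_assoc]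
    refine and_congr_right fun h => ?_
    constructor
    · rintro ⟨h1, -, h3⟩
      lia
    · intro h1
      have : (i + j + l + 2) / 3 = k := by lia
      rw [this]
      exact ⟨by lia, by simp, rfl⟩
  · rw [coeff_pentagonalSeries_eq_zero ℤ hb, mul_zero, mul_zero]
    refine Finset.sum_eq_zero fun v hv => ?_
    rw [Finset.mem_filter] at hv
    exact absurd ⟨_, (Prod.mk.inj hv.2).2⟩ hb

theorem derivative_shellSeries :
    d⁄dX ℤ shellSeries * pentagonalSeries ℤ =
      8 * (shellSeries * d⁄dX ℤ (pentagonalSeries ℤ)) := by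
  suffices h : (X * d⁄dX ℤ shellSeries) * pentagonalSeries ℤ =
      8 * (shellSeries * (X * d⁄dX ℤ (pentagonalSeries ℤ))) by
    refine mul_left_cancel₀ (X_ne_zero (R := ℤ)) ?_
    linear_combination h
  ext n
  have h := sum_quinticWeight_mod_one n
  rw [← Finset.sum_fiberwise_of_maps_to (t := Finset.HasAntidiagonal.antidiagonal n)
    (g := fun v => (n - pentagonal ((v.1 + v.2.1 + v.2.2 + 2) / 3),
        pentagonal ((v.1 + v.2.1 + v.2.2 + 2) / 3))),
    Finset.sum_congr rfl fun p hp => sum_quinticWeight_antidiagonal hp, ← Finset.mul_sum] at h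
  · rw [← sub_eq_zero, ← map_sub,
      show (8 : ℤ⟦X⟧) = C 8 by simp, map_sub, coeff_C_mul, coeff_mul, coeff_mul, Finset.mul_sum,
      ← Finset.sum_sub_distrib]
    refine Eq.trans (Finset.sum_congr rfl fun p _ => ?_) (by simpa using h)
    rw [coeff_X_mul_derivative, coeff_X_mul_derivative]
    ring
  · rintro ⟨i, j, l⟩ h
    rw [Finset.mem_filter] at h
    have := pentagonal_le_of_mem h.1 (k := (i + j + l + 2) / 3) (by lia)
    rw [Finset.HasAntidiagonal.mem_antidiagonal]
    dsimp only
    lia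

theorem constantCoeff_pentagonalSeries : constantCoeff (pentagonalSeries ℤ) = 1 := by
  simpa [pentagonal_def] using coeff_pentagonalSeries_pentagonal ℤ 0

theorem shellSum_one : shellSum 1 = 6 := by
  have : primaryShell 1 = {(1, 0), (0, 1), (-1, -1)} := by
    unfold primaryShell
    decide
  rw [shellSum, this]
  decide

theorem shellSeries_eq : shellSeries = 6 * pentagonalSeries ℤ ^ 8 := by
  obtain ⟨u, hu⟩ : IsUnit (pentagonalSeries ℤ) := by
    rw [isUnit_iff_constantCoeff, constantCoeff_pentagonalSeries]
    exact isUnit_one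
  have hd := derivative_shellSeries
  rw [← hu] at hd ⊢
  have hu' : (u : ℤ⟦X⟧) * (↑u⁻¹ : ℤ⟦X⟧) = 1 := u.mul_inv
  have key : shellSeries * (↑u⁻¹ : ℤ⟦X⟧) ^ 8 = C 6 := by
    refine derivative.ext ?_ ?_
    · rw [Derivation.leibniz, derivative_pow, derivative_inv, derivative_C]
      simp only [smul_eq_mul]
      push_cast
      linear_combination (↑u⁻¹ : ℤ⟦X⟧) ^ 9 * hd -
        (↑u⁻¹ : ℤ⟦X⟧) ^ 8 * d⁄dX ℤ shellSeries * hu'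
    · have h1 : constantCoeff (↑u⁻¹ : ℤ⟦X⟧) = 1 := by
        have h2 := congrArg constantCoeff hu'
        rw [map_mul, hu, constantCoeff_pentagonalSeries, one_mul, map_one] at h2
        exact h2
      rw [map_mul, map_pow, h1, ← coeff_zero_eq_constantCoeff_apply, shellSeries, coeff_mk]
      simp only [mul_zero, zero_add, shellSum_one, one_pow, mul_one]
      exact (constantCoeff_C 6).symm
  have h6 : (6 : ℤ⟦X⟧) = C 6 := by simp
  rw [h6, ← key, mul_assoc, ← mul_pow, mul_comm (↑u⁻¹ : ℤ⟦X⟧), hu']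
  simp

end Fiber

section Hecke

/-- Multiplication by the Eisenstein integer `a + bω` in coordinates. -/
def eisensteinMul (a b : ℤ) (z : ℤ × ℤ) : ℤ × ℤ :=
  (a * z.1 - b * z.2, a * z.2 + b * z.1 - b * z.2)

theorem eisensteinMul_injective {a b : ℤ} (h : a ^ 2 - a * b + b ^ 2 ≠ 0) :
    Function.Injective (eisensteinMul a b) := by
  rintro ⟨x, y⟩ ⟨u, v⟩ heq
  obtain ⟨h1, h2⟩ := Prod.mk.inj heq
  dsimp only at h1 h2
  refine Prod.ext (mul_left_cancel₀ h ?_) (mul_left_cancel₀ h ?_)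
  · dsimp only
    linear_combination (a - b) * h1 + b * h2
  · dsimp only
    linear_combination a * h2 - b * h1

theorem eisensteinMul_mem_primaryShell {a b : ℤ} {p m : ℕ} (hp0 : p ≠ 0) (hab : (a + b) % 3 = 1)
    (hp : a ^ 2 - a * b + b ^ 2 = p) {z : ℤ × ℤ} :
    eisensteinMul a b z ∈ primaryShell (p * m) ↔ z ∈ primaryShell m := by
  obtain ⟨x, y⟩ := z
  simp only [eisensteinMul, mem_primaryShell]
  have hN : (a * x - b * y) ^ 2 - (a * x - b * y) * (a * y + b * x - b * y) +
      (a * y + b * x - b * y) ^ 2 = p * (x ^ 2 - x * y + y ^ 2) := by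
    rw [← hp]; ring
  have hp0' : (p : ℤ) ≠ 0 := by exact_mod_cast hp0
  rw [hN, Nat.cast_mul, mul_right_inj' hp0']
  obtain ⟨t, ht⟩ : ∃ t, a = 3 * t + 1 - b := ⟨(a + b) / 3, by lia⟩
  have : a * x - b * y + (a * y + b * x - b * y) = x + y + 3 * (t * (x + y) - b * y) := by
    rw [ht]; ring
  rw [this]
  refine and_congr_left fun _ => ?_
  lia

theorem sum_image_eisensteinMul {a b : ℤ} (h : a ^ 2 - a * b + b ^ 2 ≠ 0) (m : ℕ) :
    ∑ z ∈ (primaryShell m).image (eisensteinMul a b), cubeTrace z.1 z.2 =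
      ∑ z ∈ primaryShell m, cubeTrace (a * z.1 - b * z.2) (a * z.2 + b * z.1 - b * z.2) :=
  Finset.sum_image (eisensteinMul_injective h).injOn

theorem exists_eisensteinMul_of_dvd {a b x y : ℤ} {p m : ℕ} (hp : p.Prime)
    (hab : a ^ 2 - a * b + b ^ 2 = p) (hN : x ^ 2 - x * y + y ^ 2 = p * m)
    (h : (p : ℤ) ∣ a * y - b * x) : ∃ z, eisensteinMul a b z = (x, y) := by
  have hp' := Nat.prime_iff_prime_int.mp hp
  have hp0 : (p : ℤ) ≠ 0 := hp'.ne_zero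
  obtain ⟨v, hv⟩ := h
  obtain ⟨u, hu⟩ : (p : ℤ) ∣ (a - b) * x + b * y := by
    refine hp'.dvd_of_dvd_pow (n := 2)
      ⟨p * m + v * ((a - b) * x + b * y) - p * v ^ 2, ?_⟩
    linear_combination (p : ℤ) * hN + (x ^ 2 - x * y + y ^ 2) * hab +
      ((a - b) * x + b * y - (a * y - b * x) - p * v) * hv
  refine ⟨(u, v), Prod.ext (mul_left_cancel₀ hp0 ?_) (mul_left_cancel₀ hp0 ?_)⟩
  · simp only [eisensteinMul]
    linear_combination x * hab - a * hu + b * hv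
  · simp only [eisensteinMul]
    linear_combination y * hab - b * hu - (a - b) * hv

/-- The Eisenstein integers of norm `p * m` are divisible by one of the primes above a split
prime `p`. -/
theorem primaryShell_mul_eq_union {a b : ℤ} {p : ℕ} (hp : p.Prime) (hab : (a + b) % 3 = 1)
    (hN : a ^ 2 - a * b + b ^ 2 = p) (m : ℕ) :
    primaryShell (p * m) = (primaryShell m).image (eisensteinMul a b) ∪
      (primaryShell m).image (eisensteinMul (a - b) (-b)) := by
  have hab' : (a - b + -b) % 3 = 1 := by lia
  have hN' : (a - b) ^ 2 - (a - b) * -b + (-b) ^ 2 = p := by linear_combination hN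
  have h1 := fun z => eisensteinMul_mem_primaryShell (m := m) hp.ne_zero hab hN (z := z)
  have h2 := fun z => eisensteinMul_mem_primaryShell (m := m) hp.ne_zero hab' hN' (z := z)
  ext ⟨x, y⟩
  simp only [Finset.mem_union, Finset.mem_image]
  constructor
  · intro h
    have hxy := (mem_primaryShell.mp h).2
    push_cast at hxy
    have hdvd : (p : ℤ) ∣ (a * y - b * x) * ((a - b) * y - -b * x) :=
      ⟨y ^ 2 - b ^ 2 * m, by linear_combination y ^ 2 * hN - b ^ 2 * hxy⟩
    rcases (Nat.prime_iff_prime_int.mp hp).dvd_or_dvd hdvd with hd | hd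
    · obtain ⟨z, hz⟩ := exists_eisensteinMul_of_dvd hp hN hxy hd
      exact Or.inl ⟨z, (h1 z).mp (hz ▸ h), hz⟩
    · obtain ⟨z, hz⟩ := exists_eisensteinMul_of_dvd hp hN' hxy hd
      exact Or.inr ⟨z, (h2 z).mp (hz ▸ h), hz⟩
  · rintro (⟨z, hz, he⟩ | ⟨z, hz, he⟩)
    · rw [← he]; exact (h1 z).mpr hz
    · rw [← he]; exact (h2 z).mpr hz

theorem dvd_of_mem_image_inter {a b : ℤ} {p m : ℕ} (hp : p.Prime) (hab : (a + b) % 3 = 1)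
    (hN : a ^ 2 - a * b + b ^ 2 = p) {x y : ℤ}
    (h : (x, y) ∈ (primaryShell m).image (eisensteinMul a b) ∩
      (primaryShell m).image (eisensteinMul (a - b) (-b))) : (p : ℤ) ∣ x ∧ (p : ℤ) ∣ y := by
  have hp' := Nat.prime_iff_prime_int.mp hp
  simp only [Finset.mem_inter, Finset.mem_image] at h
  obtain ⟨⟨⟨u, v⟩, -, h1⟩, ⟨⟨s, t⟩, -, h2⟩⟩ := h
  obtain ⟨h1x, h1y⟩ := Prod.mk.inj h1
  obtain ⟨h2x, h2y⟩ := Prod.mk.inj h2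
  dsimp only at h1x h1y h2x h2y
  have hb : ¬ (p : ℤ) ∣ b := by
    rintro ⟨c, hc⟩
    obtain ⟨d, hd⟩ : (p : ℤ) ∣ a :=
      hp'.dvd_of_dvd_pow (n := 2) ⟨1 + a * c - p * c ^ 2, by rw [hc] at hN; linear_combination hN⟩
    refine hp'.not_dvd_one ⟨d ^ 2 - d * c + c ^ 2, mul_left_cancel₀ hp'.ne_zero ?_⟩
    rw [hc, hd] at hN
    linear_combination -hN
  have hthree : ¬ (p : ℤ) ∣ 3 := by
    intro h3
    have : p = 3 := (Nat.prime_dvd_prime_iff_eq hp Nat.prime_three).mp (by exact_mod_cast h3)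
    obtain ⟨t, ht⟩ : ∃ t, a = 3 * t + 1 - b := ⟨(a + b) / 3, by lia⟩
    rw [this, ht] at hN
    push_cast at hN
    ring_nf at hN
    lia
  have e1 : (p : ℤ) ∣ b * (2 * x - y) :=
    ⟨t - v, by
      rw [← hN]
      linear_combination (b - a) * h2y - b * h2x + a * h1y - b * h1x⟩
  have e2 : (p : ℤ) ∣ b * (x - 2 * y) :=
    ⟨s - u, by
      rw [← hN]
      linear_combination -a * h2x + b * h2y + (a - b) * h1x + b * h1y⟩
  have d1 := (hp'.dvd_or_dvd e1).resolve_left hb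
  have d2 := (hp'.dvd_or_dvd e2).resolve_left hb
  constructor
  · refine (hp'.dvd_or_dvd (a := 3) ?_).resolve_left hthree
    have := (d1.mul_left 2).sub d2
    ring_nf at this ⊢
    exact this
  · refine (hp'.dvd_or_dvd (a := 3) ?_).resolve_left hthree
    have := d1.sub (d2.mul_left 2)
    ring_nf at this ⊢
    exact this

/-- The Hecke relation at a split prime, before the intersection term is evaluated. -/
theorem shellSum_mul_add_inter {a b : ℤ} {p : ℕ} (hp : p.Prime) (hab : (a + b) % 3 = 1)
    (hN : a ^ 2 - a * b + b ^ 2 = p) (m : ℕ) :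
    shellSum (p * m) + ∑ z ∈ (primaryShell m).image (eisensteinMul a b) ∩
      (primaryShell m).image (eisensteinMul (a - b) (-b)), cubeTrace z.1 z.2 =
    cubeTrace a b * shellSum m := by
  have hp0 : (p : ℤ) ≠ 0 := by exact_mod_cast hp.ne_zero
  rw [shellSum, primaryShell_mul_eq_union hp hab hN, Finset.sum_union_inter,
    sum_image_eisensteinMul (hN ▸ hp0),
    sum_image_eisensteinMul (by rw [← hN] at hp0; convert hp0 using 1; ring),
    ← Finset.sum_add_distrib, shellSum, Finset.mul_sum]
  refine Finset.sum_congr rfl fun z _ => ?_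
  unfold cubeTrace
  ring

theorem sq_dvd_of_mem_primaryShell {p m : ℕ} {x y : ℤ} (h : (x, y) ∈ primaryShell m)
    (hx : (p : ℤ) ∣ x) (hy : (p : ℤ) ∣ y) : p ^ 2 ∣ m := by
  obtain ⟨u, rfl⟩ := hx
  obtain ⟨v, rfl⟩ := hy
  have hN := (mem_primaryShell.mp h).2
  zify
  exact ⟨u ^ 2 - u * v + v ^ 2, by rw [← hN]; ring⟩

theorem shellSum_split_mul_of_not_dvd {a b : ℤ} {p : ℕ} (hp : p.Prime) (hab : (a + b) % 3 = 1)
    (hN : a ^ 2 - a * b + b ^ 2 = p) {m : ℕ} (hm : ¬ p ∣ m) :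
    shellSum (p * m) = cubeTrace a b * shellSum m := by
  rw [← shellSum_mul_add_inter hp hab hN, Finset.sum_eq_zero, add_zero]
  rintro ⟨x, y⟩ h
  refine absurd ?_ hm
  obtain ⟨hx, hy⟩ := dvd_of_mem_image_inter hp hab hN h
  have h' : (x, y) ∈ primaryShell (p * m) := by
    rw [primaryShell_mul_eq_union hp hab hN]
    exact Finset.mem_union_left _ (Finset.mem_inter.mp h).1
  have := sq_dvd_of_mem_primaryShell h' hx hy
  rw [pow_two] at this
  exact Nat.dvd_of_mul_dvd_mul_left hp.pos this

theorem shellSum_split_mul_mul {a b : ℤ} {p : ℕ} (hp : p.Prime) (hab : (a + b) % 3 = 1)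
    (hN : a ^ 2 - a * b + b ^ 2 = p) (m : ℕ) :
    shellSum (p * (p * m)) = cubeTrace a b * shellSum (p * m) - p ^ 3 * shellSum m := by
  have hp0 : (p : ℤ) ≠ 0 := by exact_mod_cast hp.ne_zero
  have hab' : (a - b + -b) % 3 = 1 := by lia
  have hN' : (a - b) ^ 2 - (a - b) * -b + (-b) ^ 2 = p := by linear_combination hN
  rw [← shellSum_mul_add_inter hp hab hN, eq_sub_iff_add_eq, add_right_inj]
  rw [shellSum, Finset.mul_sum]
  symm
  have hp3 : (p : ℤ) % 3 = 1 := by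
    obtain ⟨t, ht⟩ : ∃ t, a = 3 * t + 1 - b := ⟨(a + b) / 3, by lia⟩
    rw [← hN, ht]
    ring_nf
    lia
  have hshell : ∀ {u v : ℤ}, (p * u, p * v) ∈ primaryShell (p * (p * m)) ↔
      (u, v) ∈ primaryShell m := by
    intro u v
    have := eisensteinMul_mem_primaryShell (a := p) (b := 0) (p := p * p) (m := m) (z := (u, v))
      (mul_ne_zero hp.ne_zero hp.ne_zero) (by lia) (by push_cast; ring)
    simpa [eisensteinMul, mul_assoc] using this
  refine Finset.sum_nbij' (fun z => (z.1 / p, z.2 / p)) (fun z => (p * z.1, p * z.2)) ?_ ?_ ?_ ?_ ?_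
  · rintro ⟨x, y⟩ h
    obtain ⟨⟨u, rfl⟩, ⟨v, rfl⟩⟩ := dvd_of_mem_image_inter hp hab hN h
    rw [Int.mul_ediv_cancel_left _ hp0, Int.mul_ediv_cancel_left _ hp0, ← hshell,
      primaryShell_mul_eq_union hp hab hN]
    exact Finset.mem_union_left _ (Finset.mem_inter.mp h).1
  · rintro ⟨u, v⟩ h
    have h1 := (eisensteinMul_mem_primaryShell hp.ne_zero hab hN).mpr h
    have h2 := (eisensteinMul_mem_primaryShell hp.ne_zero hab' hN').mpr h
    simp only [Finset.mem_inter, Finset.mem_image]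
    refine ⟨⟨_, h2, ?_⟩, ⟨_, h1, ?_⟩⟩
    · simp only [eisensteinMul, Prod.mk.injEq]
      constructor
      · linear_combination u * hN
      · linear_combination v * hN
    · simp only [eisensteinMul, Prod.mk.injEq]
      constructor
      · linear_combination u * hN
      · linear_combination v * hN
  · rintro ⟨x, y⟩ h
    obtain ⟨⟨u, rfl⟩, ⟨v, rfl⟩⟩ := dvd_of_mem_image_inter hp hab hN h
    simp only [Int.mul_ediv_cancel_left _ hp0]
  · rintro ⟨u, v⟩ h
    simp only [Int.mul_ediv_cancel_left _ hp0]
  · rintro ⟨x, y⟩ h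
    obtain ⟨⟨u, rfl⟩, ⟨v, rfl⟩⟩ := dvd_of_mem_image_inter hp hab hN h
    dsimp only
    rw [Int.mul_ediv_cancel_left _ hp0, Int.mul_ediv_cancel_left _ hp0]
    unfold cubeTrace
    ring

theorem dvd_of_inert {p : ℕ} (hp : p.Prime) (h3 : p % 3 = 2) {x y : ℤ}
    (h : (p : ℤ) ∣ x ^ 2 - x * y + y ^ 2) : (p : ℤ) ∣ x ∧ (p : ℤ) ∣ y := by
  have := Fact.mk hp
  simp only [← ZMod.intCast_zmod_eq_zero_iff_dvd] at h ⊢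
  push_cast at h
  have hpow (z : ZMod p) : (z ^ 3) ^ (2 * (p / 3) + 1) = z := by
    rw [← pow_mul, show 3 * (2 * (p / 3) + 1) = p + (p - 1) by lia, pow_add, ZMod.pow_card,
      ← pow_succ', Nat.sub_add_cancel hp.one_le, ZMod.pow_card]
  have hxy : (x : ZMod p) = -y := by
    rw [← hpow x, ← hpow (-y)]
    congr 1
    linear_combination (x + y : ZMod p) * h
  have hthree : (3 : ZMod p) ≠ 0 := by
    intro h0
    have := (ZMod.natCast_eq_zero_iff 3 p).mp (by exact_mod_cast h0)
    have := (Nat.prime_dvd_prime_iff_eq hp Nat.prime_three).mp this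
    lia
  have hy : (y : ZMod p) = 0 := by
    refine pow_eq_zero_iff two_ne_zero |>.mp ((mul_eq_zero.mp ?_).resolve_left hthree)
    rw [hxy] at h
    linear_combination h
  exact ⟨by rw [hxy, hy, neg_zero], hy⟩

theorem shellSum_inert_mul_of_not_dvd {p : ℕ} (hp : p.Prime) (h3 : p % 3 = 2) {m : ℕ}
    (hm : ¬ p ∣ m) : shellSum (p * m) = 0 := by
  refine Finset.sum_eq_zero ?_
  rintro ⟨x, y⟩ h
  have hN := (mem_primaryShell.mp h).2
  obtain ⟨hx, hy⟩ := dvd_of_inert hp h3 (x := x) (y := y) ⟨m, by rw [hN]; push_cast; ring⟩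
  have := sq_dvd_of_mem_primaryShell h hx hy
  rw [pow_two] at this
  exact absurd (Nat.dvd_of_mul_dvd_mul_left hp.pos this) hm

theorem shellSum_inert_mul_mul {p : ℕ} (hp : p.Prime) (h3 : p % 3 = 2) (m : ℕ) :
    shellSum (p * (p * m)) = -p ^ 3 * shellSum m := by
  have hp0 : (p : ℤ) ≠ 0 := by exact_mod_cast hp.ne_zero
  have himage : primaryShell (p * (p * m)) = (primaryShell m).image (eisensteinMul (-p) 0) := by
    have hmem := fun z => eisensteinMul_mem_primaryShell (a := -p) (b := 0) (p := p * p) (m := m)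
      (z := z) (mul_ne_zero hp.ne_zero hp.ne_zero) (by lia) (by push_cast; ring)
    rw [mul_assoc] at hmem
    ext ⟨x, y⟩
    rw [Finset.mem_image]
    constructor
    · intro h
      have hN := (mem_primaryShell.mp h).2
      obtain ⟨⟨u, rfl⟩, ⟨v, rfl⟩⟩ :=
        dvd_of_inert hp h3 (x := x) (y := y) ⟨p * m, by rw [hN]; push_cast; ring⟩
      have he : eisensteinMul (-p) 0 (-u, -v) = (p * u, p * v) := by simp [eisensteinMul]
      exact ⟨(-u, -v), (hmem _).mp (he ▸ h), he⟩
    · rintro ⟨z, hz, he⟩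
      rw [← he]
      exact (hmem z).mpr hz
  rw [shellSum, himage, sum_image_eisensteinMul (by simpa using hp0), shellSum, Finset.mul_sum]
  refine Finset.sum_congr rfl fun z _ => ?_
  unfold cubeTrace
  ring

theorem shellSum_three_mul (m : ℕ) : shellSum (3 * m) = 0 := by
  refine Finset.sum_eq_zero ?_
  rintro ⟨x, y⟩ h
  obtain ⟨h1, hN⟩ := mem_primaryShell.mp h
  obtain ⟨t, rfl⟩ : ∃ t, x = 3 * t + 1 - y := ⟨(x + y) / 3, by lia⟩
  push_cast at hN
  ring_nf at hN
  lia

end Hecke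

section Multiplicative

variable {f : ℕ → ℤ}

/-- A second-order recursion in the exponent of `p` transfers to prime powers. -/
theorem shellSum_pow_mul_of_recurrence {p : ℕ} {s t : ℤ} (h0 : f (p ^ 0) = 1) (h1 : f (p ^ 1) = s)
    (hrec : ∀ r, f (p ^ (r + 2)) = s * f (p ^ (r + 1)) - t * f (p ^ r)) {m : ℕ}
    (hm : shellSum (p * m) = s * shellSum m)
    (hmul : ∀ m, shellSum (p * (p * m)) = s * shellSum (p * m) - t * shellSum m) (r : ℕ) :
    shellSum (p ^ r * m) = f (p ^ r) * shellSum m := by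
  induction r using Nat.twoStepInduction with
  | zero => rw [h0, pow_zero, one_mul, one_mul]
  | one => rw [h1, pow_one, hm]
  | more r ih ih' =>
    rw [hrec, show p ^ (r + 2) * m = p * (p * (p ^ r * m)) by ring, hmul,
      show p * (p ^ r * m) = p ^ (r + 1) * m by ring, ih', ih]
    ring

/-- Powers of `A`, `B` with `A ≠ B` give a Lucas sequence. -/
theorem lucas_recurrence {K : Type*} [Field K] {A B ε : K} (hAB : A - B ≠ 0) (hε : ε ^ 2 = 1)
    {g : ℕ → K} (hg : ∀ r, g r = ε ^ r * (A ^ (r + 1) - B ^ (r + 1)) / (A - B)) (r : ℕ) :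
    g (r + 2) = ε * (A + B) * g (r + 1) - A * B * g r := by
  rw [hg, hg, hg]
  field_simp
  linear_combination -(A ^ (r + 1) - B ^ (r + 1)) * A * B * ε ^ r * hε

theorem split_recurrence {p x y : ℕ} (h6 : p % 6 = 1) (hy : 0 < y)
    (hxy : p = x ^ 2 + 3 * y ^ 2) (hf1 : f 1 = 1)
    (hfb : ∀ r : ℕ, 1 ≤ r →
      (f (p ^ r) : ℂ) =
        (if Odd r ∧ x % 3 ≠ 1 then (-1 : ℂ) else 1) *
          (((x : ℂ) * ((x : ℂ) ^ 2 - 9 * (y : ℂ) ^ 2) +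
              3 * Real.sqrt 3 * Complex.I * y * ((x : ℂ) ^ 2 - (y : ℂ) ^ 2)) ^ (r + 1) -
            ((x : ℂ) * ((x : ℂ) ^ 2 - 9 * (y : ℂ) ^ 2) -
              3 * Real.sqrt 3 * Complex.I * y * ((x : ℂ) ^ 2 - (y : ℂ) ^ 2)) ^ (r + 1)) /
          (6 * Real.sqrt 3 * Complex.I * y * ((x : ℂ) ^ 2 - (y : ℂ) ^ 2))) :
    ∃ a b : ℤ, (a + b) % 3 = 1 ∧ a ^ 2 - a * b + b ^ 2 = p ∧ f (p ^ 1) = cubeTrace a b ∧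
      ∀ r, f (p ^ (r + 2)) = cubeTrace a b * f (p ^ (r + 1)) - p ^ 3 * f (p ^ r) := by
  obtain ⟨ε, hε, hεx, hεr⟩ : ∃ ε : ℤ, ε ^ 2 = 1 ∧ (ε * x) % 3 = 1 ∧
      ∀ r : ℕ, (if Odd r ∧ x % 3 ≠ 1 then (-1 : ℂ) else 1) = (ε : ℂ) ^ r := by
    by_cases h3 : x % 3 = 1
    · exact ⟨1, by norm_num, by lia, fun r => by simp [h3]⟩
    · have h0 : x % 3 ≠ 0 := by
        intro h0
        obtain ⟨t, rfl⟩ : 3 ∣ x := Nat.dvd_of_mod_eq_zero h0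
        have : p % 3 = 0 := by rw [hxy]; ring_nf; lia
        lia
      refine ⟨-1, by norm_num, by lia, fun r => ?_⟩
      rcases Nat.even_or_odd r with hr | hr
      · simp [hr.neg_one_pow, Nat.not_odd_iff_even.mpr hr]
      · simp [hr.neg_one_pow, hr, h3]
  set A : ℂ := (x : ℂ) * ((x : ℂ) ^ 2 - 9 * (y : ℂ) ^ 2) +
    3 * Real.sqrt 3 * Complex.I * y * ((x : ℂ) ^ 2 - (y : ℂ) ^ 2) with hA
  set B : ℂ := (x : ℂ) * ((x : ℂ) ^ 2 - 9 * (y : ℂ) ^ 2) -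
    3 * Real.sqrt 3 * Complex.I * y * ((x : ℂ) ^ 2 - (y : ℂ) ^ 2) with hB
  have hD : 6 * Real.sqrt 3 * Complex.I * y * ((x : ℂ) ^ 2 - (y : ℂ) ^ 2) = A - B := by
    rw [hA, hB]; ring
  have hAB : A - B ≠ 0 := by
    rw [← hD]
    have hne : (x : ℂ) ^ 2 - (y : ℂ) ^ 2 ≠ 0 := by
      rw [sub_ne_zero]
      intro h
      have h' : x ^ 2 = y ^ 2 := by exact_mod_cast h
      rw [h'] at hxy
      lia
    have h3 : ((Real.sqrt 3 : ℝ) : ℂ) ≠ 0 := by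
      exact_mod_cast (Real.sqrt_pos.mpr (by norm_num : (0 : ℝ) < 3)).ne'
    have hy0 : (y : ℂ) ≠ 0 := by exact_mod_cast hy.ne'
    simp [hne, h3, hy0]
  have hsqrt : ((Real.sqrt 3 : ℝ) : ℂ) ^ 2 = 3 := by
    rw [← Complex.ofReal_pow, Real.sq_sqrt (by norm_num)]
    norm_num
  have hprod : A * B = (p : ℂ) ^ 3 := by
    rw [hA, hB, hxy]
    push_cast
    linear_combination (-9 * Complex.I ^ 2 * (y : ℂ) ^ 2 * ((x : ℂ) ^ 2 - (y : ℂ) ^ 2) ^ 2) * hsqrt -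
      27 * (y : ℂ) ^ 2 * ((x : ℂ) ^ 2 - (y : ℂ) ^ 2) ^ 2 * Complex.I_sq
  have hg : ∀ r, (f (p ^ r) : ℂ) = (ε : ℂ) ^ r * (A ^ (r + 1) - B ^ (r + 1)) / (A - B) := by
    intro r
    rcases Nat.eq_zero_or_pos r with rfl | hr
    · simp [hf1, hAB]
    · rw [hfb r hr, hεr, hD]
  have hεC : (ε : ℂ) ^ 2 = 1 := by exact_mod_cast hε
  have hε3 : (ε : ℂ) ^ 3 = ε := by rw [pow_succ, hεC, one_mul]
  have htr : (cubeTrace (ε * x + y) (2 * y) : ℂ) = ε * (A + B) := by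
    rw [hA, hB, cubeTrace]
    push_cast
    linear_combination 2 * (x : ℂ) ^ 3 * hε3
  refine ⟨ε * x + y, 2 * y, by lia, ?_, ?_, fun r => ?_⟩
  · rw [hxy]
    push_cast
    linear_combination (x : ℤ) ^ 2 * hε
  · have : (f (p ^ 1) : ℂ) = cubeTrace (ε * x + y) (2 * y) := by
      rw [hg, htr]
      field_simp
      ring
    exact_mod_cast this
  · have := lucas_recurrence hAB hεC hg r
    rw [← htr, hprod] at this
    exact_mod_cast this

theorem shellSum_eq_six_mul (hf1 : f 1 = 1)
    (hfmul : ∀ m n : ℕ, Nat.Coprime m n → f (m * n) = f m * f n)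
    (h : ∀ p r m : ℕ, p.Prime → ¬ p ∣ m → shellSum (p ^ r * m) = f (p ^ r) * shellSum m) :
    ∀ n : ℕ, n ≠ 0 → shellSum n = 6 * f n := by
  intro n
  induction n using Nat.strong_induction_on with
  | _ n ih =>
    intro hn
    rcases eq_or_ne n 1 with rfl | hn1
    · rw [shellSum_one, hf1, mul_one]
    have hp := Nat.minFac_prime hn1
    obtain ⟨r, m, hm, hnm⟩ := Nat.exists_eq_pow_mul_and_not_dvd hn n.minFac hp.ne_one
    have hpn := n.minFac_dvd
    generalize n.minFac = p at hp hm hnm hpn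
    subst hnm
    have hm0 : m ≠ 0 := by rintro rfl; exact hm (dvd_zero p)
    have hr : r ≠ 0 := by
      rintro rfl
      exact hm (by simpa using hpn)
    have hlt : m < p ^ r * m :=
      lt_mul_of_one_lt_left (Nat.pos_of_ne_zero hm0) (one_lt_pow₀ hp.one_lt hr)
    rw [h p r m hp hm, ih m hlt hm0,
      hfmul _ _ (Nat.Coprime.pow_left r ((Nat.Prime.coprime_iff_not_dvd hp).mpr hm))]
    ring

end Multiplicative

/-- With `a n` the coefficient of `q^n` in `∏ (1 - q^m)^8`, and `f` the
multiplicative function with the stated values on prime powers (involving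
`p = x² + 3y²` for `p ≡ 1 (mod 6)`), we have `a n = f (3 n + 1)` for all `n`;
moreover the representing pair is unique. -/
theorem stmt_16 (a : ℕ → ℤ)
    (ha : ∀ n N : ℕ, n ≤ N →
      a n = (((∏ m ∈ Finset.Icc 1 N, ((1 : Polynomial ℤ) - Polynomial.X ^ m)) ^ 8).coeff n))
    (f : ℕ → ℤ)
    (hf1 : f 1 = 1)
    (hfmul : ∀ m n : ℕ, Nat.Coprime m n → f (m * n) = f m * f n)
    (hfa : ∀ p r : ℕ, p.Prime → 1 ≤ r → p % 3 = 2 → Even r →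
      f (p ^ r) = (-1) ^ (r / 2) * (p : ℤ) ^ (3 * r / 2))
    (hfb : ∀ p r x y : ℕ, p.Prime → 1 ≤ r → p % 6 = 1 → 0 < x → 0 < y →
      p = x ^ 2 + 3 * y ^ 2 →
      (f (p ^ r) : ℂ) =
        (if Odd r ∧ x % 3 ≠ 1 then (-1 : ℂ) else 1) *
          (((x : ℂ) * ((x : ℂ) ^ 2 - 9 * (y : ℂ) ^ 2) +
              3 * Real.sqrt 3 * Complex.I * y * ((x : ℂ) ^ 2 - (y : ℂ) ^ 2)) ^ (r + 1) -
            ((x : ℂ) * ((x : ℂ) ^ 2 - 9 * (y : ℂ) ^ 2) -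
              3 * Real.sqrt 3 * Complex.I * y * ((x : ℂ) ^ 2 - (y : ℂ) ^ 2)) ^ (r + 1)) /
          (6 * Real.sqrt 3 * Complex.I * y * ((x : ℂ) ^ 2 - (y : ℂ) ^ 2)))
    (hf0 : ∀ p r : ℕ, p.Prime → 1 ≤ r → ¬(p % 6 = 1) → ¬(p % 3 = 2 ∧ Even r) →
      f (p ^ r) = 0) :
    (∀ p : ℕ, p.Prime → p % 6 = 1 →
      ∃! xy : ℕ × ℕ, 0 < xy.1 ∧ 0 < xy.2 ∧ p = xy.1 ^ 2 + 3 * xy.2 ^ 2) ∧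
    ∀ n : ℕ, a n = f (3 * n + 1) := by
  have hcase : ∀ p : ℕ, p.Prime → p = 3 ∨ p % 6 = 1 ∨ p % 3 = 2 := by
    intro p hp
    rcases eq_or_ne p 3 with rfl | h3
    · exact Or.inl rfl
    · have h30 : p % 3 ≠ 0 := fun h0 =>
        h3 ((Nat.prime_dvd_prime_iff_eq Nat.prime_three hp).mp (Nat.dvd_of_mod_eq_zero h0)).symm
      rcases hp.eq_two_or_odd with rfl | h2 <;> lia
  have hlocal : ∀ p r m : ℕ, p.Prime → ¬ p ∣ m →
      shellSum (p ^ r * m) = f (p ^ r) * shellSum m := by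
    intro p r m hp hm
    rcases hcase p hp with rfl | h6 | h3
    · rcases Nat.eq_zero_or_pos r with rfl | hr
      · rw [pow_zero, hf1, one_mul, one_mul]
      · rw [hf0 3 r hp hr (by norm_num) (by norm_num), zero_mul,
          show 3 ^ r * m = 3 * (3 ^ (r - 1) * m) by
            rw [← mul_assoc, ← pow_succ', Nat.sub_add_cancel hr], shellSum_three_mul]
    · obtain ⟨x, y, hx, hy, hxy⟩ := hp.exists_sq_add_three_mul_sq h6
      obtain ⟨a, b, hab, hN, h1, hrec⟩ := split_recurrence h6 hy hxy hf1
        fun r hr => hfb p r x y hp hr h6 hx hy hxy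
      exact shellSum_pow_mul_of_recurrence (by rw [pow_zero, hf1]) h1 hrec
        (shellSum_split_mul_of_not_dvd hp hab hN hm) (shellSum_split_mul_mul hp hab hN) r
    · have hodd : ∀ r, Odd r → f (p ^ r) = 0 := fun r hr =>
        hf0 p r hp hr.pos (by lia) fun h => Nat.not_even_iff_odd.mpr hr h.2
      have heven : ∀ k, f (p ^ (2 * k)) = (-p ^ 3) ^ k := by
        intro k
        rcases Nat.eq_zero_or_pos k with rfl | hk
        · simp [hf1]
        · rw [hfa p (2 * k) hp (by lia) h3 (even_two_mul k), Nat.mul_div_cancel_left _ two_pos,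
            show 3 * (2 * k) / 2 = 3 * k by lia, neg_pow ((p : ℤ) ^ 3), pow_mul]
      refine shellSum_pow_mul_of_recurrence (s := 0) (t := p ^ 3) (by rw [pow_zero, hf1])
        (hodd 1 odd_one) (fun r => ?_) ?_ (fun m => ?_) r
      · rcases Nat.even_or_odd' r with ⟨k, rfl | rfl⟩
        · rw [show 2 * k + 2 = 2 * (k + 1) by ring, heven, heven]
          ring
        · rw [hodd (2 * k + 1) (odd_two_mul_add_one k), hodd (2 * k + 1 + 2) ⟨k + 1, by ring⟩]
          ring
      · rw [shellSum_inert_mul_of_not_dvd hp h3 hm, zero_mul]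
      · rw [shellSum_inert_mul_mul hp h3]
        ring
  constructor
  · intro p hp h6
    obtain ⟨x, y, hx, hy, hxy⟩ := hp.exists_sq_add_three_mul_sq h6
    refine ⟨(x, y), ⟨hx, hy, hxy⟩, ?_⟩
    rintro ⟨u, v⟩ ⟨hu, hv, huv⟩
    obtain ⟨h1, h2⟩ := sq_add_three_mul_sq_unique hp hu hv hx hy huv hxy
    exact Prod.ext h1 h2
  · intro n
    have h1 := shellSum_eq_six_mul hf1 hfmul hlocal (3 * n + 1) (Nat.succ_ne_zero _)
    have h2 := congrArg (PowerSeries.coeff n) shellSeries_eq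
    have h6 : (6 : PowerSeries ℤ) = PowerSeries.C 6 := by simp
    rw [shellSeries, PowerSeries.coeff_mk, h1, h6, PowerSeries.coeff_C_mul] at h2
    rw [ha n n le_rfl, coeff_prod_one_sub_X_pow_pow le_rfl]
    linarith
end

section
/- Let a_n be the coefficient of q^n in ∏_{m=1}^∞ (1 - q^m)^{10}. Let f : ℕ → ℤ be the multiplicative arithmetic function determined on prime powers as follows. For p ≡ 7 or 11 (mod 12): f(p^r) = p^{2r} if r is even and f(p^r) = 0 if r is odd; f(2^r) = f(3^r) = 0 for all r ≥ 1. For p ≡ 5 (mod 12): writing (u, v) for the unique pair of positive integers with p = u^2 + v^2, u odd and v even, f(p) = 8·φ(u,v)·u·v·(u^2 − v^2), where φ(u,v) = −1 if either (u ≡ 1 (mod 6) and v ≢ 4 (mod 6)) or (u ≢ 1 (mod 6) and v ≡ 4 (mod 6)), and φ(u,v) = 1 otherwise. For p ≡ 1 (mod 12): with (u, v) as above, f(p) = 2·θ(u)·(2uv + u^2 − v^2)·(2uv + v^2 − u^2), where θ(u) = 1 if u ≡ 3 (mod 6) and θ(u) = −1 otherwise. For p ≡ 1 or 5 (mod 12)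 and r ≥ 2: f(p^r) = f(p)·f(p^{r−1}) − p^4·f(p^{r−2}). Then 48·a_n = f(12n + 5) for all n ≥ 0. -/
namespace EtaTen

section

open Complex Filter Topology
open scoped Real NNReal MatrixGroups ModularForm

/-- The theta series of the odd character modulo 4, up to a constant. -/
noncomputable def oddTheta (τ : ℂ) : ℂ :=
  cexp (π * I * τ / 4) * jacobiTheta₂' (1 / 2 + τ / 2) τ

theorem jacobiTheta₂_half_add_half (τ : ℂ) : jacobiTheta₂ (1 / 2 + τ / 2) τ = 0 := by
  have h1 := jacobiTheta₂_add_left' (-(1 / 2 + τ / 2) + 1) τ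
  rw [jacobiTheta₂_add_left, jacobiTheta₂_neg_left] at h1
  rw [show -(1 / 2 + τ / 2) + 1 + τ = 1 / 2 + τ / 2 by ring,
    show -π * I * (τ + 2 * (-(1 / 2 + τ / 2) + 1)) = -(π * I) by ring, Complex.exp_neg,
    Complex.exp_pi_mul_I] at h1
  have h2 : (2 : ℂ) * jacobiTheta₂ (1 / 2 + τ / 2) τ = 0 := by
    linear_combination h1
  simpa using h2

/-- The automorphy factor of `oddTheta` under `τ ↦ -1/τ`. -/
noncomputable def oddThetaFactor (τ : ℂ) : ℂ := -I * τ * (-I * τ) ^ (1 / 2 : ℂ)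

theorem oddTheta_neg_inv {τ : ℂ} (hτ : 0 < τ.im) :
    oddTheta (-1 / τ) = oddThetaFactor τ * oddTheta τ := by
  have hτ0 : τ ≠ 0 := by rintro rfl; simp at hτ
  have hfe := jacobiTheta₂'_functional_equation (1 / 2 + τ / 2) τ
  have hz : (1 / 2 + τ / 2) / τ = -(1 / 2 + (-1 / τ) / 2) + 1 := by field_simp; ring
  rw [hz, jacobiTheta₂'_add_left, jacobiTheta₂'_neg_left, jacobiTheta₂_add_left,
    jacobiTheta₂_neg_left, jacobiTheta₂_half_add_half] at hfe
  have hexp : cexp (-π * I * (1 / 2 + τ / 2) ^ 2 / τ) * cexp (π * I * τ / 4) =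
      -I * cexp (π * I * (-1 / τ) / 4) := by
    rw [← Complex.exp_neg_pi_div_two_mul_I, ← Complex.exp_add, ← Complex.exp_add]
    congr 1
    field_simp
    ring
  have hne : (-I * τ) ^ (1 / 2 : ℂ) ≠ 0 := by
    simp [Complex.cpow_eq_zero_iff, hτ0]
  unfold oddTheta oddThetaFactor
  rw [hfe]
  generalize jacobiTheta₂' (1 / 2 + -1 / τ / 2) (-1 / τ) = t
  generalize (-I * τ) ^ (1 / 2 : ℂ) = r at *
  have : -I * τ * r * (cexp (π * I * τ / 4) *
      (1 / r * cexp (-π * I * (1 / 2 + τ / 2) ^ 2 / τ) / τ *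
      (-t - 2 * π * I * (1 / 2 + τ / 2) * 0))) =
      I * t * (cexp (-π * I * (1 / 2 + τ / 2) ^ 2 / τ) * cexp (π * I * τ / 4)) := by
    field_simp
    ring
  rw [this, hexp]
  linear_combination (t * cexp (π * I * (-1 / τ) / 4)) * I_mul_I

theorem oddThetaFactor_three_mul (τ : ℂ) :
    oddThetaFactor (3 * τ) = 27 * oddThetaFactor (τ / 3) := by
  unfold oddThetaFactor
  have h : (-I * (3 * τ)) ^ (1 / 2 : ℂ) = 3 * (-I * (τ / 3)) ^ (1 / 2 : ℂ) := by
    rw [show -I * (3 * τ) = 9 * (-I * (τ / 3)) by ring]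
    generalize -I * (τ / 3) = z
    rcases eq_or_ne z 0 with rfl | hz
    · simp
    · have h9 : Complex.log (9 * z) = Real.log 9 + Complex.log z := by
        exact_mod_cast Complex.log_ofReal_mul (r := 9) (by norm_num) hz
      have h3 : Real.log 9 = 2 * Real.log 3 := by
        rw [show (9 : ℝ) = 3 ^ 2 by norm_num, Real.log_pow]; simp
      have he : cexp ((Real.log 3 : ℝ) : ℂ) = 3 := by
        rw [← Complex.ofReal_exp, Real.exp_log (by norm_num)]; simp
      rw [Complex.cpow_def_of_ne_zero (by simpa using hz), Complex.cpow_def_of_ne_zero hz, h9, h3,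
        add_mul, Complex.exp_add]
      congr 1
      rw [← he]
      congr 1
      push_cast
      ring
  rw [h]
  ring

theorem oddThetaFactor_sq (τ : ℂ) : oddThetaFactor τ ^ 2 = I * τ ^ 3 := by
  unfold oddThetaFactor
  have h : ((-I * τ) ^ (1 / 2 : ℂ)) ^ 2 = -I * τ := by
    rw [← Complex.cpow_nat_mul]; simp
  rw [mul_pow, h]
  linear_combination (-I * τ ^ 3) * I_sq

theorem differentiableAt_oddThetaFactor {τ : ℂ} (hτ : 0 < τ.im) :
    DifferentiableAt ℂ oddThetaFactor τ := by
  unfold oddThetaFactor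
  have : -I * τ ∈ slitPlane := by
    rw [mem_slitPlane_iff]; left; simpa using hτ
  fun_prop (disch := assumption)

/-- The coefficients of `∑ χ₄(m) m X ^ (m ^ 2)`, the sum being over `m > 0`. -/
def thetaCoeff (N : ℕ) : ℤ := if N.sqrt * N.sqrt = N then ZMod.χ₄ N.sqrt * N.sqrt else 0

theorem thetaCoeff_sq (m : ℕ) : thetaCoeff (m ^ 2) = ZMod.χ₄ m * m := by
  simp [thetaCoeff, pow_two, Nat.sqrt_eq]

theorem thetaCoeff_eq_zero {N : ℕ} (h : ∀ m, N ≠ m ^ 2) : thetaCoeff N = 0 := by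
  rw [thetaCoeff, if_neg]
  intro h'
  exact h N.sqrt (by rw [pow_two, h'])

theorem chi_four_two_mul_add_one (n : ℕ) : ZMod.χ₄ ((2 * n + 1 : ℕ) : ZMod 4) = (-1) ^ n := by
  rw [ZMod.χ₄_eq_neg_one_pow (by omega)]
  congr 1
  omega

/-- `exp (2 π i τ / 24)`. -/
noncomputable def nome (τ : ℂ) : ℂ := cexp (π * I * τ / 12)

theorem nome_pow (τ : ℂ) (n : ℕ) : nome τ ^ n = nome (n * τ) := by
  rw [nome, nome, ← Complex.exp_nat_mul]
  congr 1
  ring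

theorem norm_nome_lt_one {τ : ℂ} (hτ : 0 < τ.im) : ‖nome τ‖ < 1 := by
  have : (π * I * τ / 12).re = -(π * τ.im / 12) := by
    rw [show (π * I * τ / 12 : ℂ) = ((π / 12 : ℝ) : ℂ) * (I * τ) by push_cast; ring,
      Complex.re_ofReal_mul]
    simp
    ring
  rw [nome, Complex.norm_exp, this, Real.exp_lt_one_iff]
  have := Real.pi_pos
  simp
  positivity

theorem hasSum_oddTheta {τ : ℂ} (hτ : 0 < τ.im) :
    HasSum (fun N : ℕ ↦ (thetaCoeff N : ℂ) * nome τ ^ N) (oddTheta (τ / 3) / (2 * π * I)) := by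
  have hτ3 : 0 < (τ / 3).im := by simpa using hτ
  have h1 := ((hasSum_jacobiTheta₂'_term (1 / 2 + τ / 3 / 2) hτ3).add
    ((hasSum_jacobiTheta₂_term (1 / 2 + τ / 3 / 2) hτ3).mul_left (π * I))).mul_left
      (cexp (π * I * (τ / 3) / 4) / (2 * π * I))
  rw [jacobiTheta₂_half_add_half] at h1
  have hinj : Function.Injective (fun n : ℕ ↦ (2 * n + 1) ^ 2) := by
    intro m n h
    have := Nat.pow_left_injective two_ne_zero h
    omega
  rw [← hinj.hasSum_iff]
  · have h2 := h1.nat_add_neg_add_one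
    have hval : oddTheta (τ / 3) / (2 * π * I) = cexp (π * I * (τ / 3) / 4) / (2 * π * I) *
        (jacobiTheta₂' (1 / 2 + τ / 3 / 2) (τ / 3) + π * I * 0) := by
      rw [oddTheta]
      ring
    rw [hval]
    refine h2.congr_fun fun n ↦ ?_
    · have hpi : (π : ℂ) ≠ 0 := by exact_mod_cast Real.pi_ne_zero
      have hterm (m : ℤ) : cexp (π * I * (τ / 3) / 4) *
          jacobiTheta₂_term m (1 / 2 + τ / 3 / 2) (τ / 3) =
          (-1) ^ m * cexp (π * I * τ / 12 * (2 * m + 1) ^ 2) := by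
        rw [jacobiTheta₂_term, ← Complex.exp_pi_mul_I, ← Complex.exp_int_mul, ← Complex.exp_add,
          ← Complex.exp_add]
        congr 1
        ring
      have hterm' (m : ℤ) : cexp (π * I * (τ / 3) / 4) / (2 * π * I) *
          (jacobiTheta₂'_term m (1 / 2 + τ / 3 / 2) (τ / 3) +
          π * I * jacobiTheta₂_term m (1 / 2 + τ / 3 / 2) (τ / 3)) =
          (2 * m + 1) / 2 * ((-1) ^ m * cexp (π * I * τ / 12 * (2 * m + 1) ^ 2)) := by
        rw [← hterm, jacobiTheta₂'_term]
        field_simp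
      rw [hterm', hterm', Function.comp_apply, thetaCoeff_sq, chi_four_two_mul_add_one, nome_pow,
        nome]
      have hs : (-1 : ℂ) ^ (-((n : ℤ) + 1)) = - (-1) ^ n := by
        rw [zpow_neg, zpow_add_one₀ (by norm_num), zpow_natCast, mul_neg_one, inv_neg, ← inv_pow]
        norm_num
      rw [hs, zpow_natCast]
      push_cast
      rw [show (π * I * τ / 12 * (2 * -((n : ℂ) + 1) + 1) ^ 2) =
        π * I * τ / 12 * (2 * n + 1) ^ 2 by ring,
        show (π * I * ((2 * (n : ℂ) + 1) ^ 2 * τ) / 12) = π * I * τ / 12 * (2 * n + 1) ^ 2 by ring]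
      ring
  · intro N hN
    rw [thetaCoeff]
    split_ifs with h
    · have he : Even N.sqrt := by
        by_contra ho
        rw [Nat.not_even_iff_odd] at ho
        obtain ⟨k, hk⟩ := ho
        exact hN ⟨k, by simp only; rw [← hk, pow_two, h]⟩
      have : ZMod.χ₄ (N.sqrt : ZMod 4) = 0 := by
        rw [ZMod.χ₄_nat_eq_if_mod_four, if_pos (Nat.even_iff.mp he)]
      simp [this]
    · simp

section

/-- `f` is the sum on the unit disc of the power series `p`. -/
def Represents (p : PowerSeries ℂ) (f : ℂ → ℂ) : Prop :=
  ∀ w : ℂ, ‖w‖ < 1 → HasSum (fun n ↦ p.coeff n * w ^ n) (f w)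

namespace Represents

variable {p q : PowerSeries ℂ} {f g : ℂ → ℂ}

theorem sub (hp : Represents p f) (hq : Represents q g) :
    Represents (p - q) (fun w ↦ f w - g w) := fun w hw ↦ by
  simpa [sub_mul] using (hp w hw).sub (hq w hw)

theorem mul (hp : Represents p f) (hq : Represents q g) :
    Represents (p * q) (fun w ↦ f w * g w) := fun w hw ↦ by
  have h := summable_norm_sum_mul_antidiagonal_of_summable_norm
    (hp w hw).summable.norm (hq w hw).summable.norm
  have h2 := tsum_mul_tsum_eq_tsum_sum_antidiagonal_of_summable_norm
    (hp w hw).summable.norm (hq w hw).summable.norm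
  rw [(hp w hw).tsum_eq, (hq w hw).tsum_eq] at h2
  show HasSum _ (f w * g w)
  rw [h2]
  refine h.of_norm.hasSum.congr_fun fun n ↦ ?_
  rw [PowerSeries.coeff_mul, Finset.sum_mul]
  refine Finset.sum_congr rfl fun kl hkl ↦ ?_
  rw [← Finset.HasAntidiagonal.mem_antidiagonal.mp hkl, pow_add]
  ring

theorem one : Represents 1 (fun _ ↦ 1) := fun w _ ↦ by
  convert hasSum_single (f := fun n ↦ (1 : PowerSeries ℂ).coeff n * w ^ n) 0 ?_ using 1
  · simp
  · intro n hn
    simp [PowerSeries.coeff_one, hn]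

theorem X : Represents PowerSeries.X (fun w ↦ w) := fun w _ ↦ by
  convert hasSum_single (f := fun n ↦ (PowerSeries.X : PowerSeries ℂ).coeff n * w ^ n) 1 ?_ using 1
  · simp
  · intro n hn
    simp [PowerSeries.coeff_X, hn]

theorem pow (hp : Represents p f) (k : ℕ) : Represents (p ^ k) (fun w ↦ f w ^ k) := by
  induction k with
  | zero => simpa using one
  | succ k ih => simpa [pow_succ] using ih.mul hp

theorem const_mul (hp : Represents p f) (c : ℂ) :
    Represents (PowerSeries.C c * p) (fun w ↦ c * f w) := fun w hw ↦ by
  simpa [mul_assoc] using (hp w hw).mul_left c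

theorem hasFPowerSeriesOnBall (hp : Represents p f) :
    HasFPowerSeriesOnBall f (FormalMultilinearSeries.ofScalars ℂ (fun n ↦ p.coeff n)) 0 1 where
  r_le := by
    refine ENNReal.le_of_forall_nnreal_lt fun r hr ↦ ?_
    refine FormalMultilinearSeries.le_radius_of_tendsto (l := 0) _ ?_
    have h := (hp (r : ℝ) (by simpa using hr)).summable.norm.tendsto_atTop_zero
    simpa [FormalMultilinearSeries.ofScalars_norm] using h
  r_pos := one_pos
  hasSum {y} hy := by
    have hy' : ‖y‖ < 1 := by simpa [Metric.mem_eball, ← ofReal_norm] using hy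
    simpa [FormalMultilinearSeries.ofScalars_apply_eq, mul_comm] using hp y hy'

theorem unique (hp : Represents p f) (hq : Represents q g) (h : f =ᶠ[𝓝 0] g) : p = q := by
  have h1 := hp.hasFPowerSeriesOnBall.hasFPowerSeriesAt.congr h
  have h2 := h1.eq_formalMultilinearSeries hq.hasFPowerSeriesOnBall.hasFPowerSeriesAt
  ext n
  have := FormalMultilinearSeries.ofScalars_series_injective ℂ ℂ h2
  exact congrFun this n

theorem isBigO (hp : Represents p f) {k : ℕ} (hk : ∀ n < k, p.coeff n = 0) :
    f =O[𝓝 0] (fun w ↦ w ^ k) := by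
  have h := hp.hasFPowerSeriesOnBall.hasFPowerSeriesAt.isBigO_sub_partialSum_pow k
  refine (h.congr_left fun w ↦ ?_).trans (Asymptotics.isBigO_of_le _ (by simp))
  rw [zero_add, FormalMultilinearSeries.partialSum, Finset.sum_eq_zero, sub_zero]
  intro i hi
  simp [hk i (Finset.mem_range.mp hi)]

theorem differentiableAt (hp : Represents p f) {w : ℂ} (hw : ‖w‖ < 1) :
    DifferentiableAt ℂ f w :=
  hp.hasFPowerSeriesOnBall.differentiableOn.differentiableAt
    (Metric.isOpen_eball.mem_nhds (by simpa [Metric.mem_eball, ← ofReal_norm] using hw))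

theorem mul_deriv (hp : Represents p f) :
    Represents (.mk fun n ↦ n * p.coeff n) (fun w ↦ w * deriv f w) := fun w hw ↦ by
  obtain ⟨r, hwr, hr⟩ := exists_between hw
  have hr0 : 0 < r := (norm_nonneg w).trans_lt hwr
  have hU : IsOpen (Metric.ball (0 : ℂ) r) := Metric.isOpen_ball
  have hmem : w ∈ Metric.ball (0 : ℂ) r := by simpa using hwr
  have hsum := (hp r (by simpa [abs_of_pos hr0] using hr)).summable.norm
  have h := hasSum_deriv_of_summable_norm (F := fun n z ↦ p.coeff n * z ^ n) (z := w) hsum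
    (fun n ↦ by fun_prop) hU (fun n z hz ↦ by
      have : ‖z‖ ≤ r := by simpa using (le_of_lt (Metric.mem_ball.mp hz))
      simp only [norm_mul, norm_pow, Complex.norm_real, Real.norm_eq_abs, abs_of_pos hr0]
      gcongr) hmem
  have heq : (fun z ↦ ∑' n, p.coeff n * z ^ n) =ᶠ[𝓝 w] f := by
    filter_upwards [hU.mem_nhds hmem] with z hz
    exact (hp z ((by simpa using hz : ‖z‖ < r).trans hr)).tsum_eq
  rw [heq.deriv_eq] at h
  refine (h.mul_left w).congr_fun fun n ↦ ?_
  rw [deriv_const_mul_field, deriv_pow_field, PowerSeries.coeff_mk]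
  cases n with
  | zero => simp
  | succ n => simp only [Nat.add_sub_cancel, pow_succ]; ring

end Represents

end

theorem Represents.of_differentiableOn {f : ℂ → ℂ}
    (hf : DifferentiableOn ℂ f (Metric.ball 0 1)) :
    Represents (.mk fun n ↦ iteratedDeriv n f 0 / n.factorial) f := fun w hw ↦ by
  have h := hasSum_taylorSeries_on_ball hf (z := w) (by simpa using hw)
  refine h.congr_fun fun n ↦ ?_
  simp [div_eq_inv_mul]
  ring

theorem Represents.coeff_eq_iteratedDeriv {p : PowerSeries ℂ} {f : ℂ → ℂ} (hp : Represents p f)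
    (n : ℕ) : p.coeff n = iteratedDeriv n f 0 / n.factorial := by
  have hd : DifferentiableOn ℂ f (Metric.ball 0 1) := fun w hw ↦
    (hp.differentiableAt (by simpa using hw)).differentiableWithinAt
  rw [hp.unique (Represents.of_differentiableOn hd) (EventuallyEq.refl _ _), PowerSeries.coeff_mk]

theorem Represents.of_tendstoLocallyUniformlyOn {ι : Type*} {l : Filter ι} [l.NeBot]
    {p : ι → PowerSeries ℂ} {f : ι → ℂ → ℂ} {q : PowerSeries ℂ} {g : ℂ → ℂ}
    (hp : ∀ i, Represents (p i) (f i))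
    (hf : TendstoLocallyUniformlyOn f g l (Metric.ball 0 1))
    (hq : ∀ n, ∀ᶠ i in l, (p i).coeff n = q.coeff n) : Represents q g := by
  have hd : ∀ i, DifferentiableOn ℂ (f i) (Metric.ball 0 1) := fun i w hw ↦
    ((hp i).differentiableAt (by simpa using hw)).differentiableWithinAt
  have hg := hf.differentiableOn (.of_forall hd) Metric.isOpen_ball
  have hk : ∀ k, (∀ i, DifferentiableOn ℂ (iteratedDeriv k (f i)) (Metric.ball 0 1)) ∧
      TendstoLocallyUniformlyOn (fun i ↦ iteratedDeriv k (f i)) (iteratedDeriv k g) l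
      (Metric.ball 0 1) := by
    intro k
    induction k with
    | zero => exact ⟨by simpa using hd, by simpa using hf⟩
    | succ k ih =>
      simp only [iteratedDeriv_succ]
      exact ⟨fun i ↦ (ih.1 i).deriv Metric.isOpen_ball,
        ih.2.deriv (.of_forall ih.1) Metric.isOpen_ball⟩
  convert Represents.of_differentiableOn hg
  ext n
  rw [PowerSeries.coeff_mk]
  have h1 : Tendsto (fun i ↦ (p i).coeff n) l (𝓝 (iteratedDeriv n g 0 / n.factorial)) := by
    simp only [(hp _).coeff_eq_iteratedDeriv]
    exact ((hk n).2.tendsto_at (by simp)).div_const _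
  exact tendsto_nhds_unique (tendsto_nhds_of_eventually_eq (hq n)) h1

theorem Represents.prod {ι : Type*} {p : ι → PowerSeries ℂ} {f : ι → ℂ → ℂ} (s : Finset ι)
    (hp : ∀ i, Represents (p i) (f i)) :
    Represents (∏ i ∈ s, p i) (fun w ↦ ∏ i ∈ s, f i w) := by
  classical
  induction s using Finset.induction_on with
  | empty => simpa using Represents.one
  | insert i s hi ih => simpa [Finset.prod_insert hi] using (hp i).mul ih

theorem represents_pentagonalSeries :
    Represents (PowerSeries.pentagonalSeries ℂ) (fun q ↦ ∏' n : ℕ, (1 - q ^ (n + 1))) := by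
  refine Represents.of_tendstoLocallyUniformlyOn (l := atTop)
    (p := fun s : Finset ℕ ↦ ∏ n ∈ s, (1 - PowerSeries.X ^ (n + 1)))
    (f := fun s q ↦ ∏ n ∈ s, (1 - q ^ (n + 1)))
    (fun s ↦ Represents.prod s fun n ↦ Represents.one.sub (Represents.X.pow (n + 1))) ?_
    fun n ↦ PowerSeries.coeff_prod_one_sub_X_pow_eventually_eq ℂ n
  exact ModularForm.multipliableLocallyUniformlyOn_one_sub_pow.hasProdLocallyUniformlyOn

/-- Substitution of `w ^ d` in a power series. -/
theorem Represents.expand {p : PowerSeries ℂ} {f : ℂ → ℂ} (hp : Represents p f) {d : ℕ}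
    (hd : d ≠ 0) :
    Represents (.mk fun n ↦ if d ∣ n then p.coeff (n / d) else 0) (fun w ↦ f (w ^ d)) :=
  fun w hw ↦ by
  have h := hp (w ^ d) (by simpa using pow_lt_one₀ (norm_nonneg w) hw hd)
  have hinj : Function.Injective fun n : ℕ ↦ d * n := fun a b hab ↦
    Nat.eq_of_mul_eq_mul_left (Nat.pos_of_ne_zero hd) hab
  refine (hinj.hasSum_iff fun n hn ↦ ?_).mp (h.congr_fun fun n ↦ ?_)
  · have : ¬ d ∣ n := fun ⟨k, hk⟩ ↦ hn ⟨k, hk.symm⟩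
    simp [this]
  · simp [Nat.mul_div_cancel_left _ (Nat.pos_of_ne_zero hd), pow_mul]

section

theorem abs_thetaCoeff_le (N : ℕ) : |thetaCoeff N| ≤ N := by
  rw [thetaCoeff]
  split_ifs with h
  · rw [abs_mul, Nat.abs_cast]
    have h1 : |ZMod.χ₄ (N.sqrt : ZMod 4)| ≤ 1 := by
      generalize (N.sqrt : ZMod 4) = x
      revert x
      decide
    have h2 : (N.sqrt : ℤ) ≤ N := mod_cast N.sqrt_le_self
    nlinarith [abs_nonneg (ZMod.χ₄ (N.sqrt : ZMod 4))]
  · simp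

/-- The part of the odd theta series with exponents congruent to `r` modulo `24`. -/
noncomputable def thetaPart (r : ℕ) : PowerSeries ℂ :=
  .mk fun n ↦ if n % 24 = r then (thetaCoeff n : ℂ) else 0

/-- The function on the unit disc with power series `thetaPart r`. -/
noncomputable def thetaPartSum (r : ℕ) (w : ℂ) : ℂ := ∑' n, (thetaPart r).coeff n * w ^ n

theorem represents_thetaPart (r : ℕ) : Represents (thetaPart r) (thetaPartSum r) := fun w hw ↦ by
  refine Summable.hasSum (.of_norm_bounded (summable_pow_mul_geometric_of_norm_lt_one (R := ℝ) 1
    (r := ‖w‖) (by simpa using hw)) fun n ↦ ?_)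
  rw [thetaPart, PowerSeries.coeff_mk, norm_mul, norm_pow, pow_one]
  gcongr
  split_ifs
  · rw [Complex.norm_intCast]
    exact_mod_cast abs_thetaCoeff_le n
  · simp

theorem thetaCoeff_eq_zero_of_mod {N : ℕ} (h1 : N % 24 ≠ 1) (h9 : N % 24 ≠ 9) :
    thetaCoeff N = 0 := by
  by_cases h : ∃ m, N = m ^ 2
  · obtain ⟨m, rfl⟩ := h
    rw [thetaCoeff_sq]
    have : Even m := by
      by_contra ho
      rw [Nat.not_even_iff_odd] at ho
      have h2 : m % 24 < 24 := Nat.mod_lt _ (by norm_num)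
      have h3 : m % 2 = 1 := Nat.odd_iff.mp ho
      rw [Nat.pow_mod] at h1 h9
      have h4 : m % 24 % 2 = 1 := by omega
      generalize m % 24 = k at *
      interval_cases k <;> simp_all
    obtain ⟨k, rfl⟩ := this
    have : ZMod.χ₄ ((k + k : ℕ) : ZMod 4) = 0 := by
      rw [ZMod.χ₄_nat_eq_if_mod_four]
      simp [← two_mul]
    rw [this, zero_mul]
  · exact thetaCoeff_eq_zero fun m hm ↦ h ⟨m, hm⟩

theorem thetaPart_one_add_nine :
    thetaPart 1 + thetaPart 9 = .mk fun n ↦ (thetaCoeff n : ℂ) := by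
  ext n
  simp only [thetaPart, map_add, PowerSeries.coeff_mk]
  by_cases h1 : n % 24 = 1
  · simp [h1]
  · by_cases h9 : n % 24 = 9
    · simp [h9]
    · simp [h1, h9, thetaCoeff_eq_zero_of_mod h1 h9]

theorem thetaCoeff_nine_mul (M : ℕ) : thetaCoeff (9 * M) = -3 * thetaCoeff M := by
  by_cases h : ∃ m, M = m ^ 2
  · obtain ⟨m, rfl⟩ := h
    rw [show 9 * m ^ 2 = (3 * m) ^ 2 by ring, thetaCoeff_sq, thetaCoeff_sq, Nat.cast_mul, map_mul]
    have : ZMod.χ₄ ((3 : ℕ) : ZMod 4) = -1 := by decide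
    rw [this]
    push_cast
    ring
  · rw [thetaCoeff_eq_zero (N := M) fun m hm ↦ h ⟨m, hm⟩, mul_zero]
    refine thetaCoeff_eq_zero fun m hm ↦ h ?_
    have h3 : 3 ∣ m := Nat.prime_three.dvd_of_dvd_pow (n := 2) ⟨3 * M, by rw [← hm]; ring⟩
    obtain ⟨k, rfl⟩ := h3
    exact ⟨k, by nlinarith⟩

theorem nine_dvd_of_thetaCoeff_ne_zero {N : ℕ} (h9 : N % 24 = 9) (h : thetaCoeff N ≠ 0) :
    9 ∣ N := by
  by_contra hN
  refine h (thetaCoeff_eq_zero fun m hm ↦ hN ?_)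
  have h3 : 3 ∣ m := Nat.prime_three.dvd_of_dvd_pow (n := 2) (by omega)
  obtain ⟨k, rfl⟩ := h3
  exact ⟨k ^ 2, by rw [hm]; ring⟩

variable {τ : ℂ}

theorem thetaPartSum_one_add_nine (hτ : 0 < τ.im) :
    thetaPartSum 1 (nome τ) + thetaPartSum 9 (nome τ) = oddTheta (τ / 3) / (2 * π * I) := by
  have hw := norm_nome_lt_one hτ
  have h := (represents_thetaPart 1 _ hw).add (represents_thetaPart 9 _ hw)
  refine h.unique ((hasSum_oddTheta hτ).congr_fun fun n ↦ ?_)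
  rw [← add_mul, ← map_add, thetaPart_one_add_nine, PowerSeries.coeff_mk]

theorem thetaPartSum_nine (hτ : 0 < τ.im) :
    thetaPartSum 9 (nome τ) = -3 * (oddTheta (3 * τ) / (2 * π * I)) := by
  have hτ' : 0 < (9 * τ).im := by simpa using hτ
  have h := (hasSum_oddTheta hτ').mul_left (-3)
  rw [show 9 * τ / 3 = 3 * τ by ring] at h
  refine (represents_thetaPart 9 _ (norm_nome_lt_one hτ)).unique ?_
  have hinj : Function.Injective fun n : ℕ ↦ 9 * n := fun a b hab ↦ by simpa using hab
  refine (hinj.hasSum_iff fun n hn ↦ ?_).mp (h.congr_fun fun n ↦ ?_)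
  · rw [thetaPart, PowerSeries.coeff_mk]
    split_ifs with h9
    · have : thetaCoeff n = 0 := by
        by_contra hne
        obtain ⟨k, hk⟩ := nine_dvd_of_thetaCoeff_ne_zero h9 hne
        exact hn ⟨k, hk.symm⟩
      simp [this]
    · simp
  · have hw : nome (9 * τ) = nome τ ^ 9 := by rw [nome_pow]; norm_num
    have hc : (thetaPart 9).coeff (9 * n) = -3 * (thetaCoeff n : ℂ) := by
      rw [thetaPart, PowerSeries.coeff_mk, thetaCoeff_nine_mul]
      split_ifs with h9
      · push_cast; ring
      · have h0 : thetaCoeff n = 0 := by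
          by_contra hne
          have : n % 24 = 1 ∨ n % 24 = 9 := by
            by_contra! hcon
            exact hne (thetaCoeff_eq_zero_of_mod hcon.1 hcon.2)
          omega
        simp [h0]
    rw [Function.comp_apply, hc, hw, ← pow_mul]
    ring

/-- The Wronskian, with respect to `w d/dw`, of the two parts of the odd theta series. -/
noncomputable def thetaWronskian : PowerSeries ℂ :=
  thetaPart 1 * (.mk fun n ↦ n * (thetaPart 9).coeff n) -
    (.mk fun n ↦ n * (thetaPart 1).coeff n) * thetaPart 9

/-- The function on the unit disc with power series `thetaWronskian`. -/
noncomputable def thetaWronskianSum (w : ℂ) : ℂ :=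
  thetaPartSum 1 w * (w * deriv (thetaPartSum 9) w) -
    w * deriv (thetaPartSum 1) w * thetaPartSum 9 w

theorem represents_thetaWronskian : Represents thetaWronskian thetaWronskianSum :=
  ((represents_thetaPart 1).mul (represents_thetaPart 9).mul_deriv).sub
    ((represents_thetaPart 1).mul_deriv.mul (represents_thetaPart 9))

theorem coeff_thetaWronskian (n : ℕ) : thetaWronskian.coeff n =
    ((∑ kl ∈ Finset.HasAntidiagonal.antidiagonal n, if kl.1 % 24 = 1 ∧ kl.2 % 24 = 9 then
      thetaCoeff kl.1 * thetaCoeff kl.2 * (kl.2 - kl.1) else 0 : ℤ) : ℂ) := by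
  rw [thetaWronskian, map_sub, PowerSeries.coeff_mul, PowerSeries.coeff_mul,
    ← Finset.sum_sub_distrib]
  push_cast
  refine Finset.sum_congr rfl fun kl _ ↦ ?_
  simp only [thetaPart, PowerSeries.coeff_mk]
  by_cases h1 : kl.1 % 24 = 1 <;> by_cases h9 : kl.2 % 24 = 9 <;> simp [h1, h9]
  ring

theorem coeff_thetaWronskian_eq_zero {n : ℕ} (hn : n % 24 ≠ 10) : thetaWronskian.coeff n = 0 := by
  rw [coeff_thetaWronskian, Finset.sum_eq_zero, Int.cast_zero]
  intro kl hkl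
  rw [Finset.HasAntidiagonal.mem_antidiagonal] at hkl
  rw [if_neg]
  omega

end

section

variable {τ : ℂ}

theorem neg_one_div_im_pos (hτ : 0 < τ.im) : 0 < (-1 / τ).im := by
  have h := UpperHalfPlane.im_inv_neg_coe_pos ⟨τ, hτ⟩
  rwa [neg_div, one_div, ← inv_neg]

theorem hasDerivAt_nome (τ : ℂ) : HasDerivAt nome (π * I / 12 * nome τ) τ := by
  have h := (((hasDerivAt_id τ).const_mul (π * I)).div_const 12).cexp
  convert! h using 1
  simp [nome]
  ring

theorem hasDerivAt_thetaPartSum_nome (r : ℕ) (hτ : 0 < τ.im) :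
    HasDerivAt (fun t ↦ thetaPartSum r (nome t))
      (deriv (thetaPartSum r) (nome τ) * (π * I / 12 * nome τ)) τ :=
  ((represents_thetaPart r).differentiableAt (norm_nome_lt_one hτ)).hasDerivAt.comp τ
    (hasDerivAt_nome τ)

theorem thetaPartSum_nine_neg_inv (hτ : 0 < τ.im) :
    thetaPartSum 9 (nome (-1 / τ)) = -3 * (oddThetaFactor (τ / 3) *
      (thetaPartSum 1 (nome τ) + thetaPartSum 9 (nome τ))) := by
  have hτ3 : 0 < (τ / 3).im := by simpa using hτ
  rw [thetaPartSum_nine (neg_one_div_im_pos hτ), thetaPartSum_one_add_nine hτ,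
    show 3 * (-1 / τ) = -1 / (τ / 3) by rw [div_div_eq_mul_div]; ring, oddTheta_neg_inv hτ3]
  ring

theorem thetaPartSum_one_add_nine_neg_inv (hτ : 0 < τ.im) :
    thetaPartSum 1 (nome (-1 / τ)) + thetaPartSum 9 (nome (-1 / τ)) =
      -9 * (oddThetaFactor (τ / 3) * thetaPartSum 9 (nome τ)) := by
  have hτ3 : 0 < (3 * τ).im := by simpa using hτ
  rw [thetaPartSum_one_add_nine (neg_one_div_im_pos hτ), thetaPartSum_nine hτ,
    show -1 / τ / 3 = -1 / (3 * τ) by rw [div_div, mul_comm], oddTheta_neg_inv hτ3,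
    oddThetaFactor_three_mul]
  ring

theorem thetaWronskianSum_neg_inv (hτ : 0 < τ.im) :
    thetaWronskianSum (nome (-1 / τ)) = -I * τ ^ 5 * thetaWronskianSum (nome τ) := by
  have hτ0 : τ ≠ 0 := fun h ↦ by simp [h] at hτ
  have hτ3 : 0 < (τ / 3).im := by simpa using hτ
  have hev : ∀ᶠ t in 𝓝 τ, 0 < t.im := (isOpen_lt continuous_const continuous_im).mem_nhds hτ
  have hι : HasDerivAt (fun t : ℂ ↦ -1 / t) (τ ^ 2)⁻¹ τ := by
    convert! (hasDerivAt_inv hτ0).neg using 1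
    · ext t
      simp [neg_div]
    · simp
  have hS : HasDerivAt (fun t ↦ oddThetaFactor (t / 3)) (deriv oddThetaFactor (τ / 3) * (1 / 3))
      τ := (differentiableAt_oddThetaFactor hτ3).hasDerivAt.comp (h := fun t : ℂ ↦ t / 3) τ
      ((hasDerivAt_id' τ).div_const 3)
  have hα := hasDerivAt_thetaPartSum_nome 1 hτ
  have hβ := hasDerivAt_thetaPartSum_nome 9 hτ
  have hι' := neg_one_div_im_pos hτ
  have hα' := (hasDerivAt_thetaPartSum_nome 1 hι').comp τ hι
  have hβ' := (hasDerivAt_thetaPartSum_nome 9 hι').comp τ hι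
  have e1 := hβ'.unique (((hS.mul (hα.add hβ)).const_mul (-3)).congr_of_eventuallyEq
    (by filter_upwards [hev] with t ht using thetaPartSum_nine_neg_inv ht))
  have e2 := (hα'.add hβ').unique (((hS.mul hβ).const_mul (-9)).congr_of_eventuallyEq
    (by filter_upwards [hev] with t ht using thetaPartSum_one_add_nine_neg_inv ht))
  have e3 := thetaPartSum_nine_neg_inv hτ
  have e4 := thetaPartSum_one_add_nine_neg_inv hτ
  have hsq := oddThetaFactor_sq (τ / 3)
  have hpi : (π * I / 12 : ℂ) ≠ 0 := by simp [Real.pi_ne_zero]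
  simp only [thetaWronskianSum]
  simp only [Pi.add_apply] at e1 e2
  generalize oddThetaFactor (τ / 3) = S at *
  generalize deriv oddThetaFactor (τ / 3) * (1 / 3) = S' at *
  generalize thetaPartSum 1 (nome τ) = a at *
  generalize thetaPartSum 9 (nome τ) = b at *
  generalize thetaPartSum 1 (nome (-1 / τ)) = A at *
  generalize thetaPartSum 9 (nome (-1 / τ)) = B at *
  generalize deriv (thetaPartSum 1) (nome τ) = a' at *
  generalize deriv (thetaPartSum 9) (nome τ) = b' at *
  generalize deriv (thetaPartSum 1) (nome (-1 / τ)) = A' at *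
  generalize deriv (thetaPartSum 9) (nome (-1 / τ)) = B' at *
  generalize nome τ = w at *
  generalize nome (-1 / τ) = v at *
  generalize (π * I / 12 : ℂ) = k at *
  have key : (A + B) * (B' * (k * v) * (τ ^ 2)⁻¹) -
      (A' * (k * v) * (τ ^ 2)⁻¹ + B' * (k * v) * (τ ^ 2)⁻¹) * B =
      -27 * S ^ 2 * (k * (a * (w * b') - w * a' * b)) := by
    rw [e2, e1, e4, e3]
    ring
  rw [hsq] at key
  have : k * (A * (v * B') - v * A' * B) =
      k * (-I * τ ^ 5 * (a * (w * b') - w * a' * b)) := by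
    field_simp at key
    linear_combination (k / 27) * key
  exact mul_left_cancel₀ hpi this

theorem nome_add_one (τ : ℂ) : nome (τ + 1) = cexp (π * I / 12) * nome τ := by
  rw [nome, nome, ← Complex.exp_add]
  congr 1
  ring

theorem thetaWronskianSum_nome_add_one (hτ : 0 < τ.im) :
    thetaWronskianSum (nome (τ + 1)) = cexp (π * I / 12) ^ 10 * thetaWronskianSum (nome τ) := by
  have h1 := represents_thetaWronskian _ (norm_nome_lt_one (τ := τ + 1) (by simpa using hτ))
  have h2 := (represents_thetaWronskian _ (norm_nome_lt_one hτ)).mul_left (cexp (π * I / 12) ^ 10)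
  refine h1.unique (h2.congr_fun fun n ↦ ?_)
  by_cases hn : n % 24 = 10
  · have h24 : cexp (π * I / 12) ^ 24 = 1 := by
      rw [← Complex.exp_nat_mul, ← Complex.exp_two_pi_mul_I]
      congr 1
      push_cast
      ring
    rw [nome_add_one, mul_pow, ← Nat.div_add_mod n 24, hn, pow_add _ (24 * _) 10,
      pow_mul (cexp _), h24, one_pow, one_mul]
    ring
  · simp [coeff_thetaWronskian_eq_zero hn]

theorem thetaWronskianSum_nome_add_one_pow (hτ : 0 < τ.im) :
    thetaWronskianSum (nome (τ + 1)) ^ 12 = thetaWronskianSum (nome τ) ^ 12 := by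
  rw [thetaWronskianSum_nome_add_one hτ, mul_pow, ← pow_mul, ← Complex.exp_nat_mul]
  have : cexp (((10 * 12 : ℕ) : ℂ) * (π * I / 12)) = 1 := by
    rw [Complex.exp_eq_one_iff]
    exact ⟨5, by push_cast; ring⟩
  rw [this, one_mul]

end

/-- The quotient of the twelfth power of the theta Wronskian by the fifth power of the modular
discriminant. -/
noncomputable def wronskianQuotient (z : UpperHalfPlane) : ℂ :=
  thetaWronskianSum (nome z) ^ 12 / ModularForm.discriminant z ^ 5

theorem wronskianQuotient_slash_S :
    wronskianQuotient ∣[(0 : ℤ)] ModularGroup.S = wronskianQuotient := by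
  ext z
  have hD := congrFun ModularForm.discriminant_S_invariant z
  have hz : (z : ℂ) ≠ 0 := z.ne_zero
  rw [ModularForm.SL_slash_apply] at hD ⊢
  rw [UpperHalfPlane.modular_S_smul] at hD ⊢
  rw [ModularGroup.denom_S] at hD ⊢
  have hD' : ModularForm.discriminant ⟨(-(z : ℂ))⁻¹, z.im_inv_neg_coe_pos⟩ =
      z ^ 12 * ModularForm.discriminant z := by
    rw [← hD, mul_comm, mul_assoc, zpow_neg, zpow_ofNat, inv_mul_cancel₀ (pow_ne_zero _ hz),
      mul_one]
  have hW := thetaWronskianSum_neg_inv z.im_pos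
  rw [neg_div, one_div, ← inv_neg] at hW
  simp only [wronskianQuotient, neg_zero, zpow_zero, mul_one, hD', mul_pow]
  have hI : (-I) ^ 12 = 1 := by
    rw [show 12 = 4 * 3 by rfl, pow_mul, neg_pow, I_pow_four]; norm_num
  rw [hW, mul_pow, mul_pow, hI, one_mul, ← pow_mul, ← pow_mul,
    mul_div_mul_left _ _ (pow_ne_zero _ hz)]

theorem wronskianQuotient_slash_T :
    wronskianQuotient ∣[(0 : ℤ)] ModularGroup.T = wronskianQuotient := by
  ext z
  have hD := congrFun ModularForm.discriminant_T_invariant z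
  rw [ModularForm.SL_slash_apply, UpperHalfPlane.modular_T_smul] at hD ⊢
  have hden : UpperHalfPlane.denom (ModularGroup.T : GL (Fin 2) ℝ) z = 1 := by
    rw [ModularGroup.denom_apply]
    simp [ModularGroup.T]
  rw [hden, one_zpow, mul_one] at hD ⊢
  rw [wronskianQuotient, wronskianQuotient, hD, UpperHalfPlane.coe_vadd, add_comm,
    Complex.ofReal_one, thetaWronskianSum_nome_add_one_pow z.im_pos]

theorem tendsto_nome_atImInfty :
    Tendsto (fun z : UpperHalfPlane ↦ nome z) UpperHalfPlane.atImInfty (𝓝 0) := by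
  convert UpperHalfPlane.qParam_tendsto_atImInfty (h := 24) (by norm_num) using 2 with z
  rw [nome, Function.Periodic.qParam]
  congr 1
  push_cast
  ring

theorem thetaWronskian_coeff_lt {n : ℕ} (hn : n < 10) : thetaWronskian.coeff n = 0 :=
  coeff_thetaWronskian_eq_zero (by omega)

theorem norm_nome_pow (z : UpperHalfPlane) :
    ‖nome z ^ 24‖ = Real.exp (-2 * π * z.im) := by
  rw [nome_pow, nome, Complex.norm_exp]
  congr 1
  have : (π * I * ((24 : ℕ) * z) / 12 : ℂ) = ((2 * π : ℝ) : ℂ) * (I * z) := by push_cast; ring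
  rw [this, Complex.re_ofReal_mul]
  simp

theorem wronskianQuotient_isBoundedAtImInfty :
    UpperHalfPlane.IsBoundedAtImInfty wronskianQuotient := by
  have h1 := ((represents_thetaWronskian.isBigO fun n ↦ thetaWronskian_coeff_lt).comp_tendsto
    tendsto_nome_atImInfty).pow 12
  have h2 := ModularForm.exp_isBigO_discriminant.pow 5
  have h3 : (fun z : UpperHalfPlane ↦ thetaWronskianSum (nome z) ^ 12)
      =O[UpperHalfPlane.atImInfty] (fun z ↦ ModularForm.discriminant z ^ 5) := by
    refine h1.trans (Asymptotics.IsBigO.trans (Asymptotics.isBigO_of_le _ fun z ↦ ?_) h2)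
    rw [← norm_nome_pow]
    simp [← pow_mul]
  refine (h3.mul (Asymptotics.isBigO_refl
    (fun z ↦ (ModularForm.discriminant z ^ 5)⁻¹) _)).trans ?_
  refine Asymptotics.isBigO_of_le _ fun z ↦ ?_
  simp [mul_inv_cancel₀ (pow_ne_zero 5 (ModularForm.discriminant_ne_zero z))]

/-- `wronskianQuotient` as a modular form of level one and weight zero. -/
noncomputable def wronskianQuotientForm : ModularForm 𝒮ℒ 0 where
  toFun := wronskianQuotient
  slash_action_eq' A hA := by
    obtain ⟨A, rfl⟩ := hA
    exact SlashInvariantForm.slash_action_generators_SL2Z wronskianQuotient_slash_S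
      wronskianQuotient_slash_T A
  holo' := by
    rw [UpperHalfPlane.mdifferentiable_iff]
    have h : DifferentiableOn ℂ (fun t ↦ thetaWronskianSum (nome t) ^ 12 /
        (ModularForm.eta t ^ 24) ^ 5) UpperHalfPlane.upperHalfPlaneSet := fun z hz ↦ by
      refine DifferentiableAt.differentiableWithinAt (.div (.pow ?_ _) (.pow (.pow ?_ _) _) ?_)
      · exact (represents_thetaWronskian.differentiableAt (norm_nome_lt_one hz)).comp z
          (hasDerivAt_nome z).differentiableAt
      · exact ModularForm.differentiableAt_eta_of_mem_upperHalfPlaneSet hz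
      · exact pow_ne_zero _ (pow_ne_zero _ (ModularForm.eta_ne_zero hz))
    refine h.congr fun z hz ↦ ?_
    simp [wronskianQuotient, ModularForm.discriminant,
      UpperHalfPlane.ofComplex_apply_of_im_pos hz]
  bdd_at_cusps' hc := by
    rw [Subgroup.IsArithmetic.isCusp_iff_isCusp_SL2Z] at hc
    rw [OnePoint.isBoundedAt_iff_forall_SL2Z hc]
    intro γ _
    rw [SlashInvariantForm.slash_action_generators_SL2Z wronskianQuotient_slash_S
      wronskianQuotient_slash_T]
    exact wronskianQuotient_isBoundedAtImInfty

theorem exists_wronskian_eq_const_mul : ∃ K : ℂ, ∀ w : ℂ, ‖w‖ < 1 →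
    thetaWronskianSum w ^ 12 =
      K * (w ^ 10 * (∏' n : ℕ, (1 - (w ^ 24) ^ (n + 1))) ^ 10) ^ 12 := by
  obtain ⟨K, hK⟩ := ModularFormClass.levelOne_weight_zero_const wronskianQuotientForm
  refine ⟨K, fun w hw ↦ ?_⟩
  rcases eq_or_ne w 0 with rfl | hw0
  · simp [thetaWronskianSum]
  have him := Function.Periodic.im_invQParam_pos_of_norm_lt_one (h := 24) (by norm_num) hw hw0
  have hinv := Function.Periodic.qParam_right_inv (h := 24) (by norm_num) hw0
  set τ := Function.Periodic.invQParam 24 w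
  have hn : nome τ = w := by
    rw [← hinv, nome, Function.Periodic.qParam]
    congr 1
    push_cast
    ring
  have h := congrFun hK ⟨τ, him⟩
  change wronskianQuotient ⟨τ, him⟩ = K at h
  have hq : Function.Periodic.qParam 1 τ = w ^ 24 := by
    rw [← hn, nome_pow, nome, Function.Periodic.qParam]
    congr 1
    push_cast
    ring
  have hD := ModularForm.discriminant_eq_q_prod ⟨τ, him⟩
  simp only [ModularForm.eta_q, hq] at hD
  rw [(ModularForm.multipliable_one_sub_pow
    (by simpa using pow_lt_one₀ (norm_nonneg w) hw (by norm_num))).tprod_pow] at hD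
  rw [wronskianQuotient, div_eq_iff (pow_ne_zero _ (ModularForm.discriminant_ne_zero _)), hD] at h
  change thetaWronskianSum (nome τ) ^ 12 = _ at h
  rw [hn] at h
  rw [h]
  ring

theorem exists_eq_C_mul_of_pow_eq {p q : PowerSeries ℂ} {n : ℕ} (hn : 0 < n) (h : p ^ n = q ^ n) :
    ∃ c : ℂ, p = PowerSeries.C c * q := by
  have hζ := (Complex.isPrimitiveRoot_exp n hn.ne').map_of_injective
    (f := PowerSeries.C (R := ℂ)) PowerSeries.C_injective
  have h1 := hζ.pow_sub_pow_eq_prod_sub_mul p q hn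
  rw [h, sub_self, eq_comm, Finset.prod_eq_zero_iff] at h1
  obtain ⟨ζ, hmem, h2⟩ := h1
  have : NeZero n := ⟨hn.ne'⟩
  obtain ⟨i, -, rfl⟩ := hζ.eq_pow_of_pow_eq_one ((Polynomial.mem_nthRootsFinset hn _).mp hmem)
  exact ⟨_, by rw [sub_eq_zero.mp h2, ← map_pow]⟩

theorem exists_coeff_thetaWronskian_eq : ∃ c : ℂ, ∀ n : ℕ,
    thetaWronskian.coeff (24 * n + 10) = c * (PowerSeries.pentagonalSeries ℂ ^ 10).coeff n := by
  obtain ⟨K, hK⟩ := exists_wronskian_eq_const_mul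
  have hE := (represents_pentagonalSeries.pow 10).expand (d := 24) (by norm_num)
  have hU := ((Represents.X.pow 10).mul hE)
  have h := (represents_thetaWronskian.pow 12).unique ((hU.pow 12).const_mul K) <| by
    filter_upwards [Metric.ball_mem_nhds (0 : ℂ) one_pos] with w hw
    exact hK w (by simpa using hw)
  obtain ⟨k, rfl⟩ := IsAlgClosed.exists_pow_nat_eq K (n := 12) (by norm_num)
  rw [map_pow, ← mul_pow] at h
  obtain ⟨c, hc⟩ := exists_eq_C_mul_of_pow_eq (by norm_num) h
  refine ⟨c * k, fun n ↦ ?_⟩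
  rw [hc, ← mul_assoc, ← map_mul, PowerSeries.coeff_C_mul, PowerSeries.coeff_X_pow_mul,
    PowerSeries.coeff_mk, if_pos (dvd_mul_right _ _), Nat.mul_div_cancel_left _ (by norm_num)]

open scoped PowerSeries.WithPiTopology in
theorem coeff_pentagonalSeries_pow_ten {a : ℕ → ℤ}
    (ha : ∀ n N : ℕ, n ≤ N →
      a n = (((∏ m ∈ Finset.Icc 1 N, ((1 : Polynomial ℤ) - Polynomial.X ^ m)) ^ 10).coeff n))
    (n : ℕ) : (PowerSeries.pentagonalSeries ℂ ^ 10).coeff n = a n := by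
  have h1 := (PowerSeries.WithPiTopology.hasProd_one_sub_X_pow ℂ).tendsto_prod_nat
  have h2 := (PowerSeries.WithPiTopology.tendsto_iff_coeff_tendsto ℂ _ _ _).mp
    ((((continuous_pow 10).tendsto _).comp h1)) n
  refine tendsto_nhds_unique h2 (tendsto_nhds_of_eventually_eq ?_)
  filter_upwards [eventually_ge_atTop n] with N hN
  have h3 : (∏ i ∈ Finset.range N, (1 - PowerSeries.X ^ (i + 1)) : PowerSeries ℂ) =
      PowerSeries.map (Int.castRingHom ℂ)
        ((∏ m ∈ Finset.Icc 1 N, ((1 : Polynomial ℤ) - Polynomial.X ^ m) : Polynomial ℤ) :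
          PowerSeries ℤ) := by
    clear hN
    induction N with
    | zero => simp
    | succ N ih =>
      rw [Finset.prod_range_succ, Finset.prod_Icc_succ_top (by omega), ih]
      simp
  rw [Function.comp_apply, h3, ← map_pow, PowerSeries.coeff_map, ← Polynomial.coe_pow,
    Polynomial.coeff_coe, ha n N hN]
  rfl

/-- The Wronskian identity for the tenth power of the Euler product. -/
theorem sum_thetaCoeff_mul_thetaCoeff {a : ℕ → ℤ}
    (ha : ∀ n N : ℕ, n ≤ N →
      a n = (((∏ m ∈ Finset.Icc 1 N, ((1 : Polynomial ℤ) - Polynomial.X ^ m)) ^ 10).coeff n))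
    (n : ℕ) :
    ∑ kl ∈ Finset.HasAntidiagonal.antidiagonal (24 * n + 10),
      (if kl.1 % 24 = 1 ∧ kl.2 % 24 = 9 then
        thetaCoeff kl.1 * thetaCoeff kl.2 * (kl.2 - kl.1) else 0) = -24 * a n := by
  obtain ⟨c, hc⟩ := exists_coeff_thetaWronskian_eq
  simp only [coeff_pentagonalSeries_pow_ten ha, coeff_thetaWronskian] at hc
  have ha0 : a 0 = 1 := by simpa using ha 0 0 le_rfl
  have h0 := hc 0
  have h10 : ∑ kl ∈ Finset.HasAntidiagonal.antidiagonal (24 * 0 + 10),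
      (if kl.1 % 24 = 1 ∧ kl.2 % 24 = 9 then
        thetaCoeff kl.1 * thetaCoeff kl.2 * (kl.2 - kl.1) else 0) = -24 := by
    rw [Finset.sum_eq_single (1, 9)]
    · rw [show ((1, 9) : ℕ × ℕ) = (1 ^ 2, 3 ^ 2) by rfl]
      simp only [thetaCoeff_sq]
      decide
    · intro kl hkl hne
      rw [Finset.HasAntidiagonal.mem_antidiagonal] at hkl
      rw [if_neg]
      rintro ⟨h1, h9⟩
      exact hne (Prod.ext (by omega) (by omega))
    · intro h
      exact absurd (Finset.HasAntidiagonal.mem_antidiagonal.mpr (by norm_num)) h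
  rw [h10, ha0, Int.cast_one, mul_one] at h0
  have := hc n
  rw [← h0] at this
  exact_mod_cast this

end

/-- A character of order four of `ℤ[i]` modulo `3`, in terms of real and imaginary parts. -/
def charThree (x y : ZMod 3) : GaussianInt :=
  if x = 0 ∧ y = 0 then 0 else if y = 0 then 1 else if x = 0 then -1
  else if x = y then ⟨0, -1⟩ else ⟨0, 1⟩

/-- A sign on `ℤ[i]`, multiplicative on elements of odd norm, in terms of the parities of the real
and imaginary parts. -/
def charTwo (x y : ZMod 2) : GaussianInt :=
  if x = y then 0 else if y = 0 then 1 else -1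

/-- The Hecke character of conductor dividing `6` and infinity type `4`, as a function on `ℤ[i]`. -/
def hecke (z : GaussianInt) : GaussianInt :=
  charTwo z.re z.im * charThree z.re z.im * z ^ 4

theorem charThree_mul : ∀ x y x' y' : ZMod 3, charThree (x * x' - y * y') (x * y' + y * x') =
    charThree x y * charThree x' y' := by
  decide

theorem charTwo_mul : ∀ x y x' y' : ZMod 2, charTwo (x * x' - y * y') (x * y' + y * x') =
    charTwo x y * charTwo x' y' := by
  decide

theorem hecke_mul (z w : GaussianInt) : hecke (z * w) = hecke z * hecke w := by
  have h3 := charThree_mul z.re z.im w.re w.im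
  have h2 := charTwo_mul z.re z.im w.re w.im
  have hre : (z * w).re = z.re * w.re - z.im * w.im := by simp; ring
  have him : (z * w).im = z.re * w.im + z.im * w.re := by simp
  simp only [hecke, hre, him]
  push_cast
  rw [h2, h3]
  ring

theorem charThree_neg : ∀ x y : ZMod 3, charThree x (-y) = star (charThree x y) := by
  decide

theorem charTwo_neg : ∀ x y : ZMod 2, charTwo x (-y) = star (charTwo x y) := by
  decide

theorem hecke_star (z : GaussianInt) : hecke (star z) = star (hecke z) := by
  simp only [hecke, star_mul', star_pow, Zsqrtd.re_star, Zsqrtd.im_star, Int.cast_neg,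
    charThree_neg, charTwo_neg]

theorem hecke_natCast {p : ℕ} (h2 : p % 2 = 1) (h3 : p % 3 ≠ 0) :
    hecke p = (p : GaussianInt) ^ 4 := by
  have h2' : ((p : ℕ) : ZMod 2) = ((1 : ℕ) : ZMod 2) :=
    (ZMod.natCast_eq_natCast_iff' _ _ _).mpr h2
  have h3' : ((p : ℕ) : ZMod 3) ≠ 0 := by
    rw [Ne, ZMod.natCast_eq_zero_iff]
    omega
  simp [hecke, charTwo, charThree, h2', h3']

theorem hecke_three : hecke 3 = 0 := by
  decide

theorem hecke_eq_zero_of_even {z : GaussianInt} (hz : (2 : ℤ) ∣ z.norm) : hecke z = 0 := by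
  have : (z.re : ZMod 2) = z.im := by
    rw [ZMod.intCast_eq_intCast_iff_dvd_sub]
    rw [Zsqrtd.norm_def] at hz
    have h : Even (z.im - z.re) := by
      have h1 : Even (z.re * z.re - -1 * z.im * z.im) := even_iff_two_dvd.mpr hz
      simpa [parity_simps, iff_comm] using h1
    exact_mod_cast even_iff_two_dvd.mp h
  simp [hecke, charTwo, this]

theorem finite_norm_eq (N : ℕ) : {z : GaussianInt | z.norm = N}.Finite := by
  have hinj : Function.Injective fun z : GaussianInt ↦ (z.re, z.im) := fun z w h ↦ by
    simpa [Zsqrtd.ext_iff] using h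
  refine Set.Finite.of_finite_image (f := fun z : GaussianInt ↦ (z.re, z.im)) ?_ hinj.injOn
  refine Set.Finite.subset (Finset.finite_toSet
    (Finset.Icc (-(N : ℤ)) N ×ˢ Finset.Icc (-(N : ℤ)) N)) ?_
  rintro _ ⟨z, hz, rfl⟩
  rw [Set.mem_ofPred_eq, Zsqrtd.norm_def] at hz
  simp only [Finset.coe_product, Finset.coe_Icc, Set.mem_prod, Set.mem_Icc]
  refine ⟨⟨?_, ?_⟩, ?_, ?_⟩ <;> nlinarith [sq_nonneg (z.re - 1), sq_nonneg (z.re + 1),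
    sq_nonneg (z.im - 1), sq_nonneg (z.im + 1), Int.le_self_sq z.re, Int.le_self_sq z.im,
    Int.le_self_sq (-z.re), Int.le_self_sq (-z.im), sq_nonneg z.re, sq_nonneg z.im]

/-- The Gaussian integers of norm `N`. -/
noncomputable def normFinset (N : ℕ) : Finset GaussianInt := (finite_norm_eq N).toFinset

@[simp]
theorem mem_normFinset {N : ℕ} {z : GaussianInt} : z ∈ normFinset N ↔ z.norm = N := by
  simp [normFinset]

/-- The sum of the Hecke character over the elements of given norm. -/
noncomputable def heckeSum (N : ℕ) : GaussianInt := ∑ z ∈ normFinset N, hecke z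

open scoped Classical in
theorem sum_hecke_of_dvd {w : GaussianInt} {p M : ℕ} (hp : 0 < p) (hw : w.norm = p) :
    ∑ z ∈ normFinset (p * M) with w ∣ z, hecke z = hecke w * heckeSum M := by
  have hp' : (p : ℤ) ≠ 0 := by exact_mod_cast hp.ne'
  have hw0 : w ≠ 0 := fun h ↦ hp' (by rw [← hw, h, Zsqrtd.norm_zero])
  rw [heckeSum, Finset.mul_sum]
  symm
  refine Finset.sum_bij (fun z _ ↦ w * z) (fun z hz ↦ ?_) (fun z _ z' _ h ↦ mul_left_cancel₀ hw0 h)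
    (fun z hz ↦ ?_) (fun z _ ↦ (hecke_mul w z).symm)
  · rw [mem_normFinset] at hz
    simp [hw, hz]
  · rw [Finset.mem_filter, mem_normFinset] at hz
    obtain ⟨hz, z', rfl⟩ := hz
    rw [Zsqrtd.norm_mul, hw, Nat.cast_mul] at hz
    exact ⟨z', by simpa using mul_left_cancel₀ hp' hz, rfl⟩

theorem dvd_norm_of_natCast_dvd {z : GaussianInt} {p : ℕ} (h : (p : GaussianInt) ∣ z) :
    (p : ℤ) ^ 2 ∣ z.norm := by
  obtain ⟨w, rfl⟩ := h
  rw [Zsqrtd.norm_mul, Zsqrtd.norm_natCast, ← pow_two]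
  exact dvd_mul_right _ _

open scoped Classical in
theorem sum_hecke_of_natCast_dvd {p M : ℕ} (hp : 0 < p) :
    ∑ z ∈ normFinset (p * M) with (p : GaussianInt) ∣ z, hecke z =
      if p ∣ M then hecke p * heckeSum (M / p) else 0 := by
  split_ifs with h
  · obtain ⟨k, rfl⟩ := h
    rw [Nat.mul_div_cancel_left _ hp, ← mul_assoc]
    exact sum_hecke_of_dvd (Nat.mul_pos hp hp) (by rw [Zsqrtd.norm_natCast]; push_cast; rfl)
  · rw [Finset.sum_eq_zero]
    intro z hz
    rw [Finset.mem_filter, mem_normFinset] at hz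
    obtain ⟨hz, hd⟩ := hz
    have := dvd_norm_of_natCast_dvd hd
    rw [hz, pow_two] at this
    exact absurd (Nat.dvd_of_mul_dvd_mul_left hp (by exact_mod_cast this)) h

theorem heckeSum_two_mul (M : ℕ) : heckeSum (2 * M) = 0 :=
  Finset.sum_eq_zero fun z hz ↦ hecke_eq_zero_of_even (by
    rw [mem_normFinset] at hz
    rw [hz]
    push_cast
    exact dvd_mul_right _ _)

theorem norm_eq_mul_star (z : GaussianInt) : ((z.norm : ℤ) : GaussianInt) = z * star z :=
  Zsqrtd.norm_eq_mul_conj z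

theorem natCast_dvd_of_dvd_norm {p : ℕ} [Fact p.Prime] (hp : p % 4 = 3) {z : GaussianInt}
    (h : (p : ℤ) ∣ z.norm) : (p : GaussianInt) ∣ z := by
  have hpr := GaussianInt.prime_of_nat_prime_of_mod_four_eq_three p hp
  have h1 : (p : GaussianInt) ∣ z * star z := by
    rw [← norm_eq_mul_star]
    have h' := (Zsqrtd.intCast_dvd_intCast (d := -1) _ _).mpr h
    rwa [Int.cast_natCast] at h'
  rcases hpr.dvd_or_dvd h1 with h2 | h2
  · exact h2
  · obtain ⟨w, hw⟩ := h2
    exact ⟨star w, by rw [← star_star z, hw, star_mul', star_natCast]⟩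

theorem heckeSum_inert_mul {p : ℕ} (hpr : p.Prime) (hp : p % 4 = 3) (M : ℕ) :
    heckeSum (p * M) = if p ∣ M then hecke p * heckeSum (M / p) else 0 := by
  classical
  have : Fact p.Prime := ⟨hpr⟩
  rw [← sum_hecke_of_natCast_dvd hpr.pos, heckeSum, Finset.filter_true_of_mem]
  intro z hz
  rw [mem_normFinset] at hz
  exact natCast_dvd_of_dvd_norm hp (by rw [hz]; push_cast; exact dvd_mul_right _ _)

theorem prime_of_norm_eq_prime {w : GaussianInt} {p : ℕ} (hp : p.Prime) (hw : w.norm = p) :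
    Prime w := by
  refine Irreducible.prime ⟨fun hu ↦ ?_, fun a b hab ↦ ?_⟩
  · rw [← Zsqrtd.norm_eq_one_iff, hw] at hu
    simpa using hp.one_lt.ne' (by simpa using hu)
  · have h : a.norm.natAbs * b.norm.natAbs = p := by
      rw [← Int.natAbs_mul, ← Zsqrtd.norm_mul, ← hab, hw, Int.natAbs_natCast]
    rw [← Zsqrtd.norm_eq_one_iff, ← Zsqrtd.norm_eq_one_iff]
    rw [← h, Nat.prime_mul_iff] at hp
    tauto

theorem not_star_dvd_of_norm_eq_prime {w : GaussianInt} {p : ℕ} (hp : p.Prime) (hp2 : p ≠ 2)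
    (hw : w.norm = p) : ¬ star w ∣ w := by
  intro h
  have h1 : star w ∣ ((2 * w.re : ℤ) : GaussianInt) := by
    have : ((2 * w.re : ℤ) : GaussianInt) = w + star w := by
      ext <;> simp
      ring
    rw [this]
    exact dvd_add h dvd_rfl
  obtain ⟨k, hk⟩ := h1
  have h2 : (p : ℤ) ∣ 2 * w.re * (2 * w.re) := by
    have := congrArg Zsqrtd.norm hk
    rw [Zsqrtd.norm_intCast, Zsqrtd.norm_mul, Zsqrtd.norm_conj, hw] at this
    exact ⟨_, this⟩
  have hpz := Nat.prime_iff_prime_int.mp hp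
  have h3 : (p : ℤ) ∣ w.re := by
    have h4 : (p : ℤ) ∣ 2 * w.re := by
      rcases hpz.dvd_or_dvd h2 with h | h <;> exact h
    refine (hpz.dvd_or_dvd h4).resolve_left fun h5 ↦ hp2 ?_
    exact (Nat.prime_dvd_prime_iff_eq hp Nat.prime_two).mp (by exact_mod_cast h5)
  obtain ⟨r, hr⟩ := h3
  rw [Zsqrtd.norm_def] at hw
  have h6 : (p : ℤ) ∣ w.im := by
    have : (p : ℤ) ∣ w.im * w.im := ⟨1 - r * w.re, by rw [hr] at hw ⊢; linear_combination hw⟩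
    rcases hpz.dvd_or_dvd this with h | h <;> exact h
  obtain ⟨s, hs⟩ := h6
  have h7 : (p : ℤ) * (p * (r * r + s * s)) = p * 1 := by
    rw [hr, hs] at hw
    linear_combination hw
  have h8 := mul_left_cancel₀ hpz.ne_zero h7
  exact hpz.not_isUnit (IsUnit.of_mul_eq_one _ h8)

theorem heckeSum_split_mul {w : GaussianInt} {p : ℕ} (hp : p.Prime) (hp2 : p ≠ 2)
    (hw : w.norm = p) (M : ℕ) :
    heckeSum (p * M) = (hecke w + hecke (star w)) * heckeSum M -
      if p ∣ M then hecke p * heckeSum (M / p) else 0 := by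
  classical
  have hw' : (star w).norm = p := by rw [Zsqrtd.norm_conj, hw]
  have hpr := prime_of_norm_eq_prime hp hw
  have hpr' := prime_of_norm_eq_prime hp hw'
  have hpw : (p : GaussianInt) = w * star w := by
    rw [← norm_eq_mul_star, hw, Int.cast_natCast]
  rw [add_mul, ← sum_hecke_of_dvd hp.pos hw, ← sum_hecke_of_dvd hp.pos hw',
    ← sum_hecke_of_natCast_dvd hp.pos, heckeSum, Finset.sum_filter, Finset.sum_filter,
    Finset.sum_filter, ← Finset.sum_add_distrib, ← Finset.sum_sub_distrib]
  refine Finset.sum_congr rfl fun z hz ↦ ?_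
  rw [mem_normFinset] at hz
  have hor : w ∣ z ∨ star w ∣ z := by
    have h1 : w ∣ z * star z := by
      rw [← norm_eq_mul_star, hz, Nat.cast_mul, Int.cast_mul, Int.cast_natCast, hpw, mul_assoc]
      exact dvd_mul_right _ _
    refine (hpr.dvd_or_dvd h1).imp_right fun ⟨k, hk⟩ ↦ ⟨star k, ?_⟩
    rw [← star_star z, hk, star_mul']
  have hand : (p : GaussianInt) ∣ z ↔ w ∣ z ∧ star w ∣ z := by
    rw [hpw]
    refine ⟨fun h ↦ ⟨(dvd_mul_right _ _).trans h, (dvd_mul_left _ _).trans h⟩, ?_⟩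
    rintro ⟨⟨k, rfl⟩, h⟩
    exact mul_dvd_mul_left w
      ((hpr'.dvd_or_dvd h).resolve_left (not_star_dvd_of_norm_eq_prime hp hp2 hw))
  by_cases h1 : w ∣ z <;> by_cases h2 : star w ∣ z <;> simp_all

theorem normFinset_one : normFinset 1 = {⟨1, 0⟩, ⟨-1, 0⟩, ⟨0, 1⟩, ⟨0, -1⟩} := by
  ext z
  rw [mem_normFinset, Zsqrtd.norm_def]
  simp only [Finset.mem_insert, Finset.mem_singleton, Zsqrtd.ext_iff, Nat.cast_one]
  constructor
  · intro h
    have h1 : z.re ≤ 1 := by nlinarith [sq_nonneg z.im]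
    have h2 : -1 ≤ z.re := by nlinarith [sq_nonneg z.im]
    have h3 : z.im ≤ 1 := by nlinarith [sq_nonneg z.re]
    have h4 : -1 ≤ z.im := by nlinarith [sq_nonneg z.re]
    generalize z.re = x at *
    generalize z.im = y at *
    interval_cases x <;> interval_cases y <;> simp_all
  · rintro (⟨h1, h2⟩ | ⟨h1, h2⟩ | ⟨h1, h2⟩ | ⟨h1, h2⟩) <;> rw [h1, h2] <;> norm_num

theorem heckeSum_one : heckeSum 1 = 4 := by
  rw [heckeSum, normFinset_one]
  decide

theorem thetaCoeff_natAbs_sq (m : ℤ) : thetaCoeff (m.natAbs ^ 2) = ZMod.χ₄ m * m := by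
  rw [thetaCoeff_sq]
  rcases Int.natAbs_eq m with h | h
  · rw [← Int.cast_natCast, ← h]
  · generalize m.natAbs = k at h
    subst h
    have : ZMod.χ₄ (-1) = -1 := by decide
    push_cast
    rw [← neg_one_mul (k : ZMod 4), map_mul, this]
    ring

theorem natAbs_sq_mod_eq_one {m : ℤ} (h2 : m % 2 = 1) (h3 : m % 3 ≠ 0) :
    m.natAbs ^ 2 % 24 = 1 := by
  have h : m.natAbs % 24 = 1 ∨ m.natAbs % 24 = 5 ∨ m.natAbs % 24 = 7 ∨ m.natAbs % 24 = 11 ∨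
      m.natAbs % 24 = 13 ∨ m.natAbs % 24 = 17 ∨ m.natAbs % 24 = 19 ∨ m.natAbs % 24 = 23 := by
    omega
  rw [Nat.pow_mod]
  rcases h with h | h | h | h | h | h | h | h <;> rw [h]

theorem natAbs_sq_mod_eq_nine {m : ℤ} (h2 : m % 2 = 1) (h3 : m % 3 = 0) :
    m.natAbs ^ 2 % 24 = 9 := by
  have h : m.natAbs % 24 = 3 ∨ m.natAbs % 24 = 9 ∨ m.natAbs % 24 = 15 ∨ m.natAbs % 24 = 21 := by
    omega
  rw [Nat.pow_mod]
  rcases h with h | h | h | h <;> rw [h]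

/-- The squares of the coordinates of `(1 + i) z`. -/
def diagSq (z : GaussianInt) : ℕ × ℕ :=
  ((z.re - z.im).natAbs ^ 2, (z.re + z.im).natAbs ^ 2)

theorem diagSq_mem_antidiagonal {N : ℕ} {z : GaussianInt} (hz : z.norm = N) :
    diagSq z ∈ Finset.HasAntidiagonal.antidiagonal (2 * N) := by
  rw [Finset.HasAntidiagonal.mem_antidiagonal, diagSq]
  zify
  rw [sq_abs, sq_abs, ← hz, Zsqrtd.norm_def]
  ring

theorem filter_diagSq_eq {N m t : ℕ} (hm : Odd m) (ht : Odd t) (h : m ^ 2 + t ^ 2 = 2 * N) :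
    ∃ s : Finset GaussianInt, s.card = 4 ∧
      {z ∈ normFinset N | diagSq z = (m ^ 2, t ^ 2)} = s := by
  obtain ⟨b, rfl⟩ := hm
  obtain ⟨c, rfl⟩ := ht
  refine ⟨{⟨b + c + 1, c - b⟩, ⟨c - b, b + c + 1⟩, ⟨b - c, -(b + c + 1)⟩, ⟨-(b + c + 1), b - c⟩},
    ?_, ?_⟩
  · repeat rw [Finset.card_insert_of_notMem]
    · simp
    all_goals
      simp only [Finset.mem_insert, Finset.mem_singleton, Zsqrtd.ext_iff]
      omega
  · ext z
    simp only [Finset.mem_filter, mem_normFinset, diagSq, Prod.mk.injEq, Finset.mem_insert,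
      Finset.mem_singleton, Zsqrtd.ext_iff, Nat.pow_left_inj two_ne_zero]
    constructor
    · omega
    · intro hz
      refine ⟨?_, by omega⟩
      rw [Zsqrtd.norm_def]
      zify at h
      rcases hz with ⟨h1, h2⟩ | ⟨h1, h2⟩ | ⟨h1, h2⟩ | ⟨h1, h2⟩ <;> rw [h1, h2] <;>
        refine mul_left_cancel₀ (two_ne_zero' ℤ) ?_ <;> linear_combination h

theorem sum_diagSq {N : ℕ} {F : ℕ × ℕ → ℤ}
    (hF : ∀ kl, F kl ≠ 0 → ∃ m t, Odd m ∧ Odd t ∧ kl = (m ^ 2, t ^ 2)) :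
    ∑ z ∈ normFinset N, F (diagSq z) =
      4 * ∑ kl ∈ Finset.HasAntidiagonal.antidiagonal (2 * N), F kl := by
  rw [Finset.mul_sum, ← Finset.sum_fiberwise_of_maps_to (g := diagSq)
    (fun z hz ↦ diagSq_mem_antidiagonal (mem_normFinset.mp hz))]
  refine Finset.sum_congr rfl fun kl hkl ↦ ?_
  rw [Finset.sum_congr rfl (g := fun _ ↦ F kl) fun z hz ↦ by rw [(Finset.mem_filter.mp hz).2],
    Finset.sum_const, nsmul_eq_mul]
  by_cases h : F kl = 0
  · simp [h]
  · obtain ⟨m, t, hm, ht, rfl⟩ := hF kl h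
    obtain ⟨s, hs, hs'⟩ :=
      filter_diagSq_eq hm ht (Finset.HasAntidiagonal.mem_antidiagonal.mp hkl)
    rw [hs', hs]
    rfl

/-- The summand of the convolution of the two parts of the theta series. -/
def convTerm (kl : ℕ × ℕ) : ℤ :=
  if kl.1 % 24 = 1 ∧ kl.2 % 24 = 9 then thetaCoeff kl.1 * thetaCoeff kl.2 * (kl.2 - kl.1) else 0

theorem exists_eq_sq_of_convTerm_ne_zero {kl : ℕ × ℕ} (h : convTerm kl ≠ 0) :
    ∃ m t, Odd m ∧ Odd t ∧ kl = (m ^ 2, t ^ 2) := by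
  rw [convTerm] at h
  split_ifs at h with hc
  · by_contra! hne
    by_cases h1 : ∃ m, kl.1 = m ^ 2
    · by_cases h2 : ∃ t, kl.2 = t ^ 2
      · obtain ⟨m, hm⟩ := h1
        obtain ⟨t, ht⟩ := h2
        refine hne m t ?_ ?_ (Prod.ext hm ht)
        · rw [← Nat.odd_pow_iff two_ne_zero, ← hm, Nat.odd_iff]
          omega
        · rw [← Nat.odd_pow_iff two_ne_zero, ← ht, Nat.odd_iff]
          omega
      · push Not at h2
        simp [thetaCoeff_eq_zero h2] at h
    · push Not at h1
      simp [thetaCoeff_eq_zero h1] at h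
  · exact absurd rfl h

theorem charTwo_of_odd {z : GaussianInt} (h : (z.re + z.im) % 2 = 1) :
    charTwo z.re z.im = (ZMod.χ₄ ((z.re - z.im : ℤ) * (z.re + z.im : ℤ)) : ℤ) := by
  obtain ⟨x, y⟩ := z
  dsimp only at h ⊢
  have key : ∀ x y : ZMod 4, (x + y = 1 ∨ x + y = 3) →
      charTwo (x.cast) (y.cast) = (ZMod.χ₄ ((x - y) * (x + y)) : ℤ) := by
    decide
  have hx : ((x : ZMod 4).cast : ZMod 2) = x := ZMod.cast_intCast (by norm_num) x
  have hy : ((y : ZMod 4).cast : ZMod 2) = y := ZMod.cast_intCast (by norm_num) y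
  have := key x y (by
    have h4 : (x + y) % 4 = 1 ∨ (x + y) % 4 = 3 := by omega
    refine h4.imp (fun h ↦ ?_) (fun h ↦ ?_)
    · exact_mod_cast (ZMod.intCast_eq_intCast_iff _ 1 4).mpr h
    · exact_mod_cast (ZMod.intCast_eq_intCast_iff _ 3 4).mpr h)
  rw [hx, hy] at this
  rw [this]
  push_cast
  rfl

theorem convTerm_diagSq_of_mod {z : GaussianInt} (h2 : (z.re + z.im) % 2 = 1)
    (h3 : (z.re + z.im) % 3 = 0) (h3' : (z.re - z.im) % 3 ≠ 0) :
    convTerm (diagSq z) = ZMod.χ₄ ((z.re - z.im : ℤ) * (z.re + z.im : ℤ)) *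
      (4 * z.re * z.im * (z.re ^ 2 - z.im ^ 2)) := by
  have h2' : (z.re - z.im) % 2 = 1 := by omega
  rw [convTerm, diagSq, if_pos ⟨natAbs_sq_mod_eq_one h2' h3', natAbs_sq_mod_eq_nine h2 h3⟩,
    thetaCoeff_natAbs_sq, thetaCoeff_natAbs_sq, map_mul, Nat.cast_pow, Nat.cast_pow,
    Int.natAbs_sq, Int.natAbs_sq]
  ring

theorem convTerm_diagSq_eq_zero {z : GaussianInt} (h3 : (z.re - z.im) % 3 = 0) :
    convTerm (diagSq z) = 0 := by
  rw [convTerm, diagSq, if_neg]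
  rintro ⟨h, -⟩
  obtain ⟨k, hk⟩ := Int.dvd_of_emod_eq_zero h3
  dsimp only at h
  rw [hk, Int.natAbs_mul, mul_pow] at h
  simp at h
  omega

theorem hecke_add_hecke_star_aux {z : GaussianInt} (h2 : (z.re + z.im) % 2 = 1)
    (h3 : (z.re + z.im) % 3 = 0) (h3' : (z.re - z.im) % 3 ≠ 0) :
    hecke z + hecke (star z) =
      -2 * (convTerm (diagSq z) + convTerm (diagSq (star z)) : ℤ) := by
  rw [convTerm_diagSq_eq_zero (z := star z) (by simpa using h3), add_zero,
    convTerm_diagSq_of_mod h2 h3 h3', hecke_star, hecke, Int.cast_mul, ← charTwo_of_odd h2]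
  have hc : charThree z.re z.im = ⟨0, 1⟩ := by
    have hx : (z.re : ZMod 3) = -z.im := by
      rw [eq_neg_iff_add_eq_zero]
      exact_mod_cast (ZMod.intCast_zmod_eq_zero_iff_dvd _ 3).mpr (Int.dvd_of_emod_eq_zero h3)
    have hy : (z.im : ZMod 3) ≠ 0 := by
      rw [Ne, ZMod.intCast_zmod_eq_zero_iff_dvd]
      omega
    rw [hx]
    generalize (z.im : ZMod 3) = y at hy
    revert y
    decide
  have ht : star (charTwo z.re z.im) = charTwo z.re z.im := by
    generalize (z.re : ZMod 2) = x
    generalize (z.im : ZMod 2) = y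
    revert x y
    decide
  rw [hc, star_mul', star_mul', ht, mul_assoc, mul_assoc, ← mul_add, mul_left_comm]
  congr 1
  ext <;> simp [pow_succ] <;> ring

theorem hecke_add_hecke_star {n : ℕ} {z : GaussianInt} (hz : z.norm = (12 * n + 5 : ℕ)) :
    hecke z + hecke (star z) =
      -2 * (convTerm (diagSq z) + convTerm (diagSq (star z)) : ℤ) := by
  rw [Zsqrtd.norm_def] at hz
  have h2 : (z.re + z.im) % 2 = 1 := by
    rw [← Int.odd_iff]
    have : Odd (z.re * z.re - -1 * z.im * z.im) := by
      rw [hz, Int.odd_iff]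
      omega
    have h : Odd (z.re * z.re) ↔ Even z.im := by simpa [parity_simps] using this
    rw [Int.odd_mul, and_self] at h
    rwa [Int.odd_add]
  have hprod : ((z.re : ZMod 3) * z.re + z.im * z.im) = 2 := by
    have := congrArg (Int.cast : ℤ → ZMod 3) hz
    push_cast at this
    rw [show (12 : ZMod 3) = 0 by rfl, show (5 : ZMod 3) = 2 by rfl] at this
    linear_combination this
  have key : ∀ x y : ZMod 3, x * x + y * y = 2 →
      (x + y = 0 ∧ x - y ≠ 0) ∨ (x - y = 0 ∧ x + y ≠ 0) := by decide
  have h3 := key _ _ hprod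
  norm_cast at h3
  simp only [ZMod.intCast_zmod_eq_zero_iff_dvd] at h3
  push_cast at h3
  rcases h3 with h3 | h3
  · exact hecke_add_hecke_star_aux h2 (by omega) (by omega)
  · have := hecke_add_hecke_star_aux (z := star z) (by simp; omega) (by simp; omega)
      (by simp; omega)
    rw [star_star] at this
    rw [add_comm, this, add_comm (convTerm _)]

theorem heckeSum_eq_coeff {a : ℕ → ℤ}
    (ha : ∀ n N : ℕ, n ≤ N →
      a n = (((∏ m ∈ Finset.Icc 1 N, ((1 : Polynomial ℤ) - Polynomial.X ^ m)) ^ 10).coeff n))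
    (n : ℕ) : heckeSum (12 * n + 5) = ((192 * a n : ℤ) : GaussianInt) := by
  have hstar {M : Type} [AddCommMonoid M] (g : GaussianInt → M) :
      ∑ z ∈ normFinset (12 * n + 5), g (star z) = ∑ z ∈ normFinset (12 * n + 5), g z :=
    Finset.sum_bij' (fun z _ ↦ star z) (fun z _ ↦ star z) (by simp [Zsqrtd.norm_conj])
      (by simp [Zsqrtd.norm_conj]) (by simp) (by simp) (by simp)
  have h1 := sum_diagSq (N := 12 * n + 5) (fun _ ↦ exists_eq_sq_of_convTerm_ne_zero)
  have h2 := sum_thetaCoeff_mul_thetaCoeff ha n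
  rw [show 2 * (12 * n + 5) = 24 * n + 10 by ring] at h1
  change ∑ kl ∈ _, convTerm kl = _ at h2
  rw [h2] at h1
  have h3 := Finset.sum_congr rfl fun z (hz : z ∈ normFinset (12 * n + 5)) ↦
    hecke_add_hecke_star (mem_normFinset.mp hz)
  rw [Finset.sum_add_distrib, hstar, ← Finset.mul_sum, ← Int.cast_sum, Finset.sum_add_distrib,
    hstar (fun z ↦ convTerm (diagSq z)), h1] at h3
  have h20 : (2 : GaussianInt) ≠ 0 := by decide
  apply mul_left_cancel₀ h20
  rw [heckeSum, two_mul, h3]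
  push_cast
  ring

theorem hecke_of_odd_of_even {u v : ℕ} (hu : Odd u) (hv : Even v) :
    hecke ⟨u, v⟩ = charThree u v * ⟨u, v⟩ ^ 4 := by
  have hu' : (u : ZMod 2) = 1 := (ZMod.natCast_eq_one_iff_odd).mpr hu
  have hv' : (v : ZMod 2) = 0 := (ZMod.natCast_eq_zero_iff_even).mpr hv
  simp [hecke, charTwo, hu', hv']

theorem cast_zmod_three_eq {u k : ℕ} (h : u % 3 = k) : (u : ZMod 3) = k := by
  rw [← h, ZMod.natCast_mod]

theorem hecke_add_hecke_star_of_mod_five {p u v : ℕ} (hp : p % 12 = 5) (hu : Odd u) (hv : Even v)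
    (h : p = u ^ 2 + v ^ 2) :
    hecke ⟨u, v⟩ + hecke (star ⟨u, v⟩) = ((8 *
      (if (u % 6 = 1 ∧ v % 6 ≠ 4) ∨ (u % 6 ≠ 1 ∧ v % 6 = 4) then (-1 : ℤ) else 1) *
      u * v * ((u : ℤ) ^ 2 - (v : ℤ) ^ 2) : ℤ) : GaussianInt) := by
  rw [hecke_star, hecke_of_odd_of_even hu hv]
  rw [Nat.odd_iff] at hu
  rw [Nat.even_iff] at hv
  have h3 : (u ^ 2 + v ^ 2) % 3 = 2 := by omega
  rw [Nat.add_mod, Nat.pow_mod, Nat.pow_mod v] at h3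
  have hu3 : u % 3 = 0 ∨ u % 3 = 1 ∨ u % 3 = 2 := by omega
  have hv3 : v % 3 = 0 ∨ v % 3 = 1 ∨ v % 3 = 2 := by omega
  have h1 : charThree 1 1 = ⟨0, -1⟩ := by decide
  have h2 : charThree 1 2 = ⟨0, 1⟩ := by decide
  have h1' : charThree 2 1 = ⟨0, 1⟩ := by decide
  have h2' : charThree 2 2 = ⟨0, -1⟩ := by decide
  rcases hu3 with hu3 | hu3 | hu3 <;> rcases hv3 with hv3 | hv3 | hv3 <;>
    simp only [hu3, hv3] at h3 <;> norm_num at h3 <;>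
    rw [cast_zmod_three_eq hu3, cast_zmod_three_eq hv3]
  · rw [if_neg (by omega)]
    simp only [Nat.cast_one, h1]
    ext <;> simp [pow_succ] <;> ring
  · rw [if_pos (by omega)]
    simp only [Nat.cast_one, Nat.cast_ofNat, h2]
    ext <;> simp [pow_succ] <;> ring
  · rw [if_pos (by omega)]
    simp only [Nat.cast_one, Nat.cast_ofNat, h1']
    ext <;> simp [pow_succ] <;> ring
  · rw [if_neg (by omega)]
    simp only [Nat.cast_ofNat, h2']
    ext <;> simp [pow_succ] <;> ring

theorem hecke_add_hecke_star_of_mod_one {p u v : ℕ} (hp : p % 12 = 1) (hu : Odd u) (hv : Even v)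
    (h : p = u ^ 2 + v ^ 2) :
    hecke ⟨u, v⟩ + hecke (star ⟨u, v⟩) = ((2 * (if u % 6 = 3 then (1 : ℤ) else -1) *
      (2 * u * v + (u : ℤ) ^ 2 - (v : ℤ) ^ 2) *
      (2 * u * v + (v : ℤ) ^ 2 - (u : ℤ) ^ 2) : ℤ) : GaussianInt) := by
  rw [hecke_star, hecke_of_odd_of_even hu hv]
  rw [Nat.odd_iff] at hu
  have h3 : (u ^ 2 + v ^ 2) % 3 = 1 := by omega
  rw [Nat.add_mod, Nat.pow_mod, Nat.pow_mod v] at h3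
  by_cases hu3 : u % 3 = 0
  · have hv3 : (v : ZMod 3) ≠ 0 := by
      rw [Ne, ZMod.natCast_eq_zero_iff]
      intro hv3
      simp [hu3, Nat.mod_eq_zero_of_dvd hv3] at h3
    have hc : charThree u v = -1 := by
      simp [charThree, cast_zmod_three_eq hu3, hv3]
    rw [if_pos (by omega), hc]
    ext <;> simp [pow_succ] <;> ring
  · have hv3 : v % 3 = 0 := by
      have hu3 : u % 3 = 1 ∨ u % 3 = 2 := by omega
      have hv3 : v % 3 = 0 ∨ v % 3 = 1 ∨ v % 3 = 2 := by omega
      rcases hu3 with hu3 | hu3 <;> rcases hv3 with hv3 | hv3 | hv3 <;>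
        simp [hu3, hv3] at h3 ⊢
    have hu3' : (u : ZMod 3) ≠ 0 := by
      rw [Ne, ZMod.natCast_eq_zero_iff]
      omega
    have hc : charThree u v = 1 := by
      simp [charThree, cast_zmod_three_eq hv3, hu3']
    rw [if_neg (by omega), hc]
    ext <;> simp [pow_succ] <;> ring

theorem map_prime_mul {f : ℕ → ℤ}
    (hfmul : ∀ m n : ℕ, Nat.Coprime m n → f (m * n) = f m * f n) {p : ℕ} (hp : p.Prime) {d : ℤ}
    (hrec : ∀ r, f (p ^ (r + 2)) = f p * f (p ^ (r + 1)) - d * f (p ^ r)) {M : ℕ} (hM : M ≠ 0) :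
    f (p * M) = f p * f M - if p ∣ M then d * f (M / p) else 0 := by
  obtain ⟨k, m, hm, rfl⟩ := Nat.exists_eq_pow_mul_and_not_dvd hM p hp.ne_one
  have hco (r : ℕ) : f (p ^ r * m) = f (p ^ r) * f m :=
    hfmul _ _ (((Nat.Prime.coprime_iff_not_dvd hp).mpr hm).pow_left r)
  cases k with
  | zero =>
    have := hco 1
    rw [pow_one] at this
    rw [pow_zero, one_mul, if_neg hm, this, sub_zero]
  | succ r =>
    have h1 : p * (p ^ (r + 1) * m) = p ^ (r + 2) * m := by ring
    have h2 : p ^ (r + 1) * m = p * (p ^ r * m) := by ring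
    rw [h1, if_pos ⟨_, h2⟩, hco, hco (r + 1), h2, Nat.mul_div_cancel_left _ hp.pos, hco, hrec]
    ring

theorem exists_sq_add_sq {p : ℕ} (hp : p.Prime) (h4 : p % 4 = 1) :
    ∃ u v : ℕ, 0 < u ∧ 0 < v ∧ Odd u ∧ Even v ∧ p = u ^ 2 + v ^ 2 := by
  have : Fact p.Prime := ⟨hp⟩
  obtain ⟨x, y, h⟩ := Nat.Prime.sq_add_sq (p := p) (by omega)
  have hodd : Odd x ↔ Even y := by
    rw [← Nat.odd_pow_iff two_ne_zero, ← Nat.even_pow' two_ne_zero, ← Nat.odd_add, h, Nat.odd_iff]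
    omega
  have hpos {x y : ℕ} (h : x ^ 2 + y ^ 2 = p) : 0 < x := by
    rw [Nat.pos_iff_ne_zero]
    rintro rfl
    refine hp.not_isSquare ⟨y, ?_⟩
    rw [← h]
    ring
  have hx := hpos h
  have hy := hpos ((add_comm _ _).trans h)
  rcases Nat.even_or_odd y with hy' | hy'
  · refine ⟨x, y, hx, hy, hodd.mpr hy', hy', h.symm⟩
  · refine ⟨y, x, hy, hx, hy', ?_, by rw [← h, add_comm]⟩
    rwa [← Nat.not_odd_iff_even, hodd, Nat.not_even_iff_odd]

theorem heckeSum_eq_four_mul {f : ℕ → ℤ} (hf1 : f 1 = 1)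
    (hfmul : ∀ m n : ℕ, Nat.Coprime m n → f (m * n) = f m * f n)
    (hrec : ∀ p : ℕ, p.Prime → ∃ d : ℤ,
      (∀ r, f (p ^ (r + 2)) = f p * f (p ^ (r + 1)) - d * f (p ^ r)) ∧
      ∀ M, heckeSum (p * M) = f p * heckeSum M - if p ∣ M then d * heckeSum (M / p) else 0)
    {N : ℕ} (hN : N ≠ 0) : heckeSum N = ((4 * f N : ℤ) : GaussianInt) := by
  induction N using Nat.strong_induction_on with
  | _ N ih =>
    by_cases hN1 : N = 1
    · rw [hN1, heckeSum_one, hf1]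
      rfl
    · obtain ⟨p, hp, M, rfl⟩ := Nat.exists_prime_and_dvd hN1
      have hM : M ≠ 0 := right_ne_zero_of_mul hN
      have hlt : M < p * M := lt_mul_of_one_lt_left (Nat.pos_of_ne_zero hM) hp.one_lt
      obtain ⟨d, hd, hs⟩ := hrec p hp
      rw [hs, map_prime_mul hfmul hp hd hM, ih M hlt hM]
      split_ifs with h
      · have hM' : M / p ≠ 0 := (Nat.div_pos (Nat.le_of_dvd (Nat.pos_of_ne_zero hM) h) hp.pos).ne'
        rw [ih (M / p) ((Nat.div_le_self M p).trans_lt hlt) hM']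
        push_cast
        ring
      · push_cast
        ring

theorem sq_add_sq_unique {p : ℕ} (hp : p.Prime) {u v u' v' : ℕ} (hu : Odd u) (hv : Even v)
    (hu' : Odd u') (hv' : Even v') (h : p = u ^ 2 + v ^ 2) (h' : p = u' ^ 2 + v' ^ 2) :
    u = u' ∧ v = v' := by
  have hw : (⟨u, v⟩ : GaussianInt).norm = p := by
    rw [Zsqrtd.norm_def, h]
    push_cast
    ring
  have hw' : (⟨u', v'⟩ : GaussianInt).norm = p := by
    rw [Zsqrtd.norm_def, h']
    push_cast
    ring
  have key {z w : GaussianInt} (hz : z.norm = p) (hw : w.norm = p) (h : z ∣ w) (hz1 : Odd z.re)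
      (hz2 : Even z.im) (hw1 : Odd w.re) (hw2 : Even w.im) :
      z.re.natAbs = w.re.natAbs ∧ z.im.natAbs = w.im.natAbs := by
    obtain ⟨e, rfl⟩ := h
    rw [Zsqrtd.norm_mul, hz] at hw
    have he : e.norm = (1 : ℕ) := by
      exact_mod_cast (mul_eq_left₀ (by exact_mod_cast hp.ne_zero)).mp hw
    rw [← mem_normFinset, normFinset_one] at he
    simp only [Finset.mem_insert, Finset.mem_singleton] at he
    rcases he with rfl | rfl | rfl | rfl <;>
      simp [Int.even_iff, Int.odd_iff] at * <;> omega
  have hpw : (p : GaussianInt) = ⟨u, v⟩ * star ⟨u, v⟩ := by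
    rw [← norm_eq_mul_star, hw, Int.cast_natCast]
  have hdvd : (⟨u', v'⟩ : GaussianInt) ∣ ⟨u, v⟩ * star ⟨u, v⟩ := by
    rw [← hpw]
    exact ⟨star _, by rw [← norm_eq_mul_star, hw', Int.cast_natCast]⟩
  rcases (prime_of_norm_eq_prime hp hw').dvd_or_dvd hdvd with h1 | h1
  · have := key hw' hw h1 (by simpa) (by simpa) (by simpa) (by simpa)
    simp only [Int.natAbs_natCast] at this
    exact ⟨this.1.symm, this.2.symm⟩
  · have := key hw' (by rw [Zsqrtd.norm_conj, hw]) h1 (by simpa) (by simpa) (by simpa) (by simpa)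
    simp only [Zsqrtd.re_star, Zsqrtd.im_star, Int.natAbs_neg, Int.natAbs_natCast] at this
    exact ⟨this.1.symm, this.2.symm⟩

end EtaTen

/-- Tenth power: with `a n` the coefficient of `q^n` in `∏ (1 - q^m)^{10}`,
and `f` the multiplicative function determined by the stated initial values
and the recurrence `f(p^r) = f(p) f(p^{r-1}) - p^4 f(p^{r-2})`, we have
`48 a_n = f (12 n + 5)` for all `n`; moreover for each prime `p ≡ 1 (mod 4)`
the representing pair `(u, v)` with `p = u² + v²`, `u` odd, `v` even, is
unique. -/
theorem stmt_17 (a : ℕ → ℤ)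
    (ha : ∀ n N : ℕ, n ≤ N →
      a n = (((∏ m ∈ Finset.Icc 1 N, ((1 : Polynomial ℤ) - Polynomial.X ^ m)) ^ 10).coeff n))
    (f : ℕ → ℤ)
    (hf1 : f 1 = 1)
    (hfmul : ∀ m n : ℕ, Nat.Coprime m n → f (m * n) = f m * f n)
    (hfa : ∀ p r : ℕ, p.Prime → 1 ≤ r → (p % 12 = 7 ∨ p % 12 = 11) → Even r →
      f (p ^ r) = (p : ℤ) ^ (2 * r))
    (hfb : ∀ p r : ℕ, p.Prime → 1 ≤ r → (p % 12 = 7 ∨ p % 12 = 11) → Odd r →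
      f (p ^ r) = 0)
    (hfc : ∀ r : ℕ, 1 ≤ r → f (2 ^ r) = 0 ∧ f (3 ^ r) = 0)
    (hfd : ∀ p u v : ℕ, p.Prime → p % 12 = 5 → 0 < u → 0 < v →
      Odd u → Even v → p = u ^ 2 + v ^ 2 →
      f p = 8 *
        (if (u % 6 = 1 ∧ v % 6 ≠ 4) ∨ (u % 6 ≠ 1 ∧ v % 6 = 4) then (-1 : ℤ) else 1) *
        u * v * ((u : ℤ) ^ 2 - (v : ℤ) ^ 2))
    (hfe : ∀ p u v : ℕ, p.Prime → p % 12 = 1 → 0 < u → 0 < v →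
      Odd u → Even v → p = u ^ 2 + v ^ 2 →
      f p = 2 * (if u % 6 = 3 then (1 : ℤ) else -1) *
        (2 * u * v + (u : ℤ) ^ 2 - (v : ℤ) ^ 2) *
        (2 * u * v + (v : ℤ) ^ 2 - (u : ℤ) ^ 2))
    (hfrec : ∀ p r : ℕ, p.Prime → (p % 12 = 1 ∨ p % 12 = 5) → 2 ≤ r →
      f (p ^ r) = f p * f (p ^ (r - 1)) - (p : ℤ) ^ 4 * f (p ^ (r - 2))) :
    (∀ p : ℕ, p.Prime → p % 4 = 1 →
      ∃! uv : ℕ × ℕ, 0 < uv.1 ∧ 0 < uv.2 ∧ Odd uv.1 ∧ Even uv.2 ∧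
        p = uv.1 ^ 2 + uv.2 ^ 2) ∧
    ∀ n : ℕ, 48 * a n = f (12 * n + 5) := by
  have hrec : ∀ p : ℕ, p.Prime → ∃ d : ℤ,
      (∀ r, f (p ^ (r + 2)) = f p * f (p ^ (r + 1)) - d * f (p ^ r)) ∧
      ∀ M, EtaTen.heckeSum (p * M) =
        f p * EtaTen.heckeSum M - if p ∣ M then d * EtaTen.heckeSum (M / p) else 0 := by
    intro p hp
    rcases eq_or_ne p 2 with rfl | hp2
    · have h2 : f 2 = 0 := by simpa using (hfc 1 le_rfl).1
      exact ⟨0, fun r ↦ by simp [h2, (hfc (r + 2) (by omega)).1],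
        fun M ↦ by simp [h2, EtaTen.heckeSum_two_mul]⟩
    rcases eq_or_ne p 3 with rfl | hp3
    · have h3 : f 3 = 0 := by simpa using (hfc 1 le_rfl).2
      refine ⟨0, fun r ↦ by simp [h3, (hfc (r + 2) (by omega)).2], fun M ↦ ?_⟩
      rw [EtaTen.heckeSum_inert_mul hp (by norm_num)]
      simp [h3, EtaTen.hecke_three]
    have h2 : p % 2 = 1 := Nat.odd_iff.mp (hp.odd_of_ne_two hp2)
    have h3 : p % 3 ≠ 0 := fun h ↦
      hp3 ((Nat.prime_dvd_prime_iff_eq Nat.prime_three hp).mp (Nat.dvd_of_mod_eq_zero h)).symm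
    have hmod : (p % 12 = 1 ∨ p % 12 = 5) ∨ (p % 12 = 7 ∨ p % 12 = 11) := by omega
    rcases hmod with hmod | hmod
    · obtain ⟨u, v, hu, hv, hou, hev, huv⟩ := EtaTen.exists_sq_add_sq hp (by omega)
      have hfp : EtaTen.hecke ⟨u, v⟩ + EtaTen.hecke (star ⟨u, v⟩) = f p := by
        rcases hmod with h | h
        · rw [hfe p u v hp h hu hv hou hev huv]
          exact EtaTen.hecke_add_hecke_star_of_mod_one h hou hev huv
        · rw [hfd p u v hp h hu hv hou hev huv]
          exact EtaTen.hecke_add_hecke_star_of_mod_five h hou hev huv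
      refine ⟨p ^ 4, fun r ↦ hfrec p (r + 2) hp hmod (by omega), fun M ↦ ?_⟩
      rw [EtaTen.heckeSum_split_mul (w := ⟨u, v⟩) hp hp2
        (by rw [Zsqrtd.norm_def, huv]; push_cast; ring), hfp, EtaTen.hecke_natCast h2 h3]
      push_cast
      rfl
    · have hfp : f p = 0 := by simpa using hfb p 1 hp le_rfl hmod odd_one
      refine ⟨-p ^ 4, fun r ↦ ?_, fun M ↦ ?_⟩
      · rcases Nat.even_or_odd r with hr | hr
        · rw [hfa p (r + 2) hp (by omega) hmod (hr.add even_two), hfp]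
          rcases Nat.eq_zero_or_pos r with rfl | hr0
          · simp [hf1]
          · rw [hfa p r hp hr0 hmod hr]
            ring
        · rw [hfb p (r + 2) hp (by omega) hmod (hr.add_even even_two), hfb p r hp hr.pos hmod hr,
            hfp]
          ring
      · rw [EtaTen.heckeSum_inert_mul hp (by omega), EtaTen.hecke_natCast h2 h3, hfp]
        split_ifs <;> simp
  refine ⟨fun p hp h4 ↦ ?_, fun n ↦ ?_⟩
  · obtain ⟨u, v, hu, hv, hou, hev, huv⟩ := EtaTen.exists_sq_add_sq hp h4
    refine ⟨(u, v), ⟨hu, hv, hou, hev, huv⟩, ?_⟩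
    rintro ⟨u', v'⟩ ⟨-, -, hou', hev', huv'⟩
    obtain ⟨h1, h2⟩ := EtaTen.sq_add_sq_unique hp hou' hev' hou hev huv' huv
    exact Prod.ext h1 h2
  · have h1 := EtaTen.heckeSum_eq_coeff ha n
    rw [EtaTen.heckeSum_eq_four_mul hf1 hfmul hrec (by omega)] at h1
    have h2 := congrArg Zsqrtd.re h1
    simp only [Zsqrtd.re_intCast] at h2
    omega
end
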